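/- arXiv:0902.3637 — 3 statements merged into one kernel-verified Lean document; each statement's English description precedes it below -/
import Mathlib

section
/- Let 𝓜 be a left-aligned stack polyomino, s a tuple of nonnegative integers indexed by the columns of 𝓜, and A a set of rows of 𝓜. Then there exists a bijection φ: F(𝓜,s;A) → F(𝓜,s;A) such that maj(M) = ne(φ(M)) for every M ∈ F(𝓜,s;A), and moreover φ leaves the top nonempty row unchanged: for every M, the fillings M and φ(M) agree on the topmost nonempty row. -/
open Polynomial

namespace MoonPolyomino

/-- A cell `(r, c)` of `ℤ²`: `r` is the row index (rows increase downwards)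
and `c` is the column index (columns increase to the right). -/
abbrev Cell : Type := ℤ × ℤ

/-- The set of (indices of) rows of a polyomino. -/
def rowSet (P : Finset Cell) : Finset ℤ := P.image Prod.fst

/-- The set of (indices of) columns of a polyomino. -/
def colSet (P : Finset Cell) : Finset ℤ := P.image Prod.snd

/-- The length of row `r` of `P`. -/
def rowLen (P : Finset Cell) (r : ℤ) : ℕ := (P.filter fun x => x.1 = r).card

/-- The length of column `c` of `P`. -/
def colLen (P : Finset Cell) (c : ℤ) : ℕ := (P.filter fun x => x.2 = c).card

def RowConvex (P : Finset Cell) : Prop :=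
  ∀ r c₁ c₂ c : ℤ, (r, c₁) ∈ P → (r, c₂) ∈ P → c₁ ≤ c → c ≤ c₂ → (r, c) ∈ P

def ColConvex (P : Finset Cell) : Prop :=
  ∀ c r₁ r₂ r : ℤ, (r₁, c) ∈ P → (r₂, c) ∈ P → r₁ ≤ r → r ≤ r₂ → (r, c) ∈ P

/-- Any two columns are comparable (the rows met by one form a subset of those met
by the other). -/
def IntersectionFree (P : Finset Cell) : Prop :=
  ∀ c₁ c₂ : ℤ, (∀ r : ℤ, (r, c₁) ∈ P → (r, c₂) ∈ P) ∨ (∀ r : ℤ, (r, c₂) ∈ P → (r, c₁) ∈ P)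

/-- A moon polyomino: a convex intersection-free polyomino. -/
def IsMoon (P : Finset Cell) : Prop := RowConvex P ∧ ColConvex P ∧ IntersectionFree P

/-- A left-aligned stack polyomino: all rows have their leftmost cell in the same column. -/
def LeftAligned (P : Finset Cell) : Prop := ∃ c₀ : ℤ, ∀ x ∈ P, c₀ ≤ x.2 ∧ (x.1, c₀) ∈ P

/-- A top-aligned stack polyomino: all columns have their topmost cell in the same row. -/
def TopAligned (P : Finset Cell) : Prop := ∃ r₀ : ℤ, ∀ x ∈ P, r₀ ≤ x.1 ∧ (r₀, x.2) ∈ P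

/-- A 01-filling of `P`, identified with its set `M` of 1-cells: at most one 1 in each row. -/
def IsFilling (P M : Finset Cell) : Prop :=
  M ⊆ P ∧ ∀ x ∈ M, ∀ y ∈ M, x.1 = y.1 → x = y

open scoped Classical in
/-- `F(𝓜, s; A)`: the 01-fillings of `P` in which column `c` contains exactly `s c` ones
and whose empty rows are exactly the rows in `A`. -/
noncomputable def FillSet (P : Finset Cell) (s : ℤ → ℕ) (A : Finset ℤ) :
    Finset (Finset Cell) :=
  P.powerset.filter fun M =>
    (∀ x ∈ M, ∀ y ∈ M, x.1 = y.1 → x = y) ∧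
    (∀ c ∈ colSet P, (M.filter fun x => x.2 = c).card = s c) ∧
    (∀ r ∈ rowSet P, (r ∈ A ↔ ∀ x ∈ M, x.1 ≠ r))

open scoped Classical in
/-- `ne(M)`: the number of north-east chains, i.e. pairs of 1-cells, one strictly above and
strictly to the right of the other, such that the smallest rectangle containing both lies
in `P`.  In a pair `p`, `p.1` is the lower-left cell and `p.2` the upper-right one. -/
noncomputable def neP (P M : Finset Cell) : ℕ :=
  ((M ×ˢ M).filter fun p =>
      p.2.1 < p.1.1 ∧ p.1.2 < p.2.2 ∧
      ∀ a b : ℤ, p.2.1 ≤ a → a ≤ p.1.1 → p.1.2 ≤ b → b ≤ p.2.2 → (a, b) ∈ P).card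

open scoped Classical in
/-- The descent statistic of a rectangular filling `M`: the number of pairs of 1-cells lying
in consecutive nonempty rows and forming a north-east chain (`p.1` is the cell in the upper
of the two rows, `p.2` the one in the next nonempty row below it). -/
noncomputable def desR (M : Finset Cell) : ℕ :=
  ((M ×ˢ M).filter fun p =>
      p.1.1 < p.2.1 ∧ p.2.2 < p.1.2 ∧ ∀ z ∈ M, ¬ (p.1.1 < z.1 ∧ z.1 < p.2.1)).card

/-- The major index of a rectangular filling `M`: the sum, over the nonempty rows `r`,
of the descent statistic of the restriction of `M` to row `r` and the rows above it. -/
noncomputable def majR (M : Finset Cell) : ℕ :=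
  ∑ y ∈ M, desR (M.filter fun x => x.1 ≤ y.1)

/-- `R` is a (nonempty) combinatorial rectangle. -/
def IsRect (R : Finset Cell) : Prop :=
  ∃ r₁ r₂ c₁ c₂ : ℤ, r₁ ≤ r₂ ∧ c₁ ≤ c₂ ∧ R = Finset.Icc r₁ r₂ ×ˢ Finset.Icc c₁ c₂

/-- `R` is a maximal rectangle contained in `P`. -/
def IsMaxRect (P R : Finset Cell) : Prop :=
  IsRect R ∧ R ⊆ P ∧ ∀ R' : Finset Cell, IsRect R' → R' ⊆ P → R ⊆ R' → R' = R

open scoped Classical in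
/-- The set of maximal rectangles contained in `P`. -/
noncomputable def maxRects (P : Finset Cell) : Finset (Finset Cell) :=
  P.powerset.filter fun R => IsMaxRect P R

/-- The height (number of rows) of a rectangle. -/
def nRows (R : Finset Cell) : ℕ := (R.image Prod.fst).card

open scoped Classical in
/-- The major index of a filling `M` of a moon polyomino `P`:
`maj(M) = Σᵢ maj(Rᵢ) − Σᵢ maj(Rᵢ ∩ Rᵢ₊₁)`, where `R₁, …, R_r` are the restrictions of `M`
to the maximal rectangles of `P` listed in increasing order of height (in a moon polyomino
the maximal rectangles have pairwise distinct heights; the consecutive pairs are exactly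
the pairs of maximal rectangles with no maximal rectangle of intermediate height). -/
noncomputable def majP (P M : Finset Cell) : ℕ :=
  (∑ R ∈ maxRects P, majR (M ∩ R)) -
    ∑ p ∈ (maxRects P ×ˢ maxRects P).filter
        (fun p => nRows p.1 < nRows p.2 ∧
          ∀ T ∈ maxRects P, ¬ (nRows p.1 < nRows T ∧ nRows T < nRows p.2)),
      majR (M ∩ p.1 ∩ p.2)

/-- `c` belongs to the right part `Right(𝓜)` of `P`: every column strictly to its right
is at most as long as `c`. -/
def InRightPart (P : Finset Cell) (c : ℤ) : Prop :=
  ∀ d ∈ colSet P, c < d → colLen P d ≤ colLen P c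

/-- The total order `≺` on the columns of a moon polyomino. -/
def colPrec (P : Finset Cell) (c d : ℤ) : Prop :=
  colLen P c < colLen P d ∨
    (colLen P c = colLen P d ∧
      ((¬ InRightPart P c ∧ InRightPart P d) ∨
       (¬ InRightPart P c ∧ ¬ InRightPart P d ∧ c < d) ∨
       (InRightPart P c ∧ InRightPart P d ∧ d < c)))

open scoped Classical in
/-- `h_c = |c| − a_c − Σ_{d ≺ c} s_d`, where `a_c` is the number of rows of `A`
meeting column `c`. -/
noncomputable def hVal (P : Finset Cell) (s : ℤ → ℕ) (A : Finset ℤ) (c : ℤ) : ℤ :=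
  (colLen P c : ℤ) - ((A.filter fun r => (r, c) ∈ P).card : ℤ)
    - ∑ d ∈ (colSet P).filter (fun d => colPrec P d c), (s d : ℤ)

open scoped Classical in
/-- The Gaussian binomial coefficient
`[h choose s]_q = Σ_{0 ≤ i₁ ≤ ⋯ ≤ i_s ≤ h−s} q^{i₁+⋯+i_s}` as a polynomial in `q = X`. -/
noncomputable def gaussBinom (h : ℤ) (s : ℕ) : Polynomial ℤ :=
  ∑ f ∈ (Fintype.piFinset fun _ : Fin s => Finset.Icc (0 : ℤ) (h - s)).filter
      (fun f => Monotone f),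
    Polynomial.X ^ (∑ i, f i).toNat

/-- The major index of a word: `maj(w) = Σ_{i ∈ Des(w)} i` (positions are 1-based). -/
def majW (w : List ℕ) : ℕ :=
  ∑ i ∈ Finset.range (w.length - 1), if w.getD (i + 1) 0 < w.getD i 0 then i + 1 else 0

/-- The descent number of a word. -/
def desW (w : List ℕ) : ℕ :=
  ∑ i ∈ Finset.range (w.length - 1), if w.getD (i + 1) 0 < w.getD i 0 then 1 else 0

/-- `w'` is obtained from `w` by inserting `m` copies of the letter `a` (where `a` does not
occur in `w`): `w'` has length `k + m`, exactly `m` letters equal to `a`, and its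
subsequence of letters different from `a` is `w`. -/
def IsInsertion (w : List ℕ) (a m : ℕ) (w' : List ℕ) : Prop :=
  w'.length = w.length + m ∧ w'.count a = m ∧ w'.filter (fun x => decide (x ≠ a)) = w

open scoped Classical in
/-- The weakly increasing `m`-tuples `0 ≤ i₁ ≤ ⋯ ≤ i_m ≤ k`. -/
noncomputable def monoTuples (m k : ℕ) : Finset (Fin m → ℕ) :=
  (Fintype.piFinset fun _ : Fin m => Finset.range (k + 1)).filter fun f => Monotone f


/-- major index of a word, weighted from the right -/
def mj : List ℤ → ℕ
  | [] => 0
  | [_] => 0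
  | a :: b :: l => (if b < a then l.length + 1 else 0) + mj (b :: l)

/-- inversions of a bit word -/
def binv : List Bool → ℕ
  | [] => 0
  | true :: l => l.count false + binv l
  | false :: l => binv l

def sg : List ℤ → List Bool → List Bool
  | _, [] => []
  | v, true :: l => true :: (sg v l).rotate 1
  | [], false :: l => false :: sg [] l
  | [_], false :: l => false :: sg [] l
  | a :: b :: v, false :: l =>
    false :: (if b < a then (sg (b :: v) l).rotate 1 else sg (b :: v) l)

lemma sg_nil (v : List ℤ) : sg v [] = [] := by
  cases v with
  | nil => rfl
  | cons a v => cases v <;> rfl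

lemma sg_true (v : List ℤ) (l : List Bool) : sg v (true :: l) = true :: (sg v l).rotate 1 := by
  cases v with
  | nil => rfl
  | cons a v => cases v <;> rfl

lemma sg_perm (v : List ℤ) (l : List Bool) : (sg v l).Perm l := by
  induction l generalizing v with
  | nil => simp [sg_nil]
  | cons x l ih =>
    cases x with
    | true => rw [sg_true]; exact ((List.rotate_perm _ _).trans (ih v)).cons _
    | false =>
      match v with
      | [] => exact (ih _).cons _
      | [_] => exact (ih _).cons _
      | a :: b :: v =>
        simp only [sg]
        split_ifs
        · exact ((List.rotate_perm _ _).trans (ih _)).cons _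
        · exact (ih _).cons _

lemma sg_inj (v : List ℤ) (l l' : List Bool) (h : sg v l = sg v l') : l = l' := by
  induction l generalizing v l' with
  | nil =>
    have := (sg_perm v l').length_eq
    rw [← h, sg_nil] at this
    exact (List.eq_nil_of_length_eq_zero this.symm).symm
  | cons x l ih =>
    cases l' with
    | nil =>
      have := (sg_perm v (x :: l)).length_eq
      rw [h, sg_nil] at this
      simp at this
    | cons y l' =>
      have ht : ∀ v l, ∃ z, sg v (true :: l) = true :: z := fun v l => ⟨_, sg_true v l⟩
      have hf : ∀ v l, ∃ z, sg v (false :: l) = false :: z := by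
        intro v l
        match v with
        | [] => exact ⟨_, rfl⟩
        | [_] => exact ⟨_, rfl⟩
        | a :: b :: v => exact ⟨_, rfl⟩
      cases x <;> cases y
      · match v with
        | [] => simp only [sg, List.cons.injEq, true_and] at h; rw [ih _ _ h]
        | [_] => simp only [sg, List.cons.injEq, true_and] at h; rw [ih _ _ h]
        | a :: b :: v =>
          simp only [sg, List.cons.injEq, true_and] at h
          split_ifs at h
          · rw [ih _ _ (List.rotate_injective 1 h)]
          · rw [ih _ _ h]
      · obtain ⟨z, hz⟩ := hf v l; obtain ⟨z', hz'⟩ := ht v l'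
        rw [hz, hz'] at h; simp at h
      · obtain ⟨z, hz⟩ := ht v l; obtain ⟨z', hz'⟩ := hf v l'
        rw [hz, hz'] at h; simp at h
      · rw [sg_true, sg_true] at h
        simp only [List.cons.injEq, true_and] at h
        rw [ih _ _ (List.rotate_injective 1 h)]

lemma sg_head (v : List ℤ) (l : List Bool) : (sg v l).head? = l.head? := by
  cases l with
  | nil => rw [sg_nil]
  | cons x l =>
    cases x with
    | true => rw [sg_true]; rfl
    | false =>
      match v with
      | [] => rfl
      | [_] => rfl
      | a :: b :: v => rfl

lemma binv_append_true (l : List Bool) : binv (l ++ [true]) = binv l := by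
  induction l with
  | nil => rfl
  | cons x l ih => cases x <;> simp [binv, ih]

lemma binv_append_false (l : List Bool) : binv (l ++ [false]) = binv l + l.count true := by
  induction l with
  | nil => rfl
  | cons x l ih => cases x <;> simp [binv, ih]; omega

lemma count_map_filter (c : ℤ) (u : List ℤ) :
    (u.map (fun x => decide (x = c))).count false = (u.filter (fun x => decide (x ≠ c))).length := by
  induction u with
  | nil => rfl
  | cons a u ih =>
    by_cases h : a = c <;> simp_all

lemma main_list (c : ℤ) (u : List ℤ) (hu : ∀ x ∈ u, x ≤ c) :
    mj u = mj (u.filter (fun x => decide (x ≠ c))) +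
      binv (sg (u.filter (fun x => decide (x ≠ c))) (u.map (fun x => decide (x = c)))) := by
  induction u with
  | nil => rfl
  | cons a u ih =>
    have ih := ih (fun x hx => hu x (List.mem_cons_of_mem _ hx))
    have hl := count_map_filter c u
    have hlen : (u.map (fun x => decide (x = c))).length = u.length := by simp
    have hd := sg_head (u.filter (fun x => decide (x ≠ c))) (u.map (fun x => decide (x = c)))
    have hp := sg_perm (u.filter (fun x => decide (x ≠ c))) (u.map (fun x => decide (x = c)))
    have hpl := hp.length_eq
    have hpf := hp.count_eq false
    rw [hlen] at hpl
    rw [hl] at hpf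
    have hct : ∀ l : List Bool, l.count true + l.count false = l.length := by
      intro l; induction l with
      | nil => rfl
      | cons x l ih => cases x <;> simp <;> omega
    by_cases hac : a = c
    · subst hac
      simp only [ne_eq, not_true_eq_false, decide_false, Bool.false_eq_true, not_false_eq_true,
        List.filter_cons_of_neg, List.map_cons, decide_true, sg_true, binv]
      simp only [ne_eq] at *
      generalize u.filter (fun x => decide (¬ x = a)) = v at *
      generalize hg : sg v (u.map (fun x => decide (x = a))) = g at *
      have hrc : (g.rotate 1).count false = g.count false := (List.rotate_perm _ _).count_eq _
      rw [hrc]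
      cases u with
      | nil => simp at hpl; subst hpl; simpa [mj, binv] using ih
      | cons b u =>
        cases g with
        | nil => simp at hpl
        | cons y g =>
          have hb := hu b (by simp)
          simp only [List.map_cons, List.head?_cons, Option.some.injEq] at hd
          subst hd
          simp only [mj, List.rotate_cons_succ, List.rotate_zero]
          by_cases hba : b = a
          · subst hba
            simp only [decide_true, binv_append_true, binv] at *
            simp only [lt_irrefl, if_false]
            simp at hpf ⊢
            omega
          · have : b < a := lt_of_le_of_ne hb hba
            simp only [hba, decide_false, binv_append_false, binv, this, if_true] at *
            have := hct g
            simp at hpf hpl ⊢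
            omega
    · have hf : (a :: u).filter (fun x => decide (x ≠ c)) = a :: u.filter (fun x => decide (x ≠ c)) := by
        simp [hac]
      rw [hf]
      simp only [List.map_cons, hac, decide_false]
      generalize hv : u.filter (fun x => decide (x ≠ c)) = v at *
      cases v with
      | nil =>
        simp only [sg, binv, mj] at *
        cases u with
        | nil => simpa [mj] using ih
        | cons b u =>
          have hb : b = c := by
            by_contra hb
            simp [hb] at hv
          have : a < b := by
            have := hu a (by simp); omega
          rw [mj, if_neg (not_lt.2 this.le), ih]
          simp
      | cons b' v =>
        generalize hg : sg (b' :: v) (u.map (fun x => decide (x = c))) = g at *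
        simp only [sg, binv]
        cases u with
        | nil => simp at hv
        | cons b u =>
          cases g with
          | nil => simp at hpl
          | cons y g =>
            have hb := hu b (by simp)
            have ha := hu a (by simp)
            have hac' : a < c := lt_of_le_of_ne ha hac
            simp only [List.map_cons, List.head?_cons, Option.some.injEq] at hd
            subst hd
            simp only [hg]
            simp only [mj]
            have := hct g
            by_cases hbc : b = c
            · have : ¬ b < a := by omega
              rw [if_neg this]
              simp only [hbc, decide_true] at *
              split_ifs
              · simp only [List.rotate_cons_succ, List.rotate_zero, binv_append_true, binv] at *
                simp at hpf hpl
                omega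
              · omega
            · have hbb : b = b' := by
                simp [hbc] at hv; exact hv.1
              subst hbb
              simp only [hbc, decide_false] at *
              split_ifs
              · simp only [List.rotate_cons_succ, List.rotate_zero, binv_append_false, binv] at *
                simp at hpf hpl
                omega
              · omega

lemma recon (c : ℤ) (u u' : List ℤ)
    (h1 : u.filter (fun x => decide (x ≠ c)) = u'.filter (fun x => decide (x ≠ c)))
    (h2 : u.map (fun x => decide (x = c)) = u'.map (fun x => decide (x = c))) : u = u' := by
  induction u generalizing u' with
  | nil => cases u' with
    | nil => rfl
    | cons => simp at h2
  | cons a u ih =>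
    cases u' with
    | nil => simp at h2
    | cons b u' =>
      simp only [List.map_cons, List.cons.injEq] at h2
      have h3 := h2.1
      by_cases ha : a = c
      · have hb : b = c := by simpa [ha] using h3
        subst ha; subst hb
        rw [ih u' (by simpa using h1) h2.2]
      · have hb : b ≠ c := by intro hb; simp [ha, hb] at h3
        simp only [ne_eq, ha, hb, not_false_eq_true, decide_true, List.filter_cons_of_pos, List.cons.injEq] at h1
        rw [ih u' h1.2 h2.2, h1.1]

def SL (P : Finset Cell) (N : Finset ℤ) (w : ℤ → ℤ) (c : ℤ) : Finset ℤ :=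
  N.filter (fun r => (r, c) ∈ P ∧ w r ≤ c)

def wd (P : Finset Cell) (N : Finset ℤ) (w : ℤ → ℤ) (c : ℤ) : List ℤ :=
  ((SL P N w c).sort (· ≤ ·)).map w

def bt (P : Finset Cell) (N : Finset ℤ) (w : ℤ → ℤ) (c : ℤ) : List Bool :=
  (wd P N w c).map (fun x => decide (x = c))

def vv (P : Finset Cell) (N : Finset ℤ) (w : ℤ → ℤ) (c : ℤ) : List ℤ :=
  (wd P N w c).filter (fun x => decide (x ≠ c))

lemma bt_eq (P : Finset Cell) (N : Finset ℤ) (w : ℤ → ℤ) (c : ℤ) :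
    bt P N w c = ((SL P N w c).sort (· ≤ ·)).map (fun r => decide (w r = c)) := by
  simp [bt, wd]

lemma exists_bits (l : List ℤ) (hl : l.Nodup) (γ : List Bool) (h : γ.length = l.length) :
    ∃ p : ℤ → Bool, l.map p = γ := by
  induction l generalizing γ with
  | nil => exact ⟨fun _ => true, by simp at h; simp [h]⟩
  | cons a l ih =>
    cases γ with
    | nil => simp at h
    | cons y γ =>
      obtain ⟨ha, hl⟩ := List.nodup_cons.1 hl
      obtain ⟨p, hp⟩ := ih hl γ (by simpa using h)
      refine ⟨Function.update p a y, ?_⟩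
      simp only [List.map_cons, Function.update_self, List.cons.injEq, true_and]
      rw [← hp]
      apply List.map_congr_left
      intro x hx
      rw [Function.update_of_ne]
      rintro rfl; exact ha hx

lemma count_bits (S : Finset ℤ) (p : ℤ → Prop) [DecidablePred p] :
    ((S.sort (· ≤ ·)).map (fun r => decide (p r))).count true = (S.filter p).card := by
  have : ∀ l : List ℤ, (l.map (fun r => decide (p r))).count true = (l.filter p).length := by
    intro l; induction l with
    | nil => rfl
    | cons a l ih => by_cases h : p a <;> simp [h, ih]
  rw [this]
  have h2 : (S.filter p).card = (S.filter p).val.card := rfl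
  rw [h2, Finset.filter_val, ← Finset.sort_eq S (· ≤ ·), Multiset.filter_coe, Multiset.coe_card]

lemma count_bt (P : Finset Cell) (N : Finset ℤ) (w : ℤ → ℤ) (c : ℤ)
    (h : ∀ r ∈ N, w r = c → (r, c) ∈ P) :
    (bt P N w c).count true = (N.filter (fun r => w r = c)).card := by
  rw [bt_eq, count_bits]
  congr 1
  ext r
  simp only [SL, Finset.mem_filter]
  constructor
  · tauto
  · rintro ⟨h1, h2⟩; exact ⟨⟨h1, h r h1 h2, h2.le⟩, h2⟩

lemma bt_congr (P : Finset Cell) (N : Finset ℤ) (w w' : ℤ → ℤ) (c : ℤ)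
    (h1 : ∀ r ∈ N, (r, c) ∈ P → (w r ≤ c ↔ w' r ≤ c))
    (h2 : ∀ r ∈ N, (r, c) ∈ P → (w r = c ↔ w' r = c)) : bt P N w c = bt P N w' c := by
  have hS : SL P N w c = SL P N w' c := by
    ext r; simp only [SL, Finset.mem_filter]
    constructor
    · rintro ⟨a, b, d⟩; exact ⟨a, b, (h1 r a b).1 d⟩
    · rintro ⟨a, b, d⟩; exact ⟨a, b, (h1 r a b).2 d⟩
  rw [bt_eq, bt_eq, hS]
  apply List.map_congr_left
  intro r hr
  have hr := (Finset.mem_sort _).1 hr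
  simp only [SL, Finset.mem_filter] at hr
  simp [h2 r hr.1 hr.2.1]

lemma card_gt (P : Finset Cell) (N : Finset ℤ) (w : ℤ → ℤ) (c K : ℤ)
    (hK : ∀ x ∈ P, x.2 ≤ K)
    (h : ∀ r ∈ N, c < w r → (r, w r) ∈ P) :
    (N.filter (fun r => c < w r)).card = ∑ d ∈ Finset.Ioc c K, (bt P N w d).count true := by
  rw [Finset.card_eq_sum_card_fiberwise (f := w) (t := Finset.Ioc c K)]
  · apply Finset.sum_congr rfl
    intro d hd
    rw [Finset.mem_Ioc] at hd
    rw [count_bt]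
    · congr 1; ext r; simp only [Finset.mem_filter]
      constructor
      · tauto
      · rintro ⟨a, b⟩; exact ⟨⟨a, by omega⟩, b⟩
    · rintro r hr rfl; exact h r hr hd.1
  · intro r hr
    simp only [Finset.coe_filter, Set.mem_ofPred_eq] at hr
    simp only [Finset.coe_Ioc, Set.mem_Ioc]
    exact ⟨hr.2, hK _ (h r hr.1 hr.2)⟩

lemma exists_img (P : Finset Cell) (N : Finset ℤ) (c₀ K : ℤ)
    (hc : ∀ r c d : ℤ, (r, c) ∈ P → c₀ ≤ d → d ≤ c → (r, d) ∈ P)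
    (hc0 : ∀ x ∈ P, c₀ ≤ x.2)
    (hK : ∀ x ∈ P, x.2 ≤ K) (w : ℤ → ℤ) (hw : ∀ r ∈ N, (r, w r) ∈ P)
    (γ : ℤ → List Bool) (hγ : ∀ c, (γ c).Perm (bt P N w c)) :
    ∃ w' : ℤ → ℤ, (∀ r ∈ N, (r, w' r) ∈ P) ∧ ∀ c, bt P N w' c = γ c := by
  have hnil : ∀ w c, (∀ r ∈ N, (r, c) ∉ P ∨ c < w r) → bt P N w c = [] := by
    intro w c h
    have : SL P N w c = ∅ := by
      ext r; simp only [SL, Finset.mem_filter, Finset.notMem_empty, iff_false]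
      rintro ⟨a, b, d⟩
      rcases h r a with h | h
      · exact h b
      · omega
    rw [bt_eq, this]; simp
  have hγnil : ∀ c, bt P N w c = [] → γ c = [] := by
    intro c h
    have := hγ c
    rw [h] at this; exact this.eq_nil
  have hmain : ∀ k : ℕ, c₀ - 1 ≤ K - k → ∃ w' : ℤ → ℤ, (∀ r ∈ N, K - k < w' r → (r, w' r) ∈ P) ∧
      ∀ d, K - k < d → bt P N w' d = γ d := by
    intro k
    induction k with
    | zero =>
      intro _
      refine ⟨fun _ => K, by intro r _ h; simp at h, ?_⟩
      intro d hd
      have hn : ∀ r, (r, d) ∉ P := by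
        intro r hr; have := hK _ hr; simp at this hd; omega
      rw [hγnil d (hnil _ _ (fun r _ => Or.inl (hn r))), hnil _ _ (fun r _ => Or.inl (hn r))]
    | succ k ih =>
      intro hk
      obtain ⟨w', h1, h2⟩ := ih (by push_cast at hk; omega)
      have hck : K - ((k + 1 : ℕ) : ℤ) = K - k - 1 := by push_cast; ring
      rw [hck] at hk ⊢
      generalize hce : K - (k : ℤ) = c at *
      have hcc : c₀ ≤ c := by omega
      have hS : ∀ u : ℤ → ℤ, (∀ r ∈ N, c < u r → (r, u r) ∈ P) →
          (SL P N u c).card + (N.filter (fun r => c < u r)).card =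
            (N.filter (fun r => (r, c) ∈ P)).card := by
        intro u hu
        rw [← Finset.card_union_of_disjoint]
        · congr 1
          ext r
          simp only [SL, Finset.mem_union, Finset.mem_filter]
          constructor
          · rintro (⟨a, b, d⟩ | ⟨a, b⟩)
            · exact ⟨a, b⟩
            · exact ⟨a, hc r _ c (hu r a b) hcc b.le⟩
          · rintro ⟨a, b⟩
            rcases le_or_gt (u r) c with h | h
            · exact Or.inl ⟨a, b, h⟩
            · exact Or.inr ⟨a, h⟩
        · rw [Finset.disjoint_left]
          intro r
          simp only [SL, Finset.mem_filter]
          rintro ⟨a, b, d⟩ ⟨_, e⟩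
          omega
      have hcard : (SL P N w' c).card = (SL P N w c).card := by
        have e1 := hS w' h1
        have e2 := hS w (fun r hr _ => hw r hr)
        rw [card_gt P N w' c K hK h1] at e1
        rw [card_gt P N w c K hK (fun r hr _ => hw r hr)] at e2
        have : ∑ d ∈ Finset.Ioc c K, (bt P N w' d).count true =
            ∑ d ∈ Finset.Ioc c K, (bt P N w d).count true := by
          apply Finset.sum_congr rfl
          intro d hd
          rw [h2 d (Finset.mem_Ioc.1 hd).1]
          exact (hγ d).count_eq true
        omega
      obtain ⟨p, hp⟩ := exists_bits ((SL P N w' c).sort (· ≤ ·)) (Finset.sort_nodup _ _) (γ c) (by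
        rw [(hγ c).length_eq, bt_eq]; simp [hcard])
      let w'' : ℤ → ℤ := fun r => if c < w' r then w' r else
        if (r, c) ∈ P ∧ p r = true then c else c - 1
      have ha : ∀ r, c < w' r → w'' r = w' r := fun r h => if_pos h
      have hb : ∀ r, ¬ c < w' r → w'' r = if (r, c) ∈ P ∧ p r = true then c else c - 1 :=
        fun r h => if_neg h
      clear_value w''
      refine ⟨w'', ?_, ?_⟩
      · intro r hr hlt
        by_cases h : c < w' r
        · rw [ha r h]; exact h1 r hr h
        · have := hb r h
          split_ifs at this with h3
          · rw [this]; exact h3.1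
          · omega
      · intro d hd
        rcases eq_or_lt_of_le (show c ≤ d by omega) with rfl | hd
        · rw [← hp, bt_eq]
          have hSS : SL P N w'' c = SL P N w' c := by
            ext r; simp only [SL, Finset.mem_filter]
            refine and_congr_right (fun _ => and_congr_right (fun _ => ?_))
            by_cases h : c < w' r
            · rw [ha r h]
            · have := hb r h
              split_ifs at this <;> omega
          rw [hSS]
          apply List.map_congr_left
          intro r hr
          have hr := (Finset.mem_sort _).1 hr
          simp only [SL, Finset.mem_filter] at hr
          have := hb r (by omega)
          simp only [hr.2.1, true_and] at this
          cases hpr : p r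
          · simp [hpr] at this; simp [this]
          · simp [hpr] at this; simp [this]
        · rw [← h2 d hd]
          apply bt_congr
          · intro r _ _
            by_cases h : c < w' r
            · rw [ha r h]
            · have := hb r h
              split_ifs at this <;> omega
          · intro r _ _
            by_cases h : c < w' r
            · rw [ha r h]
            · have := hb r h
              split_ifs at this <;> omega
  rcases le_or_gt c₀ K with hcK | hcK
  · obtain ⟨w', h1, h2⟩ := hmain (K - c₀ + 1).toNat (by
      rw [Int.toNat_of_nonneg] <;> omega)
    rw [Int.toNat_of_nonneg (by omega)] at h1 h2
    have hall : ∀ r ∈ N, c₀ - 1 < w' r := by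
      have e1 := card_gt P N w' (c₀ - 1) K hK (fun r hr h => h1 r hr (by omega))
      have e2 := card_gt P N w (c₀ - 1) K hK (fun r hr h => hw r hr)
      have : ∑ d ∈ Finset.Ioc (c₀ - 1) K, (bt P N w' d).count true =
            ∑ d ∈ Finset.Ioc (c₀ - 1) K, (bt P N w d).count true := by
        apply Finset.sum_congr rfl
        intro d hd
        have := (Finset.mem_Ioc.1 hd).1
        rw [h2 d (by omega)]
        exact (hγ d).count_eq true
      have e3 : N.filter (fun r => c₀ - 1 < w r) = N := by
        apply Finset.filter_true_of_mem
        intro r hr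
        have := hc0 _ (hw r hr)
        simp at this; omega
      rw [e3] at e2
      have e4 : N.filter (fun r => c₀ - 1 < w' r) = N :=
        Finset.eq_of_subset_of_card_le (Finset.filter_subset _ _) (by omega)
      intro r hr
      rw [← e4] at hr
      exact (Finset.mem_filter.1 hr).2
    refine ⟨w', fun r hr => h1 r hr (by have := hall r hr; omega), ?_⟩
    intro c
    rcases lt_or_ge c c₀ with h | h
    · rw [hγnil c (hnil _ _ ?_), hnil]
      · intro r hr; right; have := hall r hr; omega
      · intro r hr; right; have := hc0 _ (hw r hr); simp at this; omega
    · exact h2 c (by omega)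
  · have : ∀ x, x ∉ P := by
      intro x hx
      have := hc0 x hx; have := hK x hx; omega
    exact ⟨w, hw, fun c => by rw [hγnil c (hnil _ _ (fun r _ => Or.inl (this _))), hnil _ _ (fun r _ => Or.inl (this _))]⟩

lemma sort_unique (S : Finset ℤ) (l : List ℤ) (h1 : l.Pairwise (· < ·)) (h2 : ∀ x, x ∈ l ↔ x ∈ S) :
    S.sort (· ≤ ·) = l := by
  have hn : l.Nodup := h1.imp (fun h => ne_of_lt h)
  have : S = l.toFinset := by ext x; simp [h2]
  rw [this]
  exact (List.toFinset_sort (· ≤ ·) hn).2 (h1.imp (fun h => le_of_lt h))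

lemma sort_lt (S : Finset ℤ) : (S.sort (· ≤ ·)).Pairwise (· < ·) :=
  (Finset.sortedLT_sort S).pairwise

lemma sort_filter (S : Finset ℤ) (p : ℤ → Prop) [DecidablePred p] :
    (S.filter p).sort (· ≤ ·) = (S.sort (· ≤ ·)).filter (fun x => decide (p x)) := by
  apply sort_unique
  · exact (sort_lt S).filter _
  · intro x; simp

lemma sort_union (S T : Finset ℤ) (h : ∀ a ∈ S, ∀ b ∈ T, a < b) :
    (S ∪ T).sort (· ≤ ·) = S.sort (· ≤ ·) ++ T.sort (· ≤ ·) := by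
  apply sort_unique
  · rw [List.pairwise_append]
    exact ⟨sort_lt S, sort_lt T, by simpa using h⟩
  · intro x; simp

lemma sort_head (S : Finset ℤ) (r : ℤ) (hr : r ∈ S) (h : ∀ s ∈ S, r ≤ s) :
    (S.sort (· ≤ ·)).head? = some r := by
  rw [← Finset.insert_erase hr, Finset.sort_insert]
  · rfl
  · intro b hb; exact h b (Finset.mem_of_mem_erase hb)
  · simp

lemma vv_eq (P : Finset Cell) (N : Finset ℤ) (w : ℤ → ℤ) (c : ℤ) :
    vv P N w c = ((N.filter (fun r => (r, c) ∈ P ∧ w r < c)).sort (· ≤ ·)).map w := by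
  have : N.filter (fun r => (r, c) ∈ P ∧ w r < c) = (SL P N w c).filter (fun r => w r ≠ c) := by
    ext r; simp only [SL, Finset.mem_filter, lt_iff_le_and_ne]; tauto
  rw [this, sort_filter, vv, wd, List.filter_map]
  rfl

lemma vv_next (P : Finset Cell) (hP : ColConvex P) (N : Finset ℤ) (c₀ : ℤ)
    (hc : ∀ r c d : ℤ, (r, c) ∈ P → c₀ ≤ d → d ≤ c → (r, d) ∈ P) 
    (w₁ w₂ : ℤ → ℤ) (hw₁ : ∀ r ∈ N, (r, w₁ r) ∈ P) (hw₂ : ∀ r ∈ N, (r, w₂ r) ∈ P)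
    (c : ℤ) (hcc : c₀ ≤ c) (h : wd P N w₁ c = wd P N w₂ c) :
    vv P N w₁ (c + 1) = vv P N w₂ (c + 1) := by
  by_cases hne : ∃ m ∈ N, (m, c + 1) ∈ P
  · obtain ⟨m, hmN, hmP⟩ := hne
    have key : ∀ w : ℤ → ℤ, (∀ r ∈ N, (r, w r) ∈ P) → wd P N w c =
        ((N.filter (fun r => (r, c) ∈ P ∧ (r, c + 1) ∉ P ∧ r < m)).sort (· ≤ ·)).map w ++
        (vv P N w (c + 1) ++
        ((N.filter (fun r => (r, c) ∈ P ∧ (r, c + 1) ∉ P ∧ m < r)).sort (· ≤ ·)).map w) := by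
      intro w hw
      rw [vv_eq, wd, ← List.map_append, ← List.map_append, ← sort_union, ← sort_union]
      · congr 2
        ext r
        simp only [SL, Finset.mem_union, Finset.mem_filter]
        have hr1 : r ∈ N → (r, c + 1) ∉ P → w r ≤ c := by
          intro h1 h2
          by_contra h3
          exact h2 (hc r _ _ (hw r h1) (by omega) (by omega))
        have hr2 : (r, c + 1) ∈ P → (r, c) ∈ P := fun h => hc r _ _ h hcc (by omega)
        have hr3 : (r, c + 1) ∉ P → r ≠ m := by rintro h rfl; exact h hmP
        constructor
        · rintro ⟨a, b, d⟩
          by_cases h : (r, c + 1) ∈ P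
          · exact Or.inr (Or.inl ⟨a, h, by omega⟩)
          · rcases lt_or_gt_of_ne (hr3 h) with h' | h'
            · exact Or.inl ⟨a, b, h, h'⟩
            · exact Or.inr (Or.inr ⟨a, b, h, h'⟩)
        · rintro (⟨a, b, d, e⟩ | ⟨a, b, d⟩ | ⟨a, b, d, e⟩)
          · exact ⟨a, b, hr1 a d⟩
          · exact ⟨a, hr2 b, by omega⟩
          · exact ⟨a, b, hr1 a d⟩
      · intro a ha b hb
        simp only [Finset.mem_union, Finset.mem_filter] at ha hb
        rcases hb with hb | hb
        · by_contra hab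
          exact ha.2.2.1 (hP (c + 1) b m a hb.2.1 hmP (by omega) (by omega))
        · omega
      · intro a ha b hb
        simp only [Finset.mem_filter] at ha hb
        by_contra hab
        exact hb.2.2.1 (hP (c + 1) m a b hmP ha.2.1 (by omega) (by omega))
    rw [key w₁ hw₁, key w₂ hw₂] at h
    have h2 := (List.append_inj h (by simp)).2
    exact (List.append_inj' h2 (by simp)).1
  · have : ∀ w : ℤ → ℤ, vv P N w (c + 1) = [] := by
      intro w
      rw [vv_eq]
      have : N.filter (fun r => (r, c + 1) ∈ P ∧ w r < c + 1) = ∅ := by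
        ext r; simp only [Finset.mem_filter, Finset.notMem_empty, iff_false]
        rintro ⟨a, b, d⟩; exact hne ⟨r, a, b⟩
      rw [this]; simp
    rw [this, this]

lemma inj_core (P : Finset Cell) (hP : ColConvex P) (N : Finset ℤ) (c₀ K : ℤ)
    (hc : ∀ r c d : ℤ, (r, c) ∈ P → c₀ ≤ d → d ≤ c → (r, d) ∈ P)
    (hc0 : ∀ x ∈ P, c₀ ≤ x.2)
    (hK : ∀ x ∈ P, x.2 ≤ K)
    (w₁ w₂ : ℤ → ℤ) (hw₁ : ∀ r ∈ N, (r, w₁ r) ∈ P) (hw₂ : ∀ r ∈ N, (r, w₂ r) ∈ P)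
    (h : ∀ c, sg (vv P N w₁ c) (bt P N w₁ c) = sg (vv P N w₂ c) (bt P N w₂ c)) :
    ∀ r ∈ N, w₁ r = w₂ r := by
  have step : ∀ c, vv P N w₁ c = vv P N w₂ c → wd P N w₁ c = wd P N w₂ c := by
    intro c hv
    have := h c
    rw [hv] at this
    exact recon c _ _ hv (sg_inj _ _ _ this)
  have hwd : ∀ k : ℕ, wd P N w₁ (c₀ + k) = wd P N w₂ (c₀ + k) := by
    intro k
    induction k with
    | zero =>
      apply step
      have : ∀ w : ℤ → ℤ, (∀ r ∈ N, (r, w r) ∈ P) → vv P N w (c₀ + (0 : ℕ)) = [] := by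
        intro w hw
        rw [vv_eq]
        have : N.filter (fun r => (r, c₀ + ((0 : ℕ) : ℤ)) ∈ P ∧ w r < c₀ + ((0 : ℕ) : ℤ)) = ∅ := by
          ext r; simp only [Finset.mem_filter, Finset.notMem_empty, iff_false]
          rintro ⟨a, b, d⟩
          have := hc0 _ (hw r a)
          simp at this d; omega
        rw [this]; simp
      rw [this _ hw₁, this _ hw₂]
    | succ k ih =>
      apply step
      have := vv_next P hP N c₀ hc w₁ w₂ hw₁ hw₂ (c₀ + k) (by omega) ih
      push_cast
      rw [← add_assoc]
      exact this
  have hbt : ∀ c, c₀ ≤ c → bt P N w₁ c = bt P N w₂ c := by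
    intro c hcc
    have := hwd (c - c₀).toNat
    rw [Int.toNat_of_nonneg (by omega), show c₀ + (c - c₀) = c by ring] at this
    rw [bt, bt, this]
  have hfin : ∀ k : ℕ, ∀ r ∈ N, ∀ d, K - k < d → (w₁ r = d ↔ w₂ r = d) := by
    intro k
    induction k with
    | zero =>
      intro r hr d hd
      have a := hK _ (hw₁ r hr)
      have b := hK _ (hw₂ r hr)
      simp at a b hd; omega
    | succ k ih =>
      intro r hr d hd
      rcases lt_or_ge (K - k) d with hd' | hd'
      · exact ih r hr d hd'
      · have hd2 : d = K - k := by push_cast at hd; omega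
        rcases lt_or_ge d c₀ with h0 | h0
        · have a := hc0 _ (hw₁ r hr)
          have b := hc0 _ (hw₂ r hr)
          simp at a b; omega
        have hle : ∀ r ∈ N, (w₁ r ≤ d ↔ w₂ r ≤ d) := by
          intro r hr
          constructor
          · intro h1; by_contra h2
            have := (ih r hr (w₂ r) (by omega)).2 rfl
            omega
          · intro h1; by_contra h2
            have := (ih r hr (w₁ r) (by omega)).1 rfl
            omega
        have hS : SL P N w₁ d = SL P N w₂ d := by
          ext r; simp only [SL, Finset.mem_filter]
          constructor
          · rintro ⟨a, b, e⟩; exact ⟨a, b, (hle r a).1 e⟩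
          · rintro ⟨a, b, e⟩; exact ⟨a, b, (hle r a).2 e⟩
        have hb := hbt d h0
        rw [bt_eq, bt_eq, hS] at hb
        have hmem : ∀ r ∈ SL P N w₂ d, (w₁ r = d ↔ w₂ r = d) := by
          intro r hr
          have := List.map_inj_left.1 hb r ((Finset.mem_sort _).2 hr)
          simpa using this
        constructor
        · intro h1
          refine (hmem r ?_).1 h1
          simp only [SL, Finset.mem_filter]
          exact ⟨hr, by rw [← h1]; exact hw₁ r hr, (hle r hr).1 h1.le⟩
        · intro h1
          refine (hmem r ?_).2 h1
          simp only [SL, Finset.mem_filter]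
          exact ⟨hr, by rw [← h1]; exact hw₂ r hr, h1.le⟩
  intro r hr
  refine ((hfin (K - w₁ r + 1).toNat r hr (w₁ r) ?_).1 rfl).symm
  have := hK _ (hw₁ r hr)
  simp at this
  rw [Int.toNat_of_nonneg (by omega)]; omega

lemma top_core (P : Finset Cell) (N : Finset ℤ) (w w' : ℤ → ℤ)
    (hw : ∀ r ∈ N, (r, w r) ∈ P) (hw' : ∀ r ∈ N, (r, w' r) ∈ P)
    (h : ∀ c, bt P N w' c = sg (vv P N w c) (bt P N w c))
    (r : ℤ) (hr : r ∈ N) (hmin : ∀ s ∈ N, r ≤ s) : w' r = w r := by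
  have hd : ∀ c, (bt P N w' c).head? = (bt P N w c).head? := by
    intro c; rw [h, sg_head]
  have hb : ∀ u : ℤ → ℤ, ∀ c, (r, c) ∈ P → u r ≤ c → (bt P N u c).head? = some (decide (u r = c)) := by
    intro u c h1 h2
    rw [bt_eq, List.head?_map, sort_head _ r]
    · rfl
    · simp only [SL, Finset.mem_filter]; exact ⟨hr, h1, h2⟩
    · intro s hs; simp only [SL, Finset.mem_filter] at hs; exact hmin s hs.1
  rcases le_total (w r) (w' r) with h1 | h1
  · have := hd (w' r)
    rw [hb w' _ (hw' r hr) le_rfl, hb w _ (hw' r hr) h1] at this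
    simp at this; omega
  · have := hd (w r)
    rw [hb w' _ (hw r hr) h1, hb w _ (hw r hr) le_rfl] at this
    simpa using this

lemma binv_sort (S : Finset ℤ) (p : ℤ → Prop) [DecidablePred p] :
    binv ((S.sort (· ≤ ·)).map (fun r => decide (p r))) =
      ∑ i ∈ S, if p i then (S.filter (fun j => i < j ∧ ¬ p j)).card else 0 := by
  induction S using Finset.induction_on_min with
  | empty => simp [binv]
  | insert a S ha ih =>
    have hna : a ∉ S := fun h => lt_irrefl _ (ha a h)
    rw [Finset.sort_insert (h₁ := fun b hb => (ha b hb).le) (h₂ := hna), Finset.sum_insert hna]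
    have e1 : ∑ i ∈ S, (if p i then ((insert a S).filter (fun j => i < j ∧ ¬ p j)).card else 0) =
        ∑ i ∈ S, if p i then (S.filter (fun j => i < j ∧ ¬ p j)).card else 0 := by
      apply Finset.sum_congr rfl
      intro i hi
      have := ha i hi
      rw [Finset.filter_insert, if_neg (c := i < a ∧ _) (fun h => by omega)]
    rw [e1, ← ih]
    have e2 : (insert a S).filter (fun j => a < j ∧ ¬ p j) = S.filter (fun j => ¬ p j) := by
      ext j; simp only [Finset.mem_filter, Finset.mem_insert]
      constructor
      · rintro ⟨rfl | h, h1, h2⟩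
        · omega
        · exact ⟨h, h2⟩
      · rintro ⟨h1, h2⟩; exact ⟨Or.inr h1, ha j h1, h2⟩
    rw [e2]
    have e3 : ((S.sort (· ≤ ·)).map (fun r => decide (p r))).count false =
        (S.filter (fun j => ¬ p j)).card := by
      have a1 := count_bits S p
      have a2 := Finset.card_filter_add_card_filter_not (s := S) p
      have a3 : ∀ l : List Bool, l.count true + l.count false = l.length := by
        intro l; induction l with
        | nil => rfl
        | cons x l ih => cases x <;> simp <;> omega
      have := a3 ((S.sort (· ≤ ·)).map (fun r => decide (p r)))
      simp only [List.length_map, Finset.length_sort] at this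
      omega
    by_cases h : p a
    · simp [h, binv, e3]
    · simp [h, binv]

def cells (N : Finset ℤ) (w : ℤ → ℤ) : Finset Cell := N.image (fun r => (r, w r))

lemma ne_core (P : Finset Cell) (hPc : ColConvex P) (N : Finset ℤ) (c₀ K : ℤ)
    (hc : ∀ r c d : ℤ, (r, c) ∈ P → c₀ ≤ d → d ≤ c → (r, d) ∈ P)
    (hc0 : ∀ x ∈ P, c₀ ≤ x.2)
    (hK : ∀ x ∈ P, x.2 ≤ K)
    (w : ℤ → ℤ) (hw : ∀ r ∈ N, (r, w r) ∈ P) :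
    neP P (cells N w) = ∑ c ∈ Finset.Icc c₀ K, binv (bt P N w c) := by
  have hinj : Set.InjOn (fun r : ℤ => ((r, w r) : Cell)) (N : Set ℤ) := by
    intro a _ b _ h; exact (Prod.mk.inj h).1
  have e1 : neP P (cells N w) =
      ∑ i ∈ N, (N.filter (fun j => i < j ∧ w j < w i ∧ (j, w i) ∈ P)).card := by
    unfold neP cells
    rw [Finset.card_filter, Finset.sum_product_right, Finset.sum_image hinj]
    apply Finset.sum_congr rfl
    intro i hi
    rw [Finset.card_filter, Finset.sum_image hinj]
    apply Finset.sum_congr rfl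
    intro j hj
    refine @if_congr _ _ _ (_) (_) _ _ _ _ ?_ rfl rfl
    dsimp only
    refine and_congr_right (fun h1 => and_congr_right (fun h2 => ?_))
    constructor
    · intro h; exact h j (w i) h1.le le_rfl h2.le le_rfl
    · intro h a b ha1 ha2 hb1 hb2
      have := hPc (w i) i j a (hw i hi) h ha1 ha2
      have h3 := hc0 _ (hw j hj)
      exact hc a _ b this (by simp at h3; omega) hb2
  rw [e1]
  have e2 : ∀ c, binv (bt P N w c) = ∑ i ∈ N, if w i = c then
      (N.filter (fun j => i < j ∧ w j < w i ∧ (j, w i) ∈ P)).card else 0 := by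
    intro c
    rw [bt_eq, binv_sort]
    rw [← Finset.sum_filter, ← Finset.sum_filter]
    apply Finset.sum_congr
    · ext i; simp only [SL, Finset.mem_filter]
      constructor
      · tauto
      · rintro ⟨a, rfl⟩; exact ⟨⟨a, hw i a, le_rfl⟩, rfl⟩
    · intro i hi
      rw [Finset.mem_filter] at hi
      congr 1
      ext j; simp only [SL, Finset.mem_filter, hi.2]
      rw [lt_iff_le_and_ne (a := w j)]; tauto
  rw [Finset.sum_congr rfl (fun c _ => e2 c), Finset.sum_comm]
  apply Finset.sum_congr rfl
  intro i hi
  rw [Finset.sum_ite_eq, if_pos]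
  rw [Finset.mem_Icc]
  exact ⟨hc0 _ (hw i hi), hK _ (hw i hi)⟩

lemma cells_filter (S : Finset ℤ) (w : ℤ → ℤ) (p : Cell → Prop) [DecidablePred p]
    (q : ℤ → Prop) [DecidablePred q] (h : ∀ r ∈ S, p (r, w r) ↔ q r) :
    (cells S w).filter p = cells (S.filter q) w := by
  ext x
  simp only [cells, Finset.mem_filter, Finset.mem_image]
  constructor
  · rintro ⟨⟨r, hr, rfl⟩, hx⟩
    exact ⟨r, ⟨hr, (h r hr).1 hx⟩, rfl⟩
  · rintro ⟨r, ⟨hr, hq⟩, rfl⟩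
    exact ⟨⟨r, hr, rfl⟩, (h r hr).2 hq⟩

lemma sum_cells (S : Finset ℤ) (w : ℤ → ℤ) (f : Cell → ℕ) :
    ∑ x ∈ cells S w, f x = ∑ r ∈ S, f (r, w r) := by
  unfold cells
  rw [Finset.sum_image]
  intro a _ b _ h; exact (Prod.mk.inj h).1

open scoped Classical in
lemma des_eq (S : Finset ℤ) (w : ℤ → ℤ) :
    desR (cells S w) = ∑ i ∈ S, (S.filter (fun j => i < j ∧ w j < w i ∧
      ∀ k ∈ S, ¬ (i < k ∧ k < j))).card := by
  unfold desR
  rw [Finset.card_filter, Finset.sum_product, sum_cells]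
  apply Finset.sum_congr rfl
  intro i hi
  rw [Finset.card_filter, sum_cells]
  apply Finset.sum_congr rfl
  intro j hj
  refine @if_congr _ _ _ (_) (_) _ _ _ _ ?_ rfl rfl
  simp [cells]

lemma des_insert (Q : Finset ℤ) (w : ℤ → ℤ) (a : ℤ) (ha : ∀ x ∈ Q, a < x) (b : ℤ) (hb : b ∈ Q)
    (hmin : ∀ x ∈ Q, b ≤ x) :
    desR (cells (insert a Q) w) = (if w b < w a then 1 else 0) + desR (cells Q w) := by
  classical
  have hna : a ∉ Q := fun h => lt_irrefl _ (ha a h)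
  rw [des_eq, des_eq, Finset.sum_insert hna]
  congr 1
  · have : (insert a Q).filter (fun j => a < j ∧ w j < w a ∧
        ∀ k ∈ insert a Q, ¬ (a < k ∧ k < j)) = if w b < w a then {b} else ∅ := by
      ext j
      simp only [Finset.mem_filter, Finset.mem_insert]
      have key : (j = a ∨ j ∈ Q) → a < j → (∀ k, k = a ∨ k ∈ Q → ¬ (a < k ∧ k < j)) → j = b := by
        rintro (rfl | h1) h2 h3
        · omega
        · have := hmin j h1
          have := h3 b (Or.inr hb)
          have := ha b hb
          omega
      constructor
      · rintro ⟨h1, h2, h3, h4⟩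
        have := key h1 h2 h4
        subst this
        simp [h3]
      · intro h
        split_ifs at h with h'
        · rw [Finset.mem_singleton] at h
          subst h
          refine ⟨Or.inr hb, ha j hb, h', ?_⟩
          rintro k (rfl | hk) ⟨h1, h2⟩
          · omega
          · have := hmin k hk; omega
        · simp at h
    rw [this]
    split_ifs <;> simp
  · apply Finset.sum_congr rfl
    intro i hi
    congr 1
    ext j
    simp only [Finset.mem_filter, Finset.mem_insert]
    have := ha i hi
    constructor
    · rintro ⟨h1, h2, h3, h4⟩
      refine ⟨?_, h2, h3, fun k hk => h4 k (Or.inr hk)⟩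
      rcases h1 with rfl | h1
      · omega
      · exact h1
    · rintro ⟨h1, h2, h3, h4⟩
      refine ⟨Or.inr h1, h2, h3, ?_⟩
      rintro k (rfl | hk)
      · omega
      · exact h4 k hk

lemma des_single (w : ℤ → ℤ) (a : ℤ) : desR (cells {a} w) = 0 := by
  classical
  rw [des_eq]
  simp [Finset.filter_singleton]

lemma majR_eq (S : Finset ℤ) (w : ℤ → ℤ) :
    majR (cells S w) = ∑ y ∈ S, desR (cells (S.filter (fun x => x ≤ y)) w) := by
  unfold majR
  rw [sum_cells]
  apply Finset.sum_congr rfl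
  intro y hy
  rw [cells_filter S w (fun x => x.1 ≤ (y, w y).1) (fun x => x ≤ y)]
  intro r _; rfl

lemma majR_sort (S : Finset ℤ) (w : ℤ → ℤ) :
    majR (cells S w) = mj ((S.sort (· ≤ ·)).map w) := by
  induction S using Finset.induction_on_min with
  | empty => simp [mj, majR, cells]
  | insert a S ha ih =>
    have hna : a ∉ S := fun h => lt_irrefl _ (ha a h)
    rw [Finset.sort_insert (h₁ := fun b hb => (ha b hb).le) (h₂ := hna)]
    rcases S.eq_empty_or_nonempty with rfl | hne
    · rw [majR_eq]
      simp [mj, Finset.filter_singleton, des_single]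
    · have hb := S.min'_mem hne
      have hmin : ∀ x ∈ S, S.min' hne ≤ x := fun x hx => S.min'_le x hx
      generalize S.min' hne = b at *
      have hd := sort_head S b hb hmin
      have hlen : (S.sort (· ≤ ·)).length = S.card := Finset.length_sort _
      rw [majR_eq, Finset.sum_insert hna]
      have e1 : (insert a S).filter (fun x => x ≤ a) = {a} := by
        ext x; simp only [Finset.mem_filter, Finset.mem_insert, Finset.mem_singleton]
        constructor
        · rintro ⟨rfl | h, h2⟩
          · rfl
          · have := ha x h; omega
        · rintro rfl; exact ⟨Or.inl rfl, le_rfl⟩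
      rw [e1, des_single]
      have e2 : ∀ y ∈ S, desR (cells ((insert a S).filter (fun x => x ≤ y)) w) =
          (if w b < w a then 1 else 0) + desR (cells (S.filter (fun x => x ≤ y)) w) := by
        intro y hy
        rw [Finset.filter_insert, if_pos (ha y hy).le]
        apply des_insert
        · intro x hx; exact ha x (Finset.mem_filter.1 hx).1
        · exact Finset.mem_filter.2 ⟨hb, hmin y hy⟩
        · intro x hx; exact hmin x (Finset.mem_filter.1 hx).1
      rw [Finset.sum_congr rfl e2, Finset.sum_add_distrib, ← majR_eq, ih]
      generalize S.sort (· ≤ ·) = l at *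
      cases l with
      | nil => simp at hd
      | cons b' l =>
        simp at hd; subst hd
        simp only [List.map_cons, mj, List.length_map]
        split_ifs <;> simp [← hlen]

lemma tele (g : ℤ → ℤ → ℕ) (t : ℤ → ℕ) (a : ℤ) (C : Finset ℤ) :
    ∀ K, (∀ e ∈ C, a < e) → (∀ e ∈ C, g e a = 0) →
    (∀ e ∈ C, ∀ c, a < c → c ≤ e → (∀ d ∈ C, ¬ (c ≤ d ∧ d < e)) → g e c = t c + g e (c - 1)) →
    (C.Nonempty → K ∈ C ∧ ∀ e ∈ C, e ≤ K) → (C = ∅ → K = a) →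
    ∑ e ∈ C, g e e = ∑ e ∈ C, ∑ d ∈ C,
      (if d < e ∧ ∀ s ∈ C, ¬ (d < s ∧ s < e) then g e d else 0) + ∑ c ∈ Finset.Ioc a K, t c := by
  induction C using Finset.induction_on_max with
  | empty => intro K _ _ _ _ h; simp [h]
  | insert m C hm ih =>
    intro K hpos hzero hstep hK _
    have hnm : m ∉ C := fun h => lt_irrefl _ (hm m h)
    have hKm : K = m := by
      obtain ⟨h1, h2⟩ := hK ⟨m, by simp⟩
      have := h2 m (by simp)
      rcases Finset.mem_insert.1 h1 with h | h
      · exact h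
      · have := hm K h; omega
    subst hKm
    -- previous max
    obtain ⟨K', hK'1, hK'2⟩ : ∃ K', (C.Nonempty → K' ∈ C ∧ ∀ e ∈ C, e ≤ K') ∧ (C = ∅ → K' = a) := by
      rcases C.eq_empty_or_nonempty with h | h
      · exact ⟨a, fun h' => by simp [h] at h', fun _ => rfl⟩
      · exact ⟨C.max' h, fun _ => ⟨C.max'_mem h, fun e he => C.le_max' e he⟩,
          fun h' => by simp [h'] at h⟩
    have hIH := ih K' (fun e he => hpos e (Finset.mem_insert_of_mem he))
      (fun e he => hzero e (Finset.mem_insert_of_mem he)) (by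
        intro e he c h1 h2 h3
        apply hstep e (Finset.mem_insert_of_mem he) c h1 h2
        intro d hd
        rcases Finset.mem_insert.1 hd with rfl | hd
        · have := hm e he; omega
        · exact h3 d hd) hK'1 hK'2
    have haK' : a ≤ K' := by
      rcases C.eq_empty_or_nonempty with h | h
      · rw [hK'2 h]
      · exact (hpos K' (Finset.mem_insert_of_mem (hK'1 h).1)).le
    have hle' : ∀ d ∈ C, d ≤ K' := fun d hd => (hK'1 ⟨d, hd⟩).2 d hd
    have hK'K : K' < K := by
      rcases C.eq_empty_or_nonempty with h | h
      · rw [hK'2 h]; exact hpos K (by simp)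
      · exact hm K' (hK'1 h).1
    have htel : ∀ n : ℕ, K' + n ≤ K → g K (K' + n) = g K K' + ∑ c ∈ Finset.Ioc K' (K' + n), t c := by
      intro n
      induction n with
      | zero => simp
      | succ n ihn =>
        intro hn
        push_cast at hn ⊢
        rw [← add_assoc] at hn ⊢
        have := hstep K (by simp) (K' + n + 1) (by omega) hn (by
          intro d hd
          rcases Finset.mem_insert.1 hd with rfl | hd
          · omega
          · have := hle' d hd; omega)
        rw [this, show K' + (n : ℤ) + 1 - 1 = K' + n by ring, ihn (by omega)]
        have : Finset.Ioc K' (K' + n + 1) = insert (K' + n + 1) (Finset.Ioc K' (K' + n)) := by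
          ext x; simp only [Finset.mem_Ioc, Finset.mem_insert]; omega
        rw [this, Finset.sum_insert (by simp)]
        ring
    have htel' := htel (K - K').toNat (by omega)
    rw [Int.toNat_of_nonneg (by omega), show K' + (K - K') = K by ring] at htel'
    have hsplit : ∑ c ∈ Finset.Ioc a K, t c = ∑ c ∈ Finset.Ioc a K', t c + ∑ c ∈ Finset.Ioc K' K, t c := by
      rw [← Finset.sum_union]
      · congr 1; ext x; simp only [Finset.mem_Ioc, Finset.mem_union]; omega
      · rw [Finset.disjoint_left]; intro x; simp only [Finset.mem_Ioc]; omega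
    rw [Finset.sum_insert hnm, Finset.sum_insert hnm]
    have e1 : ∀ e ∈ C, ∑ d ∈ insert K C,
        (if d < e ∧ ∀ s ∈ insert K C, ¬ (d < s ∧ s < e) then g e d else 0) = ∑ d ∈ C,
        (if d < e ∧ ∀ s ∈ C, ¬ (d < s ∧ s < e) then g e d else 0) := by
      intro e he
      have hek := hm e he
      rw [Finset.sum_insert hnm, if_neg (by omega), zero_add]
      apply Finset.sum_congr rfl
      intro d hd
      apply if_congr _ rfl rfl
      simp only [Finset.mem_insert, forall_eq_or_imp]
      constructor
      · tauto
      · rintro ⟨h1, h2⟩; exact ⟨h1, by omega, h2⟩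
    rw [Finset.sum_congr rfl e1]
    have e2 : ∑ d ∈ insert K C,
        (if d < K ∧ ∀ s ∈ insert K C, ¬ (d < s ∧ s < K) then g K d else 0) = g K K' := by
      rcases C.eq_empty_or_nonempty with h | h
      · subst h
        rw [hK'2 rfl, hzero K (by simp)]
        simp
      · obtain ⟨h1, h2⟩ := hK'1 h
        rw [Finset.sum_eq_single K']
        · rw [if_pos]
          refine ⟨hK'K, ?_⟩
          intro s hs
          rcases Finset.mem_insert.1 hs with rfl | hs
          · omega
          · have := h2 s hs; omega
        · intro d hd hdK
          rw [if_neg]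
          rintro ⟨h3, h4⟩
          have h5 := h4 K' (Finset.mem_insert_of_mem h1)
          rcases Finset.mem_insert.1 hd with rfl | hd
          · omega
          · have := h2 d hd; omega
        · intro h3; exact absurd (Finset.mem_insert_of_mem h1) h3
    rw [e2, hsplit, htel', hIH]
    ring

def RT (P : Finset Cell) (c : ℤ) : Finset Cell := P.filter (fun x => x.2 ≤ c ∧ (x.1, c) ∈ P)

open scoped Classical in
noncomputable def CC (P : Finset Cell) : Finset ℤ :=
  (colSet P).filter (fun c => ∃ r, (r, c) ∈ P ∧ (r, c + 1) ∉ P)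

lemma mem_CC (P : Finset Cell) (c : ℤ) : c ∈ CC P ↔ ∃ r, (r, c) ∈ P ∧ (r, c + 1) ∉ P := by
  simp only [CC, Finset.mem_filter, colSet, Finset.mem_image]
  constructor
  · tauto
  · rintro ⟨r, h1, h2⟩; exact ⟨⟨_, h1, rfl⟩, r, h1, h2⟩

lemma RT_rect (P : Finset Cell) (hPc : ColConvex P) (c₀ : ℤ)
    (hc : ∀ r c d : ℤ, (r, c) ∈ P → c₀ ≤ d → d ≤ c → (r, d) ∈ P)
    (hc0 : ∀ x ∈ P, c₀ ≤ x.2) (c r : ℤ) (hr : (r, c) ∈ P) : IsRect (RT P c) := by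
  let I := (P.filter (fun x => x.2 = c)).image Prod.fst
  have hI : ∀ s, s ∈ I ↔ (s, c) ∈ P := by
    intro s
    simp only [I, Finset.mem_image, Finset.mem_filter]
    constructor
    · rintro ⟨⟨x, y⟩, ⟨h, rfl⟩, rfl⟩; exact h
    · intro h; exact ⟨_, ⟨h, rfl⟩, rfl⟩
  have hne : I.Nonempty := ⟨r, (hI r).2 hr⟩
  refine ⟨I.min' hne, I.max' hne, c₀, c, I.min'_le_max' hne, hc0 _ hr, ?_⟩
  ext ⟨a, b⟩
  simp only [RT, Finset.mem_filter, Finset.mem_product, Finset.mem_Icc]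
  constructor
  · rintro ⟨h1, h2, h3⟩
    exact ⟨⟨I.min'_le a ((hI a).2 h3), I.le_max' a ((hI a).2 h3)⟩, hc0 _ h1, h2⟩
  · rintro ⟨⟨h1, h2⟩, h3, h4⟩
    have := hPc c _ _ a ((hI _).1 (I.min'_mem hne)) ((hI _).1 (I.max'_mem hne)) h1 h2
    exact ⟨hc a c b this h3 h4, h4, this⟩

lemma maxRects_eq (P : Finset Cell) (hPc : ColConvex P) (c₀ : ℤ)
    (hc : ∀ r c d : ℤ, (r, c) ∈ P → c₀ ≤ d → d ≤ c → (r, d) ∈ P)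
    (hc0 : ∀ x ∈ P, c₀ ≤ x.2) : maxRects P = (CC P).image (RT P) := by
  ext R
  simp only [maxRects, Finset.mem_filter, Finset.mem_powerset, Finset.mem_image, mem_CC]
  constructor
  · rintro ⟨hsub, ⟨r₁, r₂, c₁, c₂, h1, h2, rfl⟩, -, hmax⟩
    have hmem : ∀ a b, r₁ ≤ a → a ≤ r₂ → c₁ ≤ b → b ≤ c₂ → (a, b) ∈ P := by
      intro a b ha hb hc hd
      apply hsub; simp [*]
    have hr := hmem r₁ c₂ le_rfl h1 h2 le_rfl
    have hR : ∀ c, c₂ ≤ c → (∀ a, r₁ ≤ a → a ≤ r₂ → (a, c) ∈ P) →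
        RT P c = Finset.Icc r₁ r₂ ×ˢ Finset.Icc c₁ c₂ := by
      intro c hcc hall
      apply hmax _ (RT_rect P hPc c₀ hc hc0 c r₁ (hall r₁ le_rfl h1)) (Finset.filter_subset _ _)
      rintro ⟨a, b⟩ hab
      have hP := hsub hab
      simp only [Finset.mem_product, Finset.mem_Icc] at hab
      simp only [RT, Finset.mem_filter]
      exact ⟨hP, by omega, hall a hab.1.1 hab.1.2⟩
    have hR2 := hR c₂ le_rfl (fun a ha hb => hmem a c₂ ha hb h2 le_rfl)
    refine ⟨c₂, ?_, hR2⟩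
    by_contra hno
    push Not at hno
    have hR3 := hR (c₂ + 1) (by omega) (fun a ha hb => hno a (hmem a c₂ ha hb h2 le_rfl))
    have hx : (r₁, c₂ + 1) ∈ RT P (c₂ + 1) := by
      simp only [RT, Finset.mem_filter]
      exact ⟨hno _ hr, le_rfl, hno _ hr⟩
    rw [hR3] at hx
    simp only [Finset.mem_product, Finset.mem_Icc] at hx
    omega
  · rintro ⟨c, ⟨r, hr, hr'⟩, rfl⟩
    refine ⟨Finset.filter_subset _ _, RT_rect P hPc c₀ hc hc0 c r hr, Finset.filter_subset _ _, ?_⟩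
    rintro R' ⟨r₁, r₂, c₁, c₂, h1, h2, rfl⟩ hsub hRT
    apply Finset.Subset.antisymm _ hRT
    have hx : (r, c) ∈ RT P c := by
      simp only [RT, Finset.mem_filter]; exact ⟨hr, le_rfl, hr⟩
    have hx := hRT hx
    simp only [Finset.mem_product, Finset.mem_Icc] at hx
    rintro ⟨a, b⟩ hab
    have hP := hsub hab
    simp only [Finset.mem_product, Finset.mem_Icc] at hab
    simp only [RT, Finset.mem_filter]
    refine ⟨hP, ?_, hsub (by simp only [Finset.mem_product, Finset.mem_Icc]; omega)⟩
    by_contra hcb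
    exact hr' (hsub (by simp only [Finset.mem_product, Finset.mem_Icc]; omega))

lemma nRows_lt (P : Finset Cell) (c₀ : ℤ)
    (hc : ∀ r c d : ℤ, (r, c) ∈ P → c₀ ≤ d → d ≤ c → (r, d) ∈ P)
    (hc0 : ∀ x ∈ P, c₀ ≤ x.2) (c d : ℤ) (hd : d ∈ CC P) (h : d < c) :
    nRows (RT P c) < nRows (RT P d) := by
  obtain ⟨r, h1, h2⟩ := (mem_CC P d).1 hd
  have hd0 := hc0 _ h1
  simp only at hd0
  unfold nRows
  apply Finset.card_lt_card
  rw [Finset.ssubset_iff_of_subset]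
  · refine ⟨r, ?_, ?_⟩
    · simp only [RT, Finset.mem_image, Finset.mem_filter]
      exact ⟨_, ⟨h1, le_rfl, h1⟩, rfl⟩
    · simp only [RT, Finset.mem_image, Finset.mem_filter]
      rintro ⟨x, ⟨a, b, e⟩, rfl⟩
      exact h2 (hc _ _ _ e (by omega) (by omega))
  · intro s
    simp only [RT, Finset.mem_image, Finset.mem_filter]
    rintro ⟨x, ⟨a, b, e⟩, rfl⟩
    have := hc _ _ d e hd0 h.le
    exact ⟨(x.1, d), ⟨this, le_rfl, this⟩, rfl⟩

lemma maj_core (P : Finset Cell) (hPc : ColConvex P) (N : Finset ℤ) (c₀ K : ℤ)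
    (hc : ∀ r c d : ℤ, (r, c) ∈ P → c₀ ≤ d → d ≤ c → (r, d) ∈ P)
    (hc0 : ∀ x ∈ P, c₀ ≤ x.2)
    (hK : ∀ x ∈ P, x.2 ≤ K) (hKm : ∃ r, (r, K) ∈ P)
    (w : ℤ → ℤ) (hw : ∀ r ∈ N, (r, w r) ∈ P) :
    majP P (cells N w) = ∑ c ∈ Finset.Icc c₀ K, binv (sg (vv P N w c) (bt P N w c)) := by
  classical
  set g : ℤ → ℤ → ℕ := fun e d => majR (cells (N.filter (fun r => (r, e) ∈ P ∧ w r ≤ d)) w) with hg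
  set t : ℤ → ℕ := fun c => binv (sg (vv P N w c) (bt P N w c)) with ht
  have hgt : ∀ c, g c c = t c + g c (c - 1) := by
    intro c
    have a1 : g c c = mj (wd P N w c) := by
      simp only [hg, majR_sort]; rfl
    have a2 : g c (c - 1) = mj (vv P N w c) := by
      simp only [hg, majR_sort, vv_eq, Int.le_sub_one_iff]
    rw [a1, a2]
    have := main_list c (wd P N w c) (by
      intro x hx
      simp only [wd, List.mem_map, Finset.mem_sort, SL, Finset.mem_filter] at hx
      obtain ⟨r, h, rfl⟩ := hx
      exact h.2.2)
    rw [this, add_comm]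
    rfl
  have hCpos : ∀ e ∈ CC P, c₀ ≤ e := by
    intro e he
    obtain ⟨r, h, _⟩ := (mem_CC P e).1 he
    exact hc0 _ h
  have hcongr : ∀ n : ℕ, ∀ c e, c₀ ≤ c → e = c + n → (∀ d ∈ CC P, ¬ (c ≤ d ∧ d < e)) →
      ∀ r, ((r, c) ∈ P ↔ (r, e) ∈ P) := by
    intro n
    induction n with
    | zero => intro c e _ h _ r; simp at h; rw [h]
    | succ n ih =>
      intro c e hcc h hno r
      rw [ih c (c + n) hcc rfl (fun d hd h' => hno d hd ⟨h'.1, by push_cast at h; omega⟩)]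
      have he : e = c + n + 1 := by push_cast at h; omega
      constructor
      · intro h1
        by_contra h2
        exact hno (c + n) ((mem_CC P _).2 ⟨r, h1, by rw [← he]; exact h2⟩) (by omega)
      · intro h1; exact hc _ _ _ h1 (by omega) (by omega)
  have hKC : K ∈ CC P := by
    obtain ⟨r, hr⟩ := hKm
    refine (mem_CC P K).2 ⟨r, hr, fun h => ?_⟩
    have := hK _ h; simp at this
  have hle : ∀ e ∈ CC P, e ≤ K := by
    intro e he
    obtain ⟨r, h, _⟩ := (mem_CC P e).1 he
    exact hK _ h
  have hT := tele g t (c₀ - 1) (CC P) K (fun e he => by have := hCpos e he; omega) (by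
      intro e he
      have : N.filter (fun r => (r, e) ∈ P ∧ w r ≤ c₀ - 1) = ∅ := by
        ext r; simp only [Finset.mem_filter, Finset.notMem_empty, iff_false]
        rintro ⟨a, _, b⟩
        have := hc0 _ (hw r a); simp at this; omega
      simp only [hg, this]; simp [majR, cells]) (by
      intro e he c h1 h2 h3
      have hiff := hcongr (e - c).toNat c e (by omega) (by
        rw [Int.toNat_of_nonneg (by omega)]; ring) h3
      have : ∀ d, g e d = g c d := by
        intro d; simp only [hg, hiff]
      rw [this, this, hgt]) (fun _ => ⟨hKC, hle⟩) (fun h => by rw [h] at hKC; simp at hKC)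
  have hIoc : Finset.Ioc (c₀ - 1) K = Finset.Icc c₀ K := by
    ext x; simp only [Finset.mem_Ioc, Finset.mem_Icc]; omega
  rw [hIoc] at hT
  have hlt : ∀ c ∈ CC P, ∀ d ∈ CC P, (nRows (RT P c) < nRows (RT P d) ↔ d < c) := by
    intro c hcC d hd
    constructor
    · intro h
      by_contra h'
      rcases eq_or_lt_of_le (not_lt.1 h') with rfl | h'
      · exact lt_irrefl _ h
      · have := nRows_lt P c₀ hc hc0 d c hcC h'; omega
    · exact nRows_lt P c₀ hc hc0 c d hd
  have hinj : Set.InjOn (RT P) (CC P : Set ℤ) := by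
    intro c hcC d hd h
    have h1 := hlt c hcC d hd
    have h2 := hlt d hd c hcC
    rw [h] at h1 h2
    omega
  unfold majP
  rw [maxRects_eq P hPc c₀ hc hc0, Finset.sum_image hinj]
  have e1 : ∑ e ∈ CC P, majR (cells N w ∩ RT P e) = ∑ e ∈ CC P, g e e := by
    apply Finset.sum_congr rfl
    intro e he
    simp only [hg]
    congr 1
    ext x
    simp only [cells, RT, Finset.mem_inter, Finset.mem_image, Finset.mem_filter]
    constructor
    · rintro ⟨⟨r, h, rfl⟩, h1, h2, h3⟩; exact ⟨r, ⟨h, h3, h2⟩, rfl⟩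
    · rintro ⟨r, ⟨h, h3, h2⟩, rfl⟩; exact ⟨⟨r, h, rfl⟩, hw r h, h2, h3⟩
  rw [e1, hT]
  rw [Nat.sub_eq_of_eq_add]
  rw [add_comm]
  congr 1
  rw [Finset.sum_filter, Finset.sum_product, Finset.sum_image hinj]
  apply Finset.sum_congr rfl
  intro e he
  rw [Finset.sum_image hinj]
  apply Finset.sum_congr rfl
  intro d hd
  have hiff : (nRows (RT P e) < nRows (RT P d) ∧
      ∀ T ∈ (CC P).image (RT P), ¬ (nRows (RT P e) < nRows T ∧ nRows T < nRows (RT P d))) ↔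
      (d < e ∧ ∀ s ∈ CC P, ¬ (d < s ∧ s < e)) := by
    rw [hlt e he d hd]
    refine and_congr_right (fun _ => ?_)
    rw [Finset.forall_mem_image]
    refine forall₂_congr (fun s hs => ?_)
    rw [hlt e he s hs, hlt s hs d hd, and_comm]
  by_cases hcond : d < e ∧ ∀ s ∈ CC P, ¬ (d < s ∧ s < e)
  · rw [if_pos hcond, if_pos (hiff.2 hcond)]
    simp only [hg]
    congr 1
    have hd0 := hCpos d hd
    ext x
    simp only [cells, RT, Finset.mem_inter, Finset.mem_image, Finset.mem_filter]
    constructor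
    · rintro ⟨r, ⟨h, h3, h2⟩, rfl⟩
      have := hcond.1
      exact ⟨⟨⟨r, h, rfl⟩, hw r h, by simp only; omega, h3⟩, hw r h, h2, hc _ _ _ h3 hd0 this.le⟩
    · rintro ⟨⟨⟨r, h, rfl⟩, h1, h2, h3⟩, h4, h5, h6⟩; exact ⟨r, ⟨h, h3, h5⟩, rfl⟩
  · rw [if_neg hcond, if_neg (fun h => hcond (hiff.1 h))]

lemma card_cells_col (N : Finset ℤ) (w : ℤ → ℤ) (c : ℤ) :
    ((cells N w).filter fun x => x.2 = c).card = (N.filter (fun r => w r = c)).card := by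
  rw [cells_filter N w (fun x => x.2 = c) (fun r => w r = c) (fun r _ => Iff.rfl), cells,
    Finset.card_image_of_injective]
  intro a b h; exact (Prod.mk.inj h).1

lemma mem_fill (P : Finset Cell) (s : ℤ → ℕ) (A : Finset ℤ) (M : Finset Cell) :
    M ∈ FillSet P s A ↔ ∃ w : ℤ → ℤ, (∀ r ∈ rowSet P \ A, (r, w r) ∈ P) ∧
      M = cells (rowSet P \ A) w ∧
      ∀ c ∈ colSet P, ((rowSet P \ A).filter (fun r => w r = c)).card = s c := by
  simp only [FillSet, Finset.mem_filter, Finset.mem_powerset]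
  constructor
  · rintro ⟨hsub, h1, h2, h3⟩
    have hex : ∀ r, ∃ d, r ∈ rowSet P \ A → (r, d) ∈ M := by
      intro r
      by_cases hr : r ∈ rowSet P \ A
      · rw [Finset.mem_sdiff] at hr
        have := mt (h3 r hr.1).2 hr.2
        push Not at this
        obtain ⟨x, hx, rfl⟩ := this
        exact ⟨x.2, fun _ => hx⟩
      · exact ⟨0, fun h => absurd h hr⟩
    choose w hw using hex
    have hM : M = cells (rowSet P \ A) w := by
      ext x
      simp only [cells, Finset.mem_image]
      constructor
      · intro hx
        have hxr : x.1 ∈ rowSet P := Finset.mem_image_of_mem _ (hsub hx)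
        have hr : x.1 ∈ rowSet P \ A :=
          Finset.mem_sdiff.2 ⟨hxr, fun hA => (h3 _ hxr).1 hA x hx rfl⟩
        exact ⟨x.1, hr, h1 _ (hw _ hr) _ hx rfl⟩
      · rintro ⟨r, hr, rfl⟩; exact hw r hr
    refine ⟨w, fun r hr => hsub (hw r hr), hM, ?_⟩
    intro c hcc
    rw [← h2 c hcc, ← card_cells_col, ← hM]
  · rintro ⟨w, hw, rfl, hs⟩
    refine ⟨?_, ?_, ?_, ?_⟩
    · intro x hx
      obtain ⟨r, hr, rfl⟩ := Finset.mem_image.1 hx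
      exact hw r hr
    · intro x hx y hy h
      obtain ⟨r, hr, rfl⟩ := Finset.mem_image.1 hx
      obtain ⟨r', hr', rfl⟩ := Finset.mem_image.1 hy
      simp only at h; rw [h]
    · intro c hcc; rw [← hs c hcc, card_cells_col]
    · intro r hr
      constructor
      · rintro hA x hx rfl
        obtain ⟨r, hr', rfl⟩ := Finset.mem_image.1 hx
        exact (Finset.mem_sdiff.1 hr').2 hA
      · intro h
        by_contra hA
        exact h (r, w r) (Finset.mem_image.2 ⟨r, Finset.mem_sdiff.2 ⟨hr, hA⟩, rfl⟩) rfl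

lemma cells_inj (N : Finset ℤ) (w w' : ℤ → ℤ) (h : cells N w = cells N w') :
    ∀ r ∈ N, w r = w' r := by
  intro r hr
  have : (r, w r) ∈ cells N w := Finset.mem_image.2 ⟨r, hr, rfl⟩
  rw [h] at this
  obtain ⟨r', _, h'⟩ := Finset.mem_image.1 this
  obtain ⟨rfl, h2⟩ := Prod.mk.inj h'
  exact h2.symm

lemma cells_congr (N : Finset ℤ) (w w' : ℤ → ℤ) (h : ∀ r ∈ N, w r = w' r) :
    cells N w = cells N w' := by
  unfold cells
  apply Finset.image_congr
  intro r hr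
  simp [h r hr]

/-- **Theorem (STATEMENT 12).** For a left-aligned stack polyomino `P`, column sums `s`
and empty rows `A`, there is a bijection `φ` of `F(P,s;A)` onto itself with
`maj(M) = ne(φ(M))` for all `M`, which moreover leaves the topmost nonempty row
unchanged (the 1-cell of minimal row index is the same in `M` and `φ(M)`). -/
theorem foata_bijection_left_aligned (P : Finset Cell) (hP : IsMoon P)
    (hL : LeftAligned P) (s : ℤ → ℕ) (A : Finset ℤ) (hA : A ⊆ rowSet P) :
    ∃ φ : Finset Cell → Finset Cell,
      Set.BijOn φ ↑(FillSet P s A) ↑(FillSet P s A) ∧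
      (∀ M ∈ FillSet P s A, majP P M = neP P (φ M)) ∧
      (∀ M ∈ FillSet P s A, ∀ x ∈ M, (∀ y ∈ M, x.1 ≤ y.1) → x ∈ φ M) := by
  classical
  rcases P.eq_empty_or_nonempty with rfl | hne
  · refine ⟨id, Set.bijOn_id _, ?_, fun M _ x hx _ => hx⟩
    intro M hM
    obtain ⟨w, _, rfl, _⟩ := (mem_fill _ _ _ _).1 hM
    simp [cells, rowSet, majP, neP, majR]
  obtain ⟨hrow, hcol, -⟩ := hP
  obtain ⟨c₀, hL⟩ := hL
  have hc0 : ∀ x ∈ P, c₀ ≤ x.2 := fun x hx => (hL x hx).1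
  have hc : ∀ r c d : ℤ, (r, c) ∈ P → c₀ ≤ d → d ≤ c → (r, d) ∈ P :=
    fun r c d h h1 h2 => hrow r c₀ c d (hL _ h).2 h h1 h2
  obtain ⟨xm, hxm, hK⟩ := Finset.exists_max_image P Prod.snd hne
  have hKm : ∃ r, (r, xm.2) ∈ P := ⟨xm.1, hxm⟩
  generalize xm.2 = K at hK hKm
  set N := rowSet P \ A with hN
  have hex : ∀ M, ∃ M', M ∈ FillSet P s A → ∃ w w' : ℤ → ℤ,
      (∀ r ∈ N, (r, w r) ∈ P) ∧ (∀ r ∈ N, (r, w' r) ∈ P) ∧ M = cells N w ∧ M' = cells N w' ∧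
      M' ∈ FillSet P s A ∧
      ∀ c, bt P N w' c = sg (vv P N w c) (bt P N w c) := by
    intro M
    by_cases hM : M ∈ FillSet P s A
    · obtain ⟨w, hw, hMw, hs⟩ := (mem_fill _ _ _ _).1 hM
      obtain ⟨w', hw', hb⟩ := exists_img P N c₀ K hc hc0 hK w hw
        (fun c => sg (vv P N w c) (bt P N w c)) (fun c => sg_perm _ _)
      refine ⟨cells N w', fun _ => ⟨w, w', hw, hw', hMw, rfl, ?_, hb⟩⟩
      refine (mem_fill _ _ _ _).2 ⟨w', hw', rfl, ?_⟩
      intro c hcc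
      rw [← hs c hcc, ← hN]
      rw [← count_bt P N w' c (by rintro r hr rfl; exact hw' r hr),
        ← count_bt P N w c (by rintro r hr rfl; exact hw r hr), hb]
      exact (sg_perm _ _).count_eq _
    · exact ⟨∅, fun h => absurd h hM⟩
  choose φ hφ using hex
  refine ⟨φ, ?_, ?_, ?_⟩
  · have hmaps : Set.MapsTo φ ↑(FillSet P s A) ↑(FillSet P s A) := by
      intro M hM
      obtain ⟨w, w', _, _, _, _, h, _⟩ := hφ M hM
      exact h
    have hinj : Set.InjOn φ ↑(FillSet P s A) := by
      intro M₁ hM₁ M₂ hM₂ h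
      obtain ⟨w₁, w₁', a1, a2, a3, a4, a5, a6⟩ := hφ M₁ hM₁
      obtain ⟨w₂, w₂', b1, b2, b3, b4, b5, b6⟩ := hφ M₂ hM₂
      rw [a4, b4] at h
      have hw := cells_inj N _ _ h
      rw [a3, b3]
      apply cells_congr
      apply inj_core P hcol N c₀ K hc hc0 hK w₁ w₂ a1 b1
      intro c
      rw [← a6, ← b6]
      apply bt_congr
      · intro r hr _; rw [hw r hr]
      · intro r hr _; rw [hw r hr]
    refine ⟨hmaps, hinj, ?_⟩
    exact Finset.surjOn_of_injOn_of_card_le φ hmaps hinj le_rfl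
  · intro M hM
    obtain ⟨w, w', a1, a2, a3, a4, a5, a6⟩ := hφ M hM
    rw [a4, a3, maj_core P hcol N c₀ K hc hc0 hK hKm w a1,
      ne_core P hcol N c₀ K hc hc0 hK w' a2]
    apply Finset.sum_congr rfl
    intro c _
    rw [a6]
  · intro M hM x hx hmin
    obtain ⟨w, w', a1, a2, a3, a4, a5, a6⟩ := hφ M hM
    rw [a3] at hx hmin
    obtain ⟨r, hr, rfl⟩ := Finset.mem_image.1 hx
    have := top_core P N w w' a1 a2 a6 r hr (fun s hs =>
      hmin (s, w s) (Finset.mem_image.2 ⟨s, hs, rfl⟩))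
    rw [a4, ← this]
    exact Finset.mem_image.2 ⟨r, hr, rfl⟩

end MoonPolyomino
end

section
/- Let 𝓜 be a moon polyomino, s a tuple of nonnegative integers indexed by the columns of 𝓜, and A a set of rows of 𝓜. Then there exists a bijection ψ: F(𝓜,s;A) → F(𝓜,s;A) such that maj(M) = ne(ψ(M)) for every M ∈ F(𝓜,s;A). -/
open Polynomial

namespace MoonPolyomino

/-! ### words -/

def comaj : List ℤ → ℕ
  | [] => 0
  | [_] => 0
  | x :: y :: t => (if y < x then t.length + 1 else 0) + comaj (y :: t)

def linv : List ℤ → ℕ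
  | [] => 0
  | x :: t => t.countP (fun y => decide (y < x)) + linv t

noncomputable def gb : ℕ → ℕ → ℕ[X]
  | _, 0 => 1
  | 0, _ + 1 => 1
  | k + 1, m + 1 => gb (k + 1) m + X ^ (m + 1) * gb k (m + 1)

theorem gb_zero_left (m : ℕ) : gb 0 m = 1 := by cases m <;> simp [gb]
theorem gb_zero_right (k : ℕ) : gb k 0 = 1 := by cases k <;> simp [gb]
theorem gb_succ (k m : ℕ) : gb (k + 1) (m + 1) = gb (k + 1) m + X ^ (m + 1) * gb k (m + 1) := by
  rw [gb]

theorem gb_dual (k m : ℕ) : gb (k + 1) (m + 1) = X ^ (k + 1) * gb (k + 1) m + gb k (m + 1) := by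
  induction k generalizing m with
  | zero =>
    induction m with
    | zero => rw [gb_succ]; simp [gb_zero_left, gb_zero_right, add_comm]
    | succ m ih =>
      have h : X ^ (0 + 1) * gb (0 + 1) (m + 1)
          = X ^ (0 + 1) * (gb (0 + 1) m + X ^ (m + 1) * gb 0 (m + 1)) := by rw [gb_succ]
      rw [gb_succ 0 (m + 1), h, ih]
      simp only [gb_zero_left]; ring
  | succ k ihk =>
    induction m with
    | zero =>
      rw [gb_succ, gb_zero_right]
      have h1 := ihk 0
      have h2 := gb_succ k 0
      simp only [gb_zero_right, zero_add] at h1 h2 ⊢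
      have h3 : X ^ 1 * gb (k + 1) 1 = X ^ 1 * (X ^ (k + 1) * 1 + gb k 1) := by rw [h1]
      rw [h3, h2]; ring
    | succ m ihm =>
      rw [gb_succ (k + 1) (m + 1)]
      have e1 : X ^ (m + 1 + 1) * gb (k + 1) (m + 1 + 1)
        = X ^ (m + 1 + 1) * (X ^ (k + 1) * gb (k + 1) (m + 1) + gb k (m + 1 + 1)) := by rw [ihk]
      have e2 : X ^ (k + 1 + 1) * gb (k + 1 + 1) (m + 1)
        = X ^ (k + 1 + 1) * (gb (k + 1 + 1) m + X ^ (m + 1) * gb (k + 1) (m + 1)) := by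
          rw [gb_succ (k + 1) m]
      rw [e1, e2, gb_succ k (m + 1), ihm]
      ring

def ins (c : ℤ) : ℕ → List ℤ → Finset (List ℤ)
  | 0, u => {u}
  | m + 1, [] => (ins c m []).image (fun w => c :: w)
  | m + 1, x :: u => (ins c m (x :: u)).image (fun w => c :: w) ∪
      (ins c (m + 1) u).image (fun w => x :: w)
termination_by m u => (m, u.length)

theorem mem_ins (c : ℤ) (m : ℕ) (u : List ℤ) (hc : c ∉ u) (w : List ℤ) :
    w ∈ ins c m u ↔ w.count c = m ∧ w.filter (fun x => decide (x ≠ c)) = u := by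
  induction m generalizing u w with
  | zero =>
    rw [ins, Finset.mem_singleton]
    constructor
    · rintro rfl
      refine ⟨List.count_eq_zero.2 hc, List.filter_eq_self.2 ?_⟩
      intro a ha
      simp only [decide_eq_true_eq]
      rintro rfl; exact hc ha
    · rintro ⟨h1, h2⟩
      rw [← h2, eq_comm, List.filter_eq_self]
      intro a ha
      simp only [decide_eq_true_eq]
      rintro rfl; exact List.count_eq_zero.1 h1 ha
  | succ m ihm =>
    induction u generalizing w with
    | nil =>
      rw [ins, Finset.mem_image]
      constructor
      · rintro ⟨v, hv, rfl⟩
        obtain ⟨h1, h2⟩ := (ihm [] hc v).1 hv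
        simp [h1] at h2 ⊢
        exact h2
      · rintro ⟨h1, h2⟩
        cases w with
        | nil => simp at h1
        | cons a w =>
          have : a = c := by
            by_contra h
            simp [List.filter_cons, h] at h2
          subst this
          refine ⟨w, (ihm [] hc w).2 ⟨by simpa using h1, by simpa [List.filter_cons] using h2⟩, rfl⟩
    | cons x u ihu =>
      have hx : x ≠ c := by rintro rfl; simp at hc
      have hu : c ∉ u := fun h => hc (List.mem_cons_of_mem _ h)
      rw [ins, Finset.mem_union, Finset.mem_image, Finset.mem_image]
      constructor
      · rintro (⟨v, hv, rfl⟩ | ⟨v, hv, rfl⟩)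
        · obtain ⟨h1, h2⟩ := (ihm _ hc v).1 hv
          refine ⟨by simp [h1], ?_⟩
          rw [List.filter_cons_of_neg (by simp)]; exact h2
        · obtain ⟨h1, h2⟩ := (ihu hu v).1 hv
          refine ⟨by rw [List.count_cons_of_ne hx]; exact h1, ?_⟩
          rw [List.filter_cons_of_pos (by simpa using hx), h2]
      · rintro ⟨h1, h2⟩
        cases w with
        | nil => simp at h1
        | cons a w =>
          by_cases h : a = c
          · subst h
            left
            refine ⟨w, (ihm _ hc w).2 ⟨by simpa using h1, ?_⟩, rfl⟩
            rw [List.filter_cons_of_neg (by simp)] at h2; exact h2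
          · right
            rw [List.filter_cons_of_pos (by simpa using h)] at h2
            rw [List.count_cons_of_ne h] at h1
            injection h2 with h3 h4
            subst h3
            exact ⟨w, (ihu hu w).2 ⟨h1, h4⟩, rfl⟩

theorem countP_filter_ne (c : ℤ) (p : ℤ → Bool) (w : List ℤ) :
    w.countP p = (w.filter (fun x => decide (x ≠ c))).countP p + (if p c then w.count c else 0) := by
  induction w with
  | nil => simp
  | cons a w ih =>
    by_cases h : a = c
    · subst h
      rw [List.filter_cons_of_neg (by simp), List.countP_cons, ih]
      by_cases hp : p a <;> simp [hp]; omega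
    · rw [List.filter_cons_of_pos (by simpa using h), List.countP_cons, ih, List.countP_cons,
        List.count_cons_of_ne h]
      omega

theorem countP_ins {c : ℤ} {m : ℕ} {u w : List ℤ} (hc : c ∉ u) (h : w ∈ ins c m u)
    (p : ℤ → Bool) : w.countP p = u.countP p + (if p c then m else 0) := by
  obtain ⟨h1, h2⟩ := (mem_ins c m u hc w).1 h
  rw [countP_filter_ne c p w, h1, h2]

theorem length_ins {c : ℤ} {m : ℕ} {u w : List ℤ} (hc : c ∉ u) (h : w ∈ ins c m u) :
    w.length = u.length + m := by
  have := countP_ins hc h (fun _ => true)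
  simpa using this

theorem mem_of_ins {c : ℤ} {m : ℕ} {u w : List ℤ} (hc : c ∉ u) (h : w ∈ ins c m u) {d : ℤ}
    (hd : d ∈ w) : d = c ∨ d ∈ u := by
  obtain ⟨h1, h2⟩ := (mem_ins c m u hc w).1 h
  by_cases hh : d = c
  · exact Or.inl hh
  · right; rw [← h2, List.mem_filter]; exact ⟨hd, by simpa using hh⟩

theorem sum_ins_succ_nil {c : ℤ} {m : ℕ} (F : List ℤ → ℕ[X]) :
    ∑ w ∈ ins c (m + 1) [], F w = ∑ w ∈ ins c m [], F (c :: w) := by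
  rw [ins, Finset.sum_image]
  intro a _ b _ h; simpa using h

theorem sum_ins_succ_cons {c : ℤ} {m : ℕ} {x : ℤ} {u : List ℤ} (hx : x ≠ c)
    (F : List ℤ → ℕ[X]) :
    ∑ w ∈ ins c (m + 1) (x :: u), F w
      = ∑ w ∈ ins c m (x :: u), F (c :: w) + ∑ w ∈ ins c (m + 1) u, F (x :: w) := by
  rw [ins, Finset.sum_union, Finset.sum_image, Finset.sum_image]
  · intro a _ b _ h; simpa using h
  · intro a _ b _ h; simpa using h
  · rw [Finset.disjoint_left]
    intro a h1 h2
    rw [Finset.mem_image] at h1 h2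
    obtain ⟨v, _, rfl⟩ := h1
    obtain ⟨v', _, h⟩ := h2
    injection h with h3 _
    exact hx h3

theorem comaj_cons_of_le {x : ℤ} {w : List ℤ} (h : ∀ y ∈ w, x ≤ y) : comaj (x :: w) = comaj w := by
  cases w with
  | nil => rfl
  | cons y t =>
    have := h y (by simp)
    rw [comaj, if_neg (by omega), zero_add]

theorem comaj_min (c : ℤ) (m : ℕ) (u : List ℤ) (hc : ∀ d ∈ u, c < d) :
    (∑ w ∈ ins c m u, (X : ℕ[X]) ^ comaj w = X ^ comaj u * gb u.length m) ∧
    ∀ y, c < y → ∑ w ∈ ins c m u, (X : ℕ[X]) ^ comaj (y :: w)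
      = X ^ (comaj (y :: u) + m) * gb u.length m := by
  induction m generalizing u with
  | zero => simp [ins, gb_zero_right]
  | succ m ihm =>
    have hcc : ∀ w ∈ ins c m u, comaj (c :: w) = comaj w := by
      intro w hw
      apply comaj_cons_of_le
      intro y hy
      rcases mem_of_ins (fun h => lt_irrefl _ (hc _ h)) hw hy with rfl | h
      · exact le_rfl
      · exact (hc _ h).le
    have hcu : c ∉ u := fun h => lt_irrefl _ (hc _ h)
    have hyc : ∀ y, c < y → ∀ w ∈ ins c m u, comaj (y :: c :: w) = (u.length + m + 1) + comaj w := by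
      intro y hy w hw
      rw [comaj, if_pos hy, hcc w hw, length_ins hcu hw]
    induction u with
    | nil =>
      constructor
      · rw [sum_ins_succ_nil, Finset.sum_congr rfl (fun w hw => by rw [hcc w hw]), (ihm [] hc).1]
        simp [gb_zero_left]
      · intro y hy
        rw [sum_ins_succ_nil, Finset.sum_congr rfl (fun w hw => by rw [hyc y hy w hw, pow_add]),
          ← Finset.mul_sum, (ihm [] hc).1]
        simp [gb_zero_left, comaj]
    | cons x u ihu =>
      have hx : c < x := hc x (by simp)
      have hu : ∀ d ∈ u, c < d := fun d hd => hc d (by simp [hd])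
      have hcu' : c ∉ u := fun h => lt_irrefl _ (hu _ h)
      have hH : ∀ y, c < y → ∑ w ∈ ins c (m+1) u, (X : ℕ[X]) ^ comaj (y :: w)
        = X ^ (comaj (y :: u) + (m + 1)) * gb u.length (m + 1) := by
        refine (ihu hu ?_ (fun h => lt_irrefl _ (hu _ h)) ?_).2
        · intro w hw
          apply comaj_cons_of_le
          intro y hy
          rcases mem_of_ins hcu' hw hy with rfl | h
          · exact le_rfl
          · exact (hu _ h).le
        · intro y hy w hw
          rw [comaj, if_pos hy, length_ins hcu' hw, comaj_cons_of_le]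
          intro y hy
          rcases mem_of_ins hcu' hw hy with rfl | h
          · exact le_rfl
          · exact (hu _ h).le
      constructor
      · rw [sum_ins_succ_cons hx.ne', Finset.sum_congr rfl (fun w hw => by rw [hcc w hw]),
          (ihm _ hc).1, hH x hx, List.length_cons, gb_succ]
        ring
      · intro y hy
        rw [sum_ins_succ_cons hx.ne',
          Finset.sum_congr rfl (fun w hw => by rw [hyc y hy w hw, pow_add]),
          ← Finset.mul_sum, (ihm _ hc).1]
        have : ∀ w ∈ ins c (m+1) u, (X : ℕ[X]) ^ comaj (y :: x :: w) =
          X ^ (if x < y then u.length + (m + 1) + 1 else 0) * X ^ comaj (x :: w) := by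
          intro w hw
          rw [comaj, length_ins hcu' hw, pow_add]
        rw [Finset.sum_congr rfl this, ← Finset.mul_sum, hH x hx, List.length_cons, comaj]
        split_ifs with h
        · rw [gb_succ]; ring
        · rw [gb_dual]; ring

theorem comaj_max (c : ℤ) (m : ℕ) (u : List ℤ) (hc : ∀ d ∈ u, d < c) :
    (∑ w ∈ ins c m u, (X : ℕ[X]) ^ comaj w = X ^ comaj u * gb u.length m) ∧
    (∑ w ∈ ins c m u, (X : ℕ[X]) ^ comaj (c :: w) = X ^ (comaj u + u.length) * gb u.length m) ∧
    ∀ y, y < c → ∑ w ∈ ins c m u, (X : ℕ[X]) ^ comaj (y :: w)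
      = X ^ (comaj (y :: u)) * gb u.length m := by
  induction m generalizing u with
  | zero =>
    refine ⟨by simp [ins, gb_zero_right], ?_, by simp [ins, gb_zero_right]⟩
    rw [ins, Finset.sum_singleton, gb_zero_right, mul_one]
    congr 1
    cases u with
    | nil => rfl
    | cons x u => rw [comaj, if_pos (hc x (by simp))]; simp; ring
  | succ m ihm =>
    have hcc : ∀ w : List ℤ, comaj (c :: c :: w) = comaj (c :: w) := by
      intro w; rw [comaj, if_neg (lt_irrefl _), zero_add]
    have hyc : ∀ y, y < c → ∀ w : List ℤ, comaj (y :: c :: w) = comaj (c :: w) := by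
      intro y hy w; rw [comaj, if_neg (by omega), zero_add]
    induction u with
    | nil =>
      obtain ⟨h1, h2, h3⟩ := ihm [] hc
      refine ⟨?_, ?_, ?_⟩
      · rw [sum_ins_succ_nil, h2]; simp [gb_zero_left]
      · rw [sum_ins_succ_nil, Finset.sum_congr rfl (fun w _ => by rw [hcc w]), h2]
        simp [gb_zero_left]
      · intro y hy
        rw [sum_ins_succ_nil, Finset.sum_congr rfl (fun w _ => by rw [hyc y hy w]), h2]
        simp [gb_zero_left, comaj]
    | cons x u ihu =>
      have hx : x < c := hc x (by simp)
      have hu : ∀ d ∈ u, d < c := fun d hd => hc d (by simp [hd])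
      have hcu' : c ∉ u := fun h => lt_irrefl _ (hu _ h)
      obtain ⟨h1, h2, h3⟩ := ihm _ hc
      obtain ⟨-, -, hH⟩ := ihu hu
      have key : ∀ y, ∑ w ∈ ins c (m+1) u, (X : ℕ[X]) ^ comaj (y :: x :: w) =
          X ^ (if x < y then u.length + (m + 1) + 1 else 0) *
            (X ^ (comaj (x :: u)) * gb u.length (m + 1)) := by
        intro y
        rw [← hH x hx, Finset.mul_sum]
        refine Finset.sum_congr rfl (fun w hw => ?_)
        rw [comaj, length_ins hcu' hw, pow_add]
      refine ⟨?_, ?_, ?_⟩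
      · rw [sum_ins_succ_cons hx.ne, h2, hH x hx, List.length_cons, gb_dual]; ring
      · rw [sum_ins_succ_cons hx.ne, Finset.sum_congr rfl (fun w _ => by rw [hcc w]), h2, key,
          if_pos hx, List.length_cons, gb_succ]; ring
      · intro y hy
        rw [sum_ins_succ_cons hx.ne, Finset.sum_congr rfl (fun w _ => by rw [hyc y hy w]), h2, key,
          List.length_cons, comaj]
        split_ifs with h
        · rw [gb_succ]; ring
        · rw [gb_dual]; ring

theorem linv_min (c : ℤ) (m : ℕ) (u : List ℤ) (hc : ∀ d ∈ u, c < d) :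
    ∑ w ∈ ins c m u, (X : ℕ[X]) ^ linv w = X ^ linv u * gb u.length m := by
  induction m generalizing u with
  | zero => simp [ins, gb_zero_right]
  | succ m ihm =>
    induction u with
    | nil =>
      have h0 : ∀ w ∈ ins c m [], linv (c :: w) = linv w := by
        intro w hw
        rw [linv, countP_ins (by simp) hw]; simp
      rw [sum_ins_succ_nil, Finset.sum_congr rfl (fun w hw => by rw [h0 w hw]), ihm [] hc]
      simp [gb_zero_left]
    | cons x u ihu =>
      have hx : c < x := hc x (by simp)
      have hcu : c ∉ x :: u := fun h => lt_irrefl _ (hc _ h)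
      have hu : ∀ d ∈ u, c < d := fun d hd => hc d (by simp [hd])
      have hcu' : c ∉ u := fun h => lt_irrefl _ (hu _ h)
      have h0 : ∀ w ∈ ins c m (x :: u), linv (c :: w) = linv w := by
        intro w hw
        rw [linv, countP_ins hcu hw, List.countP_eq_zero.2]
        · simp
        · intro a ha
          have := hc a ha
          simp; omega
      have h1 : ∀ w ∈ ins c (m+1) u, (X : ℕ[X]) ^ linv (x :: w)
        = X ^ (u.countP (fun y => decide (y < x)) + (m + 1)) * X ^ linv w := by
        intro w hw
        rw [linv, countP_ins hcu' hw, pow_add]; simp [hx]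
      rw [sum_ins_succ_cons hx.ne', Finset.sum_congr rfl (fun w hw => by rw [h0 w hw]), ihm _ hc,
        Finset.sum_congr rfl h1, ← Finset.mul_sum, ihu hu, List.length_cons, gb_succ, linv]
      ring

theorem linv_max (c : ℤ) (m : ℕ) (u : List ℤ) (hc : ∀ d ∈ u, d < c) :
    ∑ w ∈ ins c m u, (X : ℕ[X]) ^ linv w = X ^ linv u * gb u.length m := by
  induction m generalizing u with
  | zero => simp [ins, gb_zero_right]
  | succ m ihm =>
    induction u with
    | nil =>
      have h0 : ∀ w ∈ ins c m [], linv (c :: w) = linv w := by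
        intro w hw
        rw [linv, countP_ins (by simp) hw]; simp
      rw [sum_ins_succ_nil, Finset.sum_congr rfl (fun w hw => by rw [h0 w hw]), ihm [] hc]
      simp [gb_zero_left]
    | cons x u ihu =>
      have hx : x < c := hc x (by simp)
      have hcu : c ∉ x :: u := fun h => lt_irrefl _ (hc _ h)
      have hu : ∀ d ∈ u, d < c := fun d hd => hc d (by simp [hd])
      have hcu' : c ∉ u := fun h => lt_irrefl _ (hu _ h)
      have h0 : ∀ w ∈ ins c m (x :: u), (X : ℕ[X]) ^ linv (c :: w) =
          X ^ (u.length + 1) * X ^ linv w := by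
        intro w hw
        rw [linv, countP_ins hcu hw, List.countP_eq_length.2, pow_add]
        · simp
        · intro a ha
          have := hc a ha
          simpa using this
      have h1 : ∀ w ∈ ins c (m+1) u, (X : ℕ[X]) ^ linv (x :: w)
        = X ^ (u.countP (fun y => decide (y < x))) * X ^ linv w := by
        intro w hw
        rw [linv, countP_ins hcu' hw, pow_add]; simp [hx.not_gt]
      rw [sum_ins_succ_cons hx.ne, Finset.sum_congr rfl h0, ← Finset.mul_sum, ihm _ hc,
        Finset.sum_congr rfl h1, ← Finset.mul_sum, ihu hu, List.length_cons, gb_dual, linv]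
      ring

theorem comaj_sublist (w : List ℤ) : ∀ u : List ℤ, u.Sublist w → comaj u ≤ comaj w ∧
    ∀ a u' b w', u = a :: u' → w = b :: w' → a < b → comaj u + u.length ≤ comaj w := by
  induction w with
  | nil => intro u hu; simp at hu; subst hu; simp
  | cons x w ih =>
    have hle : comaj w ≤ comaj (x :: w) := by
      cases w with
      | nil => simp [comaj]
      | cons y t => rw [comaj]; omega
    have main : ∀ u : List ℤ, u.Sublist w → (∀ a u', u = a :: u' → a < x →
        comaj u + u.length ≤ comaj (x :: w)) := by
      intro u hu a u' hau hax
      obtain ⟨h1, h2⟩ := ih u hu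
      cases w with
      | nil => simp at hu; subst hu; simp at hau
      | cons y t =>
        rw [comaj]
        split_ifs with h
        · have := hu.length_le
          simp only [List.length_cons] at this
          omega
        · have := h2 a u' y t hau rfl (by omega)
          omega
    intro u hu
    cases hu with
    | cons _ h =>
      refine ⟨(ih u h).1.trans hle, ?_⟩
      rintro a u' b w' rfl hw hab
      injection hw with e1 e2
      subst e1
      exact main _ h a u' rfl hab
    | @cons_cons v _ _ h =>
      refine ⟨?_, ?_⟩
      · cases v with
        | nil => simp [comaj]
        | cons a v =>
          rw [comaj]
          split_ifs with hh
          · have := main _ h a v rfl hh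
            simp only [List.length_cons] at this
            omega
          · have := (ih _ h).1
            omega
      · intro a u' b w' e1 e2 hab
        injection e1 with e1 _
        injection e2 with e2 _
        omega

theorem linv_sublist (u w : List ℤ) (h : u.Sublist w) : linv u ≤ linv w := by
  induction h with
  | slnil => exact le_rfl
  | cons a _ ih => rw [linv]; omega
  | cons_cons a h ih => rw [linv, linv]; have := h.countP_le (p := fun y => decide (y < a)); omega

structure Good (f : List ℤ → ℕ) : Prop where
  mono : ∀ u w, List.Sublist u w → f u ≤ f w
  sum : ∀ c m u, ((∀ d ∈ u, c < d) ∨ (∀ d ∈ u, d < c)) →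
    ∑ w ∈ ins c m u, (X : ℕ[X]) ^ f w = X ^ f u * gb u.length m

theorem good_comaj : Good comaj :=
  ⟨fun u w h => (comaj_sublist w u h).1, fun c m u h => h.elim (fun h => (comaj_min c m u h).1)
    (fun h => (comaj_max c m u h).1)⟩

theorem good_linv : Good linv :=
  ⟨linv_sublist, fun c m u h => h.elim (linv_min c m u) (linv_max c m u)⟩

theorem Good.sum' {f : List ℤ → ℕ} (hf : Good f) (c : ℤ) (m : ℕ) (u : List ℤ)
    (h : (∀ d ∈ u, c < d) ∨ (∀ d ∈ u, d < c)) :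
    ∑ w ∈ ins c m u, (X : ℕ[X]) ^ (f w - f u) = gb u.length m := by
  have hcu : c ∉ u := by
    intro hc; rcases h with h | h <;> exact lt_irrefl _ (h _ hc)
  have h1 := hf.sum c m u h
  have h2 : ∑ w ∈ ins c m u, (X : ℕ[X]) ^ f w =
      X ^ f u * ∑ w ∈ ins c m u, (X : ℕ[X]) ^ (f w - f u) := by
    rw [Finset.mul_sum]
    refine Finset.sum_congr rfl (fun w hw => ?_)
    rw [← pow_add]
    congr 1
    have := hf.mono u w (by
      rw [← ((mem_ins c m u hcu w).1 hw).2]; exact List.filter_sublist)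
    omega
  rw [h2] at h1
  ext n
  have := congrArg (fun p => Polynomial.coeff p (n + f u)) h1
  simpa [Polynomial.coeff_X_pow_mul] using this

/-! ### list model -/

def stC (f : List ℤ → ℕ) (P : Finset Cell) : List ℤ → List Cell → ℕ
  | [], _ => 0
  | c :: C, L =>
    (f ((L.filter (fun x => decide ((x.1, c) ∈ P ∧ x.2 ∈ c :: C))).map Prod.snd) -
      f ((L.filter (fun x => decide ((x.1, c) ∈ P ∧ x.2 ∈ C))).map Prod.snd)) + stC f P C L

def allW (P : Finset Cell) (C : List ℤ) : List ℤ → Finset (List ℤ)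
  | [] => {[]}
  | r :: T => ((C.toFinset.filter (fun d => (r, d) ∈ P)) ×ˢ allW P C T).image
      (fun p => p.1 :: p.2)

theorem mem_allW (P : Finset Cell) (C T w : List ℤ) :
    w ∈ allW P C T ↔ w.length = T.length ∧ ∀ x ∈ T.zip w, x ∈ P ∧ x.2 ∈ C := by
  induction T generalizing w with
  | nil => simp [allW]
  | cons r T ih =>
    rw [allW, Finset.mem_image]
    constructor
    · rintro ⟨⟨d, v⟩, h, rfl⟩
      simp only [Finset.mem_product, Finset.mem_filter, List.mem_toFinset, ih] at h
      obtain ⟨⟨h1, h2⟩, h3, h4⟩ := h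
      refine ⟨by simp [h3], ?_⟩
      intro x hx
      simp only [List.zip_cons_cons, List.mem_cons] at hx
      rcases hx with rfl | hx
      · exact ⟨h2, h1⟩
      · exact h4 x hx
    · rintro ⟨h1, h2⟩
      cases w with
      | nil => simp at h1
      | cons d v =>
        refine ⟨(d, v), ?_, rfl⟩
        simp only [Finset.mem_product, Finset.mem_filter, List.mem_toFinset, ih]
        have := h2 (r, d) (by simp)
        exact ⟨⟨this.2, this.1⟩, by simpa using h1, fun x hx => h2 x (by simp [hx])⟩

def Words (P : Finset Cell) (C : List ℤ) (s : ℤ → ℕ) (T : List ℤ) : Finset (List ℤ) :=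
  (allW P C T).filter (fun w => ∀ c ∈ C, w.count c = s c)

theorem mem_Words (P : Finset Cell) (C : List ℤ) (s : ℤ → ℕ) (T w : List ℤ) :
    w ∈ Words P C s T ↔ (w.length = T.length ∧ ∀ x ∈ T.zip w, x ∈ P ∧ x.2 ∈ C) ∧
      ∀ c ∈ C, w.count c = s c := by
  rw [Words, Finset.mem_filter, mem_allW]

theorem split3 {T1 T2 T3 w : List ℤ} (h : w.length = (T1 ++ T2 ++ T3).length) :
    ∃ a1 a2 a3, w = a1 ++ a2 ++ a3 ∧ a1.length = T1.length ∧ a2.length = T2.length ∧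
      a3.length = T3.length := by
  simp only [List.length_append] at h
  refine ⟨w.take T1.length, (w.drop T1.length).take T2.length,
    (w.drop T1.length).drop T2.length, ?_, ?_, ?_, ?_⟩
  · rw [List.append_assoc, List.take_append_drop, List.take_append_drop]
  all_goals simp
  all_goals omega

theorem zip3 {T1 T2 T3 a1 a2 a3 : List ℤ} (h1 : a1.length = T1.length)
    (h2 : a2.length = T2.length) :
    (T1 ++ T2 ++ T3).zip (a1 ++ a2 ++ a3) = T1.zip a1 ++ T2.zip a2 ++ T3.zip a3 := by
  rw [List.zip_append (by simp [h1, h2]), List.zip_append h1.symm]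

theorem mem_zip_right {T a : List ℤ} (h : a.length = T.length) {d : ℤ} (hd : d ∈ a) :
    ∃ r ∈ T, (r, d) ∈ T.zip a := by
  obtain ⟨i, hi, rfl⟩ := List.mem_iff_getElem.1 hd
  have hi' : i < T.length := h ▸ hi
  refine ⟨T[i], List.getElem_mem _, ?_⟩
  rw [List.mem_iff_getElem]
  exact ⟨i, by simp [hi, hi'], by simp⟩

theorem filter_zip_all {P : Finset Cell} {c : ℤ} {T a : List ℤ} (q : ℤ → Prop) [DecidablePred q]
    (h : a.length = T.length) (hT : ∀ r ∈ T, (r, c) ∈ P) :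
    ((T.zip a).filter (fun x => decide ((x.1, c) ∈ P ∧ q x.2))).map Prod.snd
      = a.filter (fun d => decide (q d)) := by
  induction T generalizing a with
  | nil => simp at h; subst h; simp
  | cons r T ih =>
    cases a with
    | nil => simp at h
    | cons d a =>
      have hr := hT r (by simp)
      have := ih (a := a) (by simpa using h) (fun r hr => hT r (by simp [hr]))
      rw [List.zip_cons_cons, List.filter_cons, List.filter_cons]
      by_cases hq : q d
      · simp only [hr, hq, and_self, decide_true, if_true, List.map_cons, this]
      · simp only [hq, and_false, decide_false, Bool.false_eq_true, if_false, this]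

theorem filter_zip_none {P : Finset Cell} {c : ℤ} {T a : List ℤ} (q : ℤ → Prop) [DecidablePred q]
    (hT : ∀ r ∈ T, (r, c) ∉ P) :
    (T.zip a).filter (fun x => decide ((x.1, c) ∈ P ∧ q x.2)) = [] := by
  rw [List.filter_eq_nil_iff]
  rintro ⟨r, d⟩ hx
  have := hT r (List.of_mem_zip hx).1
  simp [this]

theorem stC_shift (f : List ℤ → ℕ) (P : Finset Cell) (c : ℤ) (C : List ℤ) (L1 L3 : List Cell)
    (T2 T2' v u : List ℤ) (hv : v.length = T2.length) (hu : u.length = T2'.length)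
    (hvu : v.filter (fun x => decide (x ≠ c)) = u) (hc : c ∉ C)
    (h2 : ∀ r ∈ T2, ∀ d ∈ C, (r, d) ∈ P) (h2' : ∀ r ∈ T2', ∀ d ∈ C, (r, d) ∈ P) :
    stC f P C (L1 ++ T2.zip v ++ L3) = stC f P C (L1 ++ T2'.zip u ++ L3) := by
  have key : ∀ (d : ℤ) (D : List ℤ), (∀ r ∈ T2, (r, d) ∈ P) → (∀ r ∈ T2', (r, d) ∈ P) → c ∉ D →
      ((L1 ++ T2.zip v ++ L3).filter (fun x => decide ((x.1, d) ∈ P ∧ x.2 ∈ D))).map Prod.snd =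
      ((L1 ++ T2'.zip u ++ L3).filter (fun x => decide ((x.1, d) ∈ P ∧ x.2 ∈ D))).map Prod.snd := by
    intro d D h h' hD
    simp only [List.filter_append, List.map_append]
    rw [filter_zip_all (fun x => x ∈ D) hv h, filter_zip_all (fun x => x ∈ D) hu h', ← hvu,
      List.filter_filter]
    congr 2
    apply List.filter_congr
    intro x _
    by_cases hx : x ∈ D
    · have : x ≠ c := by rintro rfl; exact hD hx
      simp [hx, this]
    · simp [hx]
  induction C with
  | nil => rfl
  | cons d C ih =>
    rw [stC, stC, ih (fun h => hc (by simp [h])) (fun r hr e he => h2 r hr e (by simp [he]))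
      (fun r hr e he => h2' r hr e (by simp [he])),
      key d (d :: C) (fun r hr => h2 r hr d (by simp)) (fun r hr => h2' r hr d (by simp)) hc,
      key d C (fun r hr => h2 r hr d (by simp)) (fun r hr => h2' r hr d (by simp))
        (fun h => hc (by simp [h]))]

theorem decomp (p : ℤ → Prop) (hp : ∀ a b c, p a → p c → a ≤ b → b ≤ c → p b) (T : List ℤ)
    (hT : T.Pairwise (· < ·)) : ∃ T1 T2 T3, T = T1 ++ T2 ++ T3 ∧ (∀ r ∈ T1, ¬ p r) ∧
      (∀ r ∈ T2, p r) ∧ (∀ r ∈ T3, ¬ p r) := by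
  induction T with
  | nil => exact ⟨[], [], [], by simp⟩
  | cons x T ih =>
    rw [List.pairwise_cons] at hT
    obtain ⟨T1, T2, T3, rfl, h1, h2, h3⟩ := ih hT.2
    by_cases hx : p x
    · cases T2 with
      | nil =>
        refine ⟨[], [x], T1 ++ T3, by simp, by simp, by simpa using hx, ?_⟩
        intro r hr
        rcases List.mem_append.1 hr with h | h
        · exact h1 r h
        · exact h3 r h
      | cons y T2 =>
        have : T1 = [] := by
          rw [List.eq_nil_iff_forall_not_mem]
          intro z hz
          apply h1 z hz
          refine hp x z y hx (h2 y (by simp)) (hT.1 z (by simp [hz])).le ?_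
          have := hT.2
          rw [List.append_assoc, List.pairwise_append] at this
          exact (this.2.2 z hz y (by simp)).le
        subst this
        refine ⟨[], x :: y :: T2, T3, by simp, by simp, ?_, h3⟩
        intro r hr
        rcases List.mem_cons.1 hr with rfl | h
        · exact hx
        · exact h2 r h
    · refine ⟨x :: T1, T2, T3, by simp, ?_, h2, h3⟩
      intro r hr
      rcases List.mem_cons.1 hr with rfl | h
      · exact hx
      · exact h1 r h

/-- good ordering of columns -/
def ColOrd (P : Finset Cell) : List ℤ → Prop
  | [] => True
  | c :: C => ((∀ d ∈ C, c < d) ∨ (∀ d ∈ C, d < c)) ∧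
      (∀ d ∈ C, ∀ r, (r, c) ∈ P → (r, d) ∈ P) ∧ ColOrd P C

theorem filter_ne_self {c : ℤ} {a : List ℤ} (h : c ∉ a) :
    a.filter (fun x => decide (x ≠ c)) = a := by
  rw [List.filter_eq_self]
  intro x hx
  simp only [decide_eq_true_eq]
  rintro rfl; exact h hx

theorem count_filter_ne {c d : ℤ} (a : List ℤ) (h : d ≠ c) :
    (a.filter (fun x => decide (x ≠ c))).count d = a.count d := by
  rw [List.count_filter]; simpa using h

theorem length_filter_ne (c : ℤ) (a : List ℤ) :
    a.length = (a.filter (fun x => decide (x ≠ c))).length + a.count c := by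
  have := countP_filter_ne c (fun _ => true) a
  simpa using this

theorem fibre (P : Finset Cell) (c : ℤ) (C : List ℤ) (s : ℤ → ℕ) (T1 T2 T3 : List ℤ)
    (hc : c ∉ C) (h1 : ∀ r ∈ T1, (r, c) ∉ P) (h3 : ∀ r ∈ T3, (r, c) ∉ P) (w : List ℤ)
    (hw : w ∈ Words P (c :: C) s (T1 ++ T2 ++ T3)) :
    ∃ a1 a2 a3, w = a1 ++ a2 ++ a3 ∧ a1.length = T1.length ∧ a2.length = T2.length ∧
      a3.length = T3.length ∧ c ∉ a1 ∧ c ∉ a3 ∧ a2.count c = s c ∧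
      w.filter (fun x => decide (x ≠ c)) = a1 ++ a2.filter (fun x => decide (x ≠ c)) ++ a3 := by
  rw [mem_Words] at hw
  obtain ⟨⟨hl, hz⟩, hs⟩ := hw
  obtain ⟨a1, a2, a3, rfl, e1, e2, e3⟩ := split3 hl
  rw [zip3 e1 e2] at hz
  have n1 : c ∉ a1 := by
    intro h
    obtain ⟨r, hr, hh⟩ := mem_zip_right e1 h
    exact h1 r hr (hz _ (by simp [hh])).1
  have n3 : c ∉ a3 := by
    intro h
    obtain ⟨r, hr, hh⟩ := mem_zip_right e3 h
    exact h3 r hr (hz _ (by simp [hh])).1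
  refine ⟨a1, a2, a3, rfl, e1, e2, e3, n1, n3, ?_, ?_⟩
  · have := hs c (by simp)
    simpa [List.count_eq_zero.2 n1, List.count_eq_zero.2 n3] using this
  · rw [List.filter_append, List.filter_append, filter_ne_self n1, filter_ne_self n3]

theorem list_main (P : Finset Cell) (hP : ColConvex P) (s : ℤ → ℕ) (C : List ℤ)
    (hC : ColOrd P C) : ∀ T : List ℤ, T.Pairwise (· < ·) → ∃ Q : ℕ[X], ∀ f, Good f →
      ∑ w ∈ Words P C s T, X ^ stC f P C (T.zip w) = Q := by
  induction C with
  | nil => intro T _; exact ⟨∑ w ∈ Words P [] s T, X ^ 0, fun f _ => rfl⟩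
  | cons c C ih =>
    obtain ⟨hext, hsub, hC'⟩ := hC
    have hc : c ∉ C := by
      intro h; rcases hext with h' | h' <;> exact lt_irrefl _ (h' _ h)
    intro T hT
    obtain ⟨T1, T2, T3, rfl, h1, h2, h3⟩ := decomp (fun r => (r, c) ∈ P)
      (fun a b d ha hd hab hbd => hP c a d b ha hd hab hbd) T hT
    by_cases hm : T2.length < s c
    · refine ⟨0, fun f _ => Finset.sum_eq_zero (fun w hw => ?_)⟩
      exfalso
      obtain ⟨a1, a2, a3, -, -, e2, -, -, -, e, -⟩ := fibre P c C s T1 T2 T3 hc h1 h3 w hw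
      have := List.count_le_length (a := c) (l := a2)
      omega
    push Not at hm
    set m := s c with hmdef
    have h2C : ∀ r ∈ T2, ∀ d ∈ C, (r, d) ∈ P := fun r hr d hd => hsub d hd r (h2 r hr)
    have h2C' : ∀ r ∈ T2.drop m, ∀ d ∈ C, (r, d) ∈ P := fun r hr => h2C r (List.mem_of_mem_drop hr)
    have hsubl : (T1 ++ T2.drop m ++ T3).Sublist (T1 ++ T2 ++ T3) :=
      ((List.Sublist.refl _).append (List.drop_sublist m T2)).append (List.Sublist.refl _)
    obtain ⟨Q, hQ⟩ := ih hC' (T1 ++ T2.drop m ++ T3) (hT.sublist hsubl)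
    refine ⟨Q * gb (T2.length - m) m, fun f hf => ?_⟩
    have hmaps : ∀ w ∈ Words P (c :: C) s (T1 ++ T2 ++ T3),
        w.filter (fun x => decide (x ≠ c)) ∈ Words P C s (T1 ++ T2.drop m ++ T3) := by
      intro w hw
      obtain ⟨a1, a2, a3, rfl, e1, e2, e3, n1, n3, ec, ef⟩ := fibre P c C s T1 T2 T3 hc h1 h3 w hw
      rw [mem_Words] at hw ⊢
      obtain ⟨⟨hl, hz⟩, hs⟩ := hw
      have el := length_filter_ne c a2
      have el' : (a2.filter (fun x => decide (x ≠ c))).length = (T2.drop m).length := by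
        rw [List.length_drop]; omega
      refine ⟨⟨?_, ?_⟩, ?_⟩
      · rw [ef]; simp only [List.length_append, el', e1, e3]
      · rw [ef, zip3 e1 el']
        rw [zip3 e1 e2] at hz
        have hmem : ∀ x ∈ (a1 ++ a2 ++ a3), x ≠ c → x ∈ C := by
          intro x hx hxc
          obtain ⟨r, hr, hh⟩ := mem_zip_right hl hx
          rw [zip3 e1 e2] at hh
          have := (hz _ hh).2
          simpa [hxc] using this
        rintro ⟨r, d⟩ hx
        rw [List.mem_append, List.mem_append] at hx
        rcases hx with (hx | hx) | hx
        · have hd := (List.of_mem_zip hx).2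
          exact ⟨(hz _ (by simp [hx])).1, hmem d (by simp [hd]) (fun e => n1 (e ▸ hd))⟩
        · obtain ⟨hr, hd⟩ := List.of_mem_zip hx
          rw [List.mem_filter] at hd
          have hdC := hmem d (by simp [hd.1]) (by simpa using hd.2)
          exact ⟨h2C' r hr d hdC, hdC⟩
        · have hd := (List.of_mem_zip hx).2
          exact ⟨(hz _ (by simp [hx])).1, hmem d (by simp [hd]) (fun e => n3 (e ▸ hd))⟩
      · intro d hd
        rw [count_filter_ne _ (fun e : d = c => hc (by rw [← e]; exact hd))]
        exact hs d (by simp [hd])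
    rw [← Finset.sum_fiberwise_of_maps_to hmaps, ← hQ f hf, Finset.sum_mul]
    refine Finset.sum_congr rfl (fun w' hw' => ?_)
    rw [mem_Words] at hw'
    obtain ⟨⟨hl, hz⟩, hs⟩ := hw'
    obtain ⟨w1, u, w3, rfl, e1, e2, e3⟩ := split3 hl
    have hall : ∀ x ∈ w1 ++ u ++ w3, x ∈ C := by
      intro x hx
      obtain ⟨r, hr, hh⟩ := mem_zip_right hl hx
      exact (hz _ hh).2
    have c1 : c ∉ w1 := fun h => hc (hall c (by simp [h]))
    have cu : c ∉ u := fun h => hc (hall c (by simp [h]))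
    have c3 : c ∉ w3 := fun h => hc (hall c (by simp [h]))
    have hfib : (Words P (c :: C) s (T1 ++ T2 ++ T3)).filter
        (fun w => w.filter (fun x => decide (x ≠ c)) = w1 ++ u ++ w3) =
        (ins c m u).image (fun v => w1 ++ v ++ w3) := by
      ext w
      rw [Finset.mem_filter, Finset.mem_image]
      constructor
      · rintro ⟨hw, hf⟩
        obtain ⟨a1, a2, a3, rfl, i1, i2, i3, n1, n3, ec, ef⟩ :=
          fibre P c C s T1 T2 T3 hc h1 h3 w hw
        rw [ef, List.append_assoc, List.append_assoc] at hf
        obtain ⟨q1, q2⟩ := List.append_inj hf (by omega)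
        obtain ⟨q3, q4⟩ := List.append_inj' q2 (by omega)
        subst q1 q4
        exact ⟨a2, (mem_ins c m u cu a2).2 ⟨ec, q3⟩, rfl⟩
      · rintro ⟨v, hv, rfl⟩
        obtain ⟨k1, k2⟩ := (mem_ins c m u cu v).1 hv
        have lv : v.length = T2.length := by
          rw [length_ins cu hv, e2, List.length_drop]; omega
        have ff : (w1 ++ v ++ w3).filter (fun x => decide (x ≠ c)) = w1 ++ u ++ w3 := by
          rw [List.filter_append, List.filter_append, filter_ne_self c1, filter_ne_self c3, k2]
        refine ⟨?_, ff⟩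
        rw [mem_Words]
        refine ⟨⟨by simp only [List.length_append, e1, e3, lv], ?_⟩, ?_⟩
        · rw [zip3 e1 lv]
          rw [zip3 e1 e2] at hz
          rintro ⟨r, d⟩ hx
          rw [List.mem_append, List.mem_append] at hx
          rcases hx with (hx | hx) | hx
          · have := hz (r, d) (by simp [hx])
            exact ⟨this.1, by simp [this.2]⟩
          · obtain ⟨hr, hd⟩ := List.of_mem_zip hx
            rcases mem_of_ins cu hv hd with rfl | hd
            · exact ⟨h2 r hr, by simp⟩
            · have := hall d (by simp [hd])
              exact ⟨h2C r hr d this, by simp [this]⟩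
          · have := hz (r, d) (by simp [hx])
            exact ⟨this.1, by simp [this.2]⟩
        · intro d hd
          rw [List.mem_cons] at hd
          by_cases hdc : d = c
          · subst hdc
            simp [List.count_eq_zero.2 c1, List.count_eq_zero.2 c3, k1, hmdef]
          · rw [← count_filter_ne _ hdc, ff]
            exact hs d (by simpa [hdc] using hd)
    rw [hfib, Finset.sum_image (by intro a _ b _ h; simpa using h)]
    have hulen : u.length = T2.length - m := by rw [e2, List.length_drop]
    have hextu : (∀ d ∈ u, c < d) ∨ (∀ d ∈ u, d < c) := by
      rcases hext with h | h
      · exact Or.inl (fun d hd => h d (hall d (by simp [hd])))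
      · exact Or.inr (fun d hd => h d (hall d (by simp [hd])))
    rw [← hulen, ← hf.sum' c m u hextu, Finset.mul_sum]
    refine Finset.sum_congr rfl (fun v hv => ?_)
    obtain ⟨k1, k2⟩ := (mem_ins c m u cu v).1 hv
    have lv : v.length = T2.length := by
      rw [length_ins cu hv, e2, List.length_drop]; omega
    rw [← pow_add, add_comm]
    congr 1
    rw [stC, zip3 e1 lv, zip3 e1 e2, stC_shift f P c C _ _ T2 (T2.drop m) v u lv e2 k2 hc h2C h2C']
    congr 2
    · congr 1
      simp only [List.filter_append, List.map_append]
      rw [filter_zip_all (fun x => x ∈ c :: C) lv h2, filter_zip_none (fun x => x ∈ c :: C) h1,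
        filter_zip_none (fun x => x ∈ c :: C) h3]
      simp only [List.map_nil, List.nil_append, List.append_nil]
      rw [List.filter_eq_self]
      intro d hd
      simp only [decide_eq_true_eq]
      rcases mem_of_ins cu hv hd with rfl | hd
      · simp
      · simp [hall d (by simp [hd])]
    · congr 1
      simp only [List.filter_append, List.map_append]
      rw [filter_zip_all (fun x => x ∈ C) lv h2, filter_zip_none (fun x => x ∈ C) h1,
        filter_zip_none (fun x => x ∈ C) h3]
      simp only [List.map_nil, List.nil_append, List.append_nil]
      rw [← k2]
      apply List.filter_congr
      intro d hd
      rw [decide_eq_decide]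
      constructor
      · rintro h rfl; exact hc h
      · intro h
        rcases mem_of_ins cu hv hd with h' | h'
        · exact absurd h' h
        · exact hall d (by simp [h'])

/-! ### link with the finset statistics -/

theorem desR_cons (x y : Cell) (L : List Cell)
    (h : (x :: y :: L).Pairwise (fun a b => a.1 < b.1)) :
    desR (x :: y :: L).toFinset = (if y.2 < x.2 then 1 else 0) + desR (y :: L).toFinset := by
  classical
  rw [List.pairwise_cons] at h
  obtain ⟨hx, hy⟩ := h
  rw [List.pairwise_cons] at hy
  have hxy := hx y (by simp)
  unfold desR
  have : (if y.2 < x.2 then 1 else 0) =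
      (if y.2 < x.2 then ({(x, y)} : Finset (Cell × Cell)) else ∅).card := by
    split_ifs <;> simp
  rw [this, ← Finset.card_union_of_disjoint]
  · congr 1
    ext ⟨a, b⟩
    simp only [Finset.mem_filter, Finset.mem_product, Finset.mem_union, List.mem_toFinset]
    constructor
    · rintro ⟨⟨ha, hb⟩, h1, h2, h3⟩
      have hb' : b ∈ y :: L := by
        rcases List.mem_cons.1 hb with rfl | h
        · exfalso
          rcases List.mem_cons.1 ha with rfl | h'
          · exact lt_irrefl _ h1
          · exact lt_asymm h1 (hx a h')
        · exact h
      rcases List.mem_cons.1 ha with rfl | ha'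
      · left
        have : b = y := by
          rcases List.mem_cons.1 hb' with h | h
          · exact h
          · exact absurd ⟨hxy, hy.1 b h⟩ (h3 y (by simp))
        subst this
        rw [if_pos h2]; simp
      · right
        exact ⟨⟨ha', hb'⟩, h1, h2, fun z hz => h3 z (List.mem_cons_of_mem _ hz)⟩
    · rintro (h | ⟨⟨ha, hb⟩, h1, h2, h3⟩)
      · split_ifs at h with hh
        · rw [Finset.mem_singleton] at h
          injection h with e1 e2
          subst e1 e2
          refine ⟨⟨by simp, by simp⟩, hxy, hh, ?_⟩
          rintro z hz ⟨z1, z2⟩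
          rcases List.mem_cons.1 hz with rfl | hz
          · exact lt_irrefl _ z1
          rcases List.mem_cons.1 hz with rfl | hz
          · exact lt_irrefl _ z2
          · exact lt_asymm z2 (hy.1 z hz)
        · simp at h
      · refine ⟨⟨List.mem_cons_of_mem _ ha, List.mem_cons_of_mem _ hb⟩, h1, h2, ?_⟩
        intro z hz
        rcases List.mem_cons.1 hz with rfl | hz
        · rintro ⟨z1, z2⟩
          exact lt_asymm z1 (hx a ha)
        · exact h3 z hz
  · rw [Finset.disjoint_left]
    rintro p hp hq
    split_ifs at hp
    · rw [Finset.mem_singleton] at hp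
      subst hp
      simp only [Finset.mem_filter, Finset.mem_product, List.mem_toFinset] at hq
      exact lt_irrefl _ (hx x hq.1.1)
    · simp at hp

theorem rows_nodup {L : List Cell} (h : L.Pairwise (fun a b => a.1 < b.1)) : L.Nodup :=
  h.imp (by rintro a b hab rfl; exact lt_irrefl _ hab)

theorem majR_list (L : List Cell) (h : L.Pairwise (fun a b => a.1 < b.1)) :
    majR L.toFinset = comaj (L.map Prod.snd) := by
  induction L with
  | nil => simp [majR, comaj]
  | cons x L ih =>
    have hnd := rows_nodup h
    have h' := h
    rw [List.pairwise_cons] at h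
    obtain ⟨hx, hL⟩ := h
    have ihL := ih hL
    have hxL : x ∉ L.toFinset := by
      rw [List.mem_toFinset]; exact (List.nodup_cons.1 hnd).1
    have e0 : desR ((x :: L).toFinset.filter (fun z => z.1 ≤ x.1)) = 0 := by
      unfold desR
      rw [Finset.card_eq_zero, Finset.filter_eq_empty_iff]
      rintro ⟨a, b⟩ hab ⟨h1, _⟩
      simp only [Finset.mem_product, Finset.mem_filter, List.mem_toFinset] at hab
      obtain ⟨⟨ha, ha'⟩, hb, hb'⟩ := hab
      simp only at h1
      rcases List.mem_cons.1 ha with rfl | ha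
      · omega
      · have := hx a ha; omega
    unfold majR at ihL ⊢
    rw [List.toFinset_cons, Finset.sum_insert hxL, ← List.toFinset_cons, e0, zero_add]
    cases L with
    | nil => simp [comaj]
    | cons y L =>
      have key : ∀ z ∈ (y :: L).toFinset, desR ((x :: y :: L).toFinset.filter (fun t => t.1 ≤ z.1))
          = (if y.2 < x.2 then 1 else 0) + desR ((y :: L).toFinset.filter (fun t => t.1 ≤ z.1)) := by
        intro z hz
        rw [List.mem_toFinset] at hz
        have hxz : x.1 ≤ z.1 := (hx z hz).le
        have hyz : y.1 ≤ z.1 := by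
          rcases List.mem_cons.1 hz with rfl | hz
          · exact le_rfl
          · exact ((List.pairwise_cons.1 hL).1 z hz).le
        have e1 : (x :: y :: L).toFinset.filter (fun t => t.1 ≤ z.1)
            = (x :: y :: L.filter (fun t => decide (t.1 ≤ z.1))).toFinset := by
          ext t
          simp only [Finset.mem_filter, List.mem_toFinset, List.mem_cons, List.mem_filter,
            decide_eq_true_eq]
          grind
        have e2 : (y :: L).toFinset.filter (fun t => t.1 ≤ z.1)
            = (y :: L.filter (fun t => decide (t.1 ≤ z.1))).toFinset := by
          ext t
          simp only [Finset.mem_filter, List.mem_toFinset, List.mem_cons, List.mem_filter,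
            decide_eq_true_eq]
          grind
        rw [e1, e2, desR_cons]
        exact h'.sublist ((List.filter_sublist.cons_cons y).cons_cons x)
      rw [Finset.sum_congr rfl key, Finset.sum_add_distrib, ihL]
      simp only [List.map_cons, Finset.sum_const, smul_eq_mul]
      rw [List.toFinset_card_of_nodup (List.nodup_cons.1 hnd).2, comaj]
      simp

noncomputable def neR (M : Finset Cell) : ℕ :=
  ((M ×ˢ M).filter fun p => p.2.1 < p.1.1 ∧ p.1.2 < p.2.2).card

theorem neR_list (L : List Cell) (h : L.Pairwise (fun a b => a.1 < b.1)) :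
    neR L.toFinset = linv (L.map Prod.snd) := by
  induction L with
  | nil => simp [neR, linv]
  | cons x L ih =>
    have hnd := rows_nodup h
    rw [List.pairwise_cons] at h
    obtain ⟨hx, hL⟩ := h
    rw [List.map_cons, linv, ← ih hL, List.countP_map, List.countP_eq_length_filter,
      ← List.toFinset_card_of_nodup ((List.nodup_cons.1 hnd).2.filter _)]
    unfold neR
    rw [← Finset.card_image_of_injective (f := fun y : Cell => (y, x)) _
      (by intro a b h; exact congrArg Prod.fst h), ← Finset.card_union_of_disjoint]
    · congr 1
      ext ⟨a, b⟩
      simp only [Finset.mem_filter, Finset.mem_product, Finset.mem_union, List.mem_toFinset,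
        Finset.mem_image, List.mem_filter, Function.comp, decide_eq_true_eq, Prod.mk.injEq]
      constructor
      · rintro ⟨⟨ha, hb⟩, h1, h2⟩
        have ha' : a ∈ L := by
          rcases List.mem_cons.1 ha with rfl | h
          · exfalso
            rcases List.mem_cons.1 hb with rfl | h'
            · exact lt_irrefl _ h1
            · exact lt_asymm h1 (hx b h')
          · exact h
        rcases List.mem_cons.1 hb with rfl | hb'
        · left; exact ⟨a, ⟨ha', h2⟩, rfl, rfl⟩
        · right; exact ⟨⟨ha', hb'⟩, h1, h2⟩
      · rintro (⟨z, ⟨hz, hz'⟩, rfl, rfl⟩ | ⟨⟨ha, hb⟩, h1, h2⟩)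
        · exact ⟨⟨by simp [hz], by simp⟩, hx z hz, hz'⟩
        · exact ⟨⟨by simp [ha], by simp [hb]⟩, h1, h2⟩
    · rw [Finset.disjoint_left]
      rintro p hp hq
      simp only [Finset.mem_image] at hp
      obtain ⟨z, _, rfl⟩ := hp
      simp only [Finset.mem_filter, Finset.mem_product, List.mem_toFinset] at hq
      exact lt_irrefl _ (hx x hq.1.2)

theorem exists_colOrd (P : Finset Cell) (hP : IsMoon P) (S : Finset ℤ) :
    ∃ C, ColOrd P C ∧ ∀ c, c ∈ C ↔ c ∈ S := by
  induction S using Finset.strongInduction with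
  | H S ih =>
    rcases S.eq_empty_or_nonempty with rfl | hS
    · exact ⟨[], trivial, by simp⟩
    · have ha := S.min'_mem hS
      have hb := S.max'_mem hS
      rcases hP.2.2 (S.min' hS) (S.max' hS) with h | h
      · obtain ⟨C, hC, hm⟩ := ih (S.erase (S.min' hS)) (Finset.erase_ssubset ha)
        refine ⟨S.min' hS :: C, ⟨Or.inl ?_, ?_, hC⟩, ?_⟩
        · intro d hd
          rw [hm, Finset.mem_erase] at hd
          exact lt_of_le_of_ne (S.min'_le d hd.2) hd.1.symm
        · intro d hd r hr
          rw [hm, Finset.mem_erase] at hd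
          exact hP.1 r _ _ d hr (h r hr) (S.min'_le d hd.2) (S.le_max' d hd.2)
        · intro c
          rw [List.mem_cons, hm, Finset.mem_erase]
          by_cases hc : c = S.min' hS
          · simp [hc, ha]
          · simp [hc]
      · obtain ⟨C, hC, hm⟩ := ih (S.erase (S.max' hS)) (Finset.erase_ssubset hb)
        refine ⟨S.max' hS :: C, ⟨Or.inr ?_, ?_, hC⟩, ?_⟩
        · intro d hd
          rw [hm, Finset.mem_erase] at hd
          exact lt_of_le_of_ne (S.le_max' d hd.2) hd.1
        · intro d hd r hr
          rw [hm, Finset.mem_erase] at hd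
          exact hP.1 r _ _ d (h r hr) hr (S.min'_le d hd.2) (S.le_max' d hd.2)
        · intro c
          rw [List.mem_cons, hm, Finset.mem_erase]
          by_cases hc : c = S.max' hS
          · simp [hc, hb]
          · simp [hc]

theorem neP_list (P : Finset Cell) (hP : IsMoon P) (C : List ℤ) (hC : ColOrd P C)
    (L : List Cell) (h : L.Pairwise (fun a b => a.1 < b.1)) (hLP : ∀ x ∈ L, x ∈ P) :
    neP P (L.toFinset.filter (fun x => x.2 ∈ C)) = stC linv P C L := by
  classical
  induction C with
  | nil => simp [neP, stC]
  | cons c C ih =>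
    obtain ⟨hext, hsub, hC'⟩ := hC
    have hstat : ∀ D : List ℤ,
        linv ((L.filter (fun x => decide ((x.1, c) ∈ P ∧ x.2 ∈ D))).map Prod.snd)
        = neR (L.toFinset.filter (fun x => (x.1, c) ∈ P ∧ x.2 ∈ D)) := by
      intro D
      rw [← neR_list _ (h.sublist List.filter_sublist), List.toFinset_filter]
      simp
    have hle := good_linv.mono
      ((L.filter (fun x => decide ((x.1, c) ∈ P ∧ x.2 ∈ C))).map Prod.snd)
      ((L.filter (fun x => decide ((x.1, c) ∈ P ∧ x.2 ∈ c :: C))).map Prod.snd)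
      ((List.monotone_filter_right _ (by
        intro x hx
        simp only [decide_eq_true_eq] at hx ⊢
        exact ⟨hx.1, List.mem_cons_of_mem _ hx.2⟩)).map _)
    rw [stC]
    rw [hstat, hstat] at hle ⊢
    rw [← ih hC']
    suffices hs : neP P (L.toFinset.filter (fun x => x.2 ∈ c :: C)) +
        neR (L.toFinset.filter (fun x => (x.1, c) ∈ P ∧ x.2 ∈ C)) =
        neP P (L.toFinset.filter (fun x => x.2 ∈ C)) +
        neR (L.toFinset.filter (fun x => (x.1, c) ∈ P ∧ x.2 ∈ c :: C)) by omega
    unfold neP neR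
    rw [eq_comm, ← Finset.card_union_add_card_inter, eq_comm]
    have hcell : ∀ d ∈ c :: C, ∀ r, (r, c) ∈ P → (r, d) ∈ P := by
      intro d hd r hr
      rcases List.mem_cons.1 hd with rfl | hd
      · exact hr
      · exact hsub d hd r hr
    congr 2
    · ext ⟨a, b⟩
      simp only [Finset.mem_filter, Finset.mem_product, Finset.mem_union, List.mem_toFinset]
      constructor
      · rintro ⟨⟨⟨ha, ha'⟩, hb, hb'⟩, h1, h2, h3⟩
        by_cases hac : a.2 ∈ C
        · by_cases hbc : b.2 ∈ C
          · left; exact ⟨⟨⟨ha, hac⟩, hb, hbc⟩, h1, h2, h3⟩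
          · right
            have : b.2 = c := by simpa [hbc] using hb'
            refine ⟨⟨⟨ha, ?_, ha'⟩, hb, ?_, hb'⟩, h1, h2⟩
            · rw [← this]; exact h3 _ _ (by omega) (by omega) (by omega) (by omega)
            · rw [← this]; exact h3 _ _ (by omega) (by omega) (by omega) (by omega)
        · right
          have : a.2 = c := by simpa [hac] using ha'
          refine ⟨⟨⟨ha, ?_, ha'⟩, hb, ?_, hb'⟩, h1, h2⟩
          · rw [← this]; exact h3 _ _ (by omega) (by omega) (by omega) (by omega)
          · rw [← this]; exact h3 _ _ (by omega) (by omega) (by omega) (by omega)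
      · rintro (⟨⟨⟨ha, hac⟩, hb, hbc⟩, h1, h2, h3⟩ | ⟨⟨⟨ha, hac, ha'⟩, hb, hbc, hb'⟩, h1, h2⟩)
        · exact ⟨⟨⟨ha, List.mem_cons_of_mem _ hac⟩, hb, List.mem_cons_of_mem _ hbc⟩, h1, h2, h3⟩
        · refine ⟨⟨⟨ha, ha'⟩, hb, hb'⟩, h1, h2, ?_⟩
          intro r d r1 r2 d1 d2
          have hr := hP.2.1 c _ _ r hbc hac r1 r2
          exact hP.1 r _ _ d (hcell _ ha' r hr) (hcell _ hb' r hr) d1 d2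
    · ext ⟨a, b⟩
      simp only [Finset.mem_filter, Finset.mem_product, Finset.mem_inter, List.mem_toFinset]
      constructor
      · rintro ⟨⟨⟨ha, hac, ha'⟩, hb, hbc, hb'⟩, h1, h2⟩
        refine ⟨⟨⟨⟨ha, ha'⟩, hb, hb'⟩, h1, h2, ?_⟩, ⟨⟨ha, hac, List.mem_cons_of_mem _ ha'⟩, hb, hbc, List.mem_cons_of_mem _ hb'⟩, h1, h2⟩
        intro r d r1 r2 d1 d2
        have hr := hP.2.1 c _ _ r hbc hac r1 r2
        exact hP.1 r _ _ d (hsub _ ha' r hr) (hsub _ hb' r hr) d1 d2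
      · rintro ⟨⟨⟨⟨ha, ha'⟩, hb, hb'⟩, h1, h2, h3⟩, ⟨⟨_, hac, _⟩, _, hbc, _⟩, _⟩
        exact ⟨⟨⟨ha, hac, ha'⟩, hb, hbc, hb'⟩, h1, h2⟩

/-! ### maximal rectangles -/

theorem len_le (P : Finset Cell) (hP : IntersectionFree P) (c d : ℤ) :
    colLen P c ≤ colLen P d ↔ ∀ r, (r, c) ∈ P → (r, d) ∈ P := by
  have key : ∀ a b : ℤ, (∀ r, (r, a) ∈ P → (r, b) ∈ P) →
      (P.filter (fun x => x.2 = a)).image (fun x => (x.1, b)) ⊆ P.filter (fun x => x.2 = b) ∧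
      ((P.filter (fun x => x.2 = a)).image (fun x : Cell => ((x.1, b) : Cell))).card =
        colLen P a := by
    intro a b h
    constructor
    · intro y hy
      simp only [Finset.mem_image, Finset.mem_filter] at hy ⊢
      obtain ⟨⟨r, e⟩, ⟨h1, h2⟩, rfl⟩ := hy
      simp only at h2
      subst h2
      exact ⟨h r h1, rfl⟩
    · rw [Finset.card_image_of_injOn]
      · rfl
      · rintro ⟨r, e⟩ hx ⟨r', e'⟩ hy hxy
        simp only [Finset.coe_filter, Set.mem_ofPred_eq] at hx hy
        simp only [Prod.mk.injEq] at hxy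
        rw [Prod.mk.injEq]
        exact ⟨hxy.1, hx.2.trans hy.2.symm⟩
  constructor
  · intro h
    rcases hP c d with h1 | h1
    · exact h1
    · intro r hr
      obtain ⟨k1, k2⟩ := key d c h1
      have := Finset.eq_of_subset_of_card_le k1 (by rw [k2]; exact h)
      have hm : (r, c) ∈ P.filter (fun x => x.2 = c) := by simp [hr]
      rw [← this] at hm
      simp only [Finset.mem_image, Finset.mem_filter, Prod.mk.injEq] at hm
      obtain ⟨⟨r', e⟩, ⟨h4, h2⟩, h3, _⟩ := hm
      simp only at h2 h3
      subst h2 h3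
      exact h4
  · intro h
    obtain ⟨k1, k2⟩ := key c d h
    rw [← k2]
    exact Finset.card_le_card k1

theorem eq_Icc_of_conn (S : Finset ℤ) (hS : S.Nonempty)
    (h : ∀ a b c, a ∈ S → b ∈ S → a ≤ c → c ≤ b → c ∈ S) :
    ∃ a b, a ≤ b ∧ S = Finset.Icc a b := by
  refine ⟨S.min' hS, S.max' hS, S.min'_le _ (S.max'_mem hS), ?_⟩
  ext x
  rw [Finset.mem_Icc]
  exact ⟨fun hx => ⟨S.min'_le x hx, S.le_max' x hx⟩,
    fun hx => h _ _ x (S.min'_mem hS) (S.max'_mem hS) hx.1 hx.2⟩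

def Rc (P : Finset Cell) (c : ℤ) : Finset Cell :=
  P.filter (fun x => (x.1, c) ∈ P ∧ colLen P c ≤ colLen P x.2)

theorem mem_Rc {P : Finset Cell} (hP : IsMoon P) {c : ℤ} {x : Cell} :
    x ∈ Rc P c ↔ (x.1, c) ∈ P ∧ colLen P c ≤ colLen P x.2 := by
  rw [Rc, Finset.mem_filter]
  refine ⟨fun h => h.2, fun h => ⟨?_, h⟩⟩
  exact (len_le P hP.2.2 _ _).1 h.2 _ h.1

theorem mem_colSet {P : Finset Cell} {c : ℤ} : c ∈ colSet P ↔ ∃ r, (r, c) ∈ P := by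
  simp [colSet]

theorem Rc_isRect {P : Finset Cell} (hP : IsMoon P) {c : ℤ} (hc : c ∈ colSet P) :
    IsRect (Rc P c) := by
  obtain ⟨r0, hr0⟩ := mem_colSet.1 hc
  obtain ⟨r1, r2, hr, hI⟩ := eq_Icc_of_conn ((rowSet P).filter (fun r => (r, c) ∈ P))
    ⟨r0, by simp only [rowSet, Finset.mem_filter, Finset.mem_image]; exact ⟨⟨_, hr0, rfl⟩, hr0⟩⟩ (by
      intro a b d ha hb h1 h2
      rw [Finset.mem_filter] at ha hb ⊢
      have := hP.2.1 c a b d ha.2 hb.2 h1 h2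
      exact ⟨Finset.mem_image.2 ⟨_, this, rfl⟩, this⟩)
  obtain ⟨c1, c2, hc', hJ⟩ := eq_Icc_of_conn ((colSet P).filter (fun d => colLen P c ≤ colLen P d))
    ⟨c, by rw [Finset.mem_filter]; exact ⟨hc, le_rfl⟩⟩ (by
      intro a b d ha hb h1 h2
      rw [Finset.mem_filter, len_le P hP.2.2] at ha hb ⊢
      have : ∀ r, (r, c) ∈ P → (r, d) ∈ P := fun r hr =>
        hP.1 r a b d (ha.2 r hr) (hb.2 r hr) h1 h2
      exact ⟨mem_colSet.2 ⟨r0, this r0 hr0⟩, this⟩)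
  refine ⟨r1, r2, c1, c2, hr, hc', ?_⟩
  rw [← hI, ← hJ]
  ext ⟨r, d⟩
  rw [mem_Rc hP, Finset.mem_product, Finset.mem_filter, Finset.mem_filter]
  simp only
  constructor
  · rintro ⟨h1, h2⟩
    exact ⟨⟨Finset.mem_image.2 ⟨_, h1, rfl⟩, h1⟩,
      mem_colSet.2 ⟨r, (len_le P hP.2.2 _ _).1 h2 _ h1⟩, h2⟩
  · rintro ⟨⟨_, h1⟩, _, h2⟩
    exact ⟨h1, h2⟩

theorem Rc_max {P : Finset Cell} (hP : IsMoon P) {c : ℤ} (hc : c ∈ colSet P) :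
    Rc P c ∈ maxRects P := by
  classical
  obtain ⟨r0, hr0⟩ := mem_colSet.1 hc
  have hsub : Rc P c ⊆ P := Finset.filter_subset _ _
  rw [maxRects, Finset.mem_filter, Finset.mem_powerset]
  refine ⟨hsub, Rc_isRect hP hc, hsub, ?_⟩
  rintro R' ⟨r1, r2, c1, c2, _, _, rfl⟩ hR' hle
  refine Finset.Subset.antisymm ?_ hle
  rintro ⟨r, d⟩ hx
  have hcol : ∀ r', (r', c) ∈ P → (r', c) ∈ Finset.Icc r1 r2 ×ˢ Finset.Icc c1 c2 := fun r' hr' =>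
    hle ((mem_Rc hP).2 ⟨hr', le_rfl⟩)
  rw [mem_Rc hP, len_le P hP.2.2]
  rw [Finset.mem_product] at hx
  refine ⟨hR' ?_, ?_⟩
  · have := hcol _ hr0
    rw [Finset.mem_product] at this ⊢
    exact ⟨hx.1, this.2⟩
  · intro r' hr'
    apply hR'
    have := hcol _ hr'
    rw [Finset.mem_product] at this ⊢
    exact ⟨this.1, hx.2⟩

theorem max_Rc {P : Finset Cell} (hP : IsMoon P) {R : Finset Cell} (hR : R ∈ maxRects P) :
    ∃ c ∈ colSet P, R = Rc P c := by
  classical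
  rw [maxRects, Finset.mem_filter] at hR
  obtain ⟨_, ⟨r1, r2, c1, c2, hr, hc, rfl⟩, hsub, hmax⟩ := hR
  obtain ⟨c, hcm, hmin⟩ := Finset.exists_min_image (Finset.Icc c1 c2) (colLen P)
    ⟨c1, Finset.mem_Icc.2 ⟨le_rfl, hc⟩⟩
  have hcP : c ∈ colSet P := mem_colSet.2 ⟨r1, hsub (Finset.mem_product.2
    ⟨Finset.mem_Icc.2 ⟨le_rfl, hr⟩, hcm⟩)⟩
  refine ⟨c, hcP, (hmax _ (Rc_isRect hP hcP) (Finset.filter_subset _ _) ?_).symm⟩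
  rintro ⟨r, d⟩ hx
  rw [Finset.mem_product] at hx
  rw [mem_Rc hP]
  exact ⟨hsub (Finset.mem_product.2 ⟨hx.1, hcm⟩), hmin d hx.2⟩

theorem nRows_Rc {P : Finset Cell} (hP : IsMoon P) (c : ℤ) : nRows (Rc P c) = colLen P c := by
  have : (Rc P c).image Prod.fst = (P.filter (fun x => x.2 = c)).image Prod.fst := by
    ext r
    simp only [Finset.mem_image, Finset.mem_filter]
    constructor
    · rintro ⟨x, hx, rfl⟩
      exact ⟨(x.1, c), ⟨((mem_Rc hP).1 hx).1, rfl⟩, rfl⟩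
    · rintro ⟨⟨r, d⟩, ⟨h1, h2⟩, rfl⟩
      simp only at h2
      subst h2
      exact ⟨(r, d), (mem_Rc hP).2 ⟨h1, le_rfl⟩, rfl⟩
  rw [nRows, this, Finset.card_image_of_injOn]
  · rfl
  · rintro ⟨r, e⟩ hx ⟨r', e'⟩ hy hxy
    simp only [Finset.coe_filter, Set.mem_ofPred_eq] at hx hy
    simp only at hxy
    rw [Prod.mk.injEq]
    exact ⟨hxy, hx.2.trans hy.2.symm⟩

theorem row_iff {P : Finset Cell} (hP : IsMoon P) {c d : ℤ} (h : colLen P c = colLen P d) (r : ℤ) :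
    (r, c) ∈ P ↔ (r, d) ∈ P :=
  ⟨(len_le P hP.2.2 c d).1 h.le r, (len_le P hP.2.2 d c).1 h.ge r⟩

theorem Rc_eq {P : Finset Cell} (hP : IsMoon P) {c d : ℤ} (h : colLen P c = colLen P d) :
    Rc P c = Rc P d := by
  ext x
  rw [mem_Rc hP, mem_Rc hP, row_iff hP h, h]

theorem nRows_inj {P : Finset Cell} (hP : IsMoon P) {R R' : Finset Cell} (hR : R ∈ maxRects P)
    (hR' : R' ∈ maxRects P) (h : nRows R = nRows R') : R = R' := by
  obtain ⟨c, _, rfl⟩ := max_Rc hP hR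
  obtain ⟨d, _, rfl⟩ := max_Rc hP hR'
  rw [nRows_Rc hP, nRows_Rc hP] at h
  exact Rc_eq hP h

noncomputable def gM (P M : Finset Cell) (c : ℤ) (D : List ℤ) : ℕ :=
  majR (M.filter (fun x => (x.1, c) ∈ P ∧ x.2 ∈ D))

noncomputable def partC (P M : Finset Cell) (n : ℕ) : List ℤ → ℕ
  | [] => 0
  | c :: C => (if colLen P c = n then gM P M c (c :: C) - gM P M c C else 0) + partC P M n C

theorem gM_list (P : Finset Cell) (L : List Cell) (h : L.Pairwise (fun a b => a.1 < b.1))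
    (c : ℤ) (D : List ℤ) : gM P L.toFinset c D =
      comaj ((L.filter (fun x => decide ((x.1, c) ∈ P ∧ x.2 ∈ D))).map Prod.snd) := by
  rw [← majR_list _ (h.sublist List.filter_sublist), List.toFinset_filter, gM]
  simp

theorem gM_mono (P : Finset Cell) (L : List Cell) (h : L.Pairwise (fun a b => a.1 < b.1))
    (c : ℤ) (C : List ℤ) : gM P L.toFinset c C ≤ gM P L.toFinset c (c :: C) := by
  rw [gM_list _ _ h, gM_list _ _ h]
  exact good_comaj.mono _ _
      ((List.monotone_filter_right _ (by
        intro x hx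
        simp only [decide_eq_true_eq] at hx ⊢
        exact ⟨hx.1, List.mem_cons_of_mem _ hx.2⟩)).map _)

theorem partC_tele (P : Finset Cell) (hP : IsMoon P) (L : List Cell)
    (h : L.Pairwise (fun a b => a.1 < b.1)) (c0 : ℤ) (C : List ℤ) (hC : ColOrd P C) :
    partC P L.toFinset (colLen P c0) C +
      majR (L.toFinset.filter (fun x => (x.1, c0) ∈ P ∧ x.2 ∈ C ∧ colLen P c0 < colLen P x.2)) =
      majR (L.toFinset.filter (fun x => (x.1, c0) ∈ P ∧ x.2 ∈ C ∧ colLen P c0 ≤ colLen P x.2)) := by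
  induction C with
  | nil => simp [partC]
  | cons c C ih =>
    obtain ⟨_, hsub, hC'⟩ := hC
    have ih := ih hC'
    have hlen : ∀ d ∈ C, colLen P c ≤ colLen P d := fun d hd =>
      (len_le P hP.2.2 c d).2 (hsub d hd)
    have hmono := gM_mono P L h c C
    rw [partC]
    rcases lt_trichotomy (colLen P c) (colLen P c0) with hlt | heq | hgt
    · rw [if_neg hlt.ne, zero_add]
      have e1 : L.toFinset.filter
            (fun x => (x.1, c0) ∈ P ∧ x.2 ∈ c :: C ∧ colLen P c0 < colLen P x.2) =
          L.toFinset.filter (fun x => (x.1, c0) ∈ P ∧ x.2 ∈ C ∧ colLen P c0 < colLen P x.2) := by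
        ext x
        simp only [Finset.mem_filter, List.mem_cons]
        grind
      have e2 : L.toFinset.filter
            (fun x => (x.1, c0) ∈ P ∧ x.2 ∈ c :: C ∧ colLen P c0 ≤ colLen P x.2) =
          L.toFinset.filter (fun x => (x.1, c0) ∈ P ∧ x.2 ∈ C ∧ colLen P c0 ≤ colLen P x.2) := by
        ext x
        simp only [Finset.mem_filter, List.mem_cons]
        grind
      rw [e1, e2]
      exact ih
    · rw [if_pos heq]
      have e1 : L.toFinset.filter
            (fun x => (x.1, c0) ∈ P ∧ x.2 ∈ c :: C ∧ colLen P c0 < colLen P x.2) =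
          L.toFinset.filter (fun x => (x.1, c0) ∈ P ∧ x.2 ∈ C ∧ colLen P c0 < colLen P x.2) := by
        ext x
        simp only [Finset.mem_filter, List.mem_cons]
        grind
      have e2 : majR (L.toFinset.filter
            (fun x => (x.1, c0) ∈ P ∧ x.2 ∈ c :: C ∧ colLen P c0 ≤ colLen P x.2)) =
          gM P L.toFinset c (c :: C) := by
        rw [gM]
        congr 1
        ext x
        simp only [Finset.mem_filter, List.mem_cons, row_iff hP heq]
        grind
      have e3 : majR (L.toFinset.filter
            (fun x => (x.1, c0) ∈ P ∧ x.2 ∈ C ∧ colLen P c0 ≤ colLen P x.2)) =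
          gM P L.toFinset c C := by
        rw [gM]
        congr 1
        ext x
        simp only [Finset.mem_filter, row_iff hP heq]
        grind
      rw [e1, e2]
      rw [e3] at ih
      omega
    · rw [if_neg hgt.ne', zero_add]
      have e1 : ∀ D : List ℤ, (∀ d ∈ D, colLen P c ≤ colLen P d) → L.toFinset.filter
            (fun x => (x.1, c0) ∈ P ∧ x.2 ∈ D ∧ colLen P c0 < colLen P x.2) =
          L.toFinset.filter (fun x => (x.1, c0) ∈ P ∧ x.2 ∈ D ∧ colLen P c0 ≤ colLen P x.2) := by
        intro D hD
        ext x
        simp only [Finset.mem_filter]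
        grind
      rw [e1 C hlen] at ih
      rw [e1 (c :: C) (by
        intro d hd
        rcases List.mem_cons.1 hd with rfl | hd
        · exact le_rfl
        · exact hlen d hd)]
      omega

theorem sum_partC (P : Finset Cell) (hP : IsMoon P) (L : List Cell)
    (h : L.Pairwise (fun a b => a.1 < b.1)) (C : List ℤ) (hC : ∀ c ∈ C, c ∈ colSet P) :
    ∑ R ∈ maxRects P, partC P L.toFinset (nRows R) C = stC comaj P C L := by
  induction C with
  | nil => simp [partC, stC]
  | cons c C ih =>
    simp only [partC]
    rw [Finset.sum_add_distrib, ih (fun d hd => hC d (List.mem_cons_of_mem _ hd)), stC,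
      Finset.sum_eq_single (Rc P c), if_pos (nRows_Rc hP c).symm, gM_list _ _ h, gM_list _ _ h]
    · intro R hR hne
      rw [if_neg]
      intro he
      apply hne
      exact nRows_inj hP hR (Rc_max hP (hC c (by simp))) (by rw [nRows_Rc hP, he])
    · intro hn
      exact absurd (Rc_max hP (hC c (by simp))) hn

theorem majP_list (P : Finset Cell) (hP : IsMoon P) (C : List ℤ) (hC : ColOrd P C)
    (hCm : ∀ c, c ∈ C ↔ c ∈ colSet P)
    (L : List Cell) (h : L.Pairwise (fun a b => a.1 < b.1)) (hLP : ∀ x ∈ L, x ∈ P) :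
    majP P L.toFinset = stC comaj P C L := by
  classical
  have hLC : ∀ x ∈ L, x.2 ∈ C := fun x hx => (hCm _).2 (mem_colSet.2 ⟨x.1, hLP x hx⟩)
  let G : Finset Cell → ℕ := fun R => majR (L.toFinset.filter
    (fun x => x.1 ∈ R.image Prod.fst ∧ x.2 ∈ C ∧ nRows R < colLen P x.2))
  have hrow : ∀ c r, r ∈ (Rc P c).image Prod.fst ↔ (r, c) ∈ P := by
    intro c r
    rw [Finset.mem_image]
    constructor
    · rintro ⟨x, hx, rfl⟩
      exact ((mem_Rc hP).1 hx).1
    · intro hr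
      exact ⟨(r, c), (mem_Rc hP).2 ⟨hr, le_rfl⟩, rfl⟩
  have hS1 : ∑ R ∈ maxRects P, majR (L.toFinset ∩ R) =
      ∑ R ∈ maxRects P, (partC P L.toFinset (nRows R) C + G R) := by
    apply Finset.sum_congr rfl
    intro R hR
    obtain ⟨c0, hc0, rfl⟩ := max_Rc hP hR
    simp only [G, hrow, nRows_Rc hP]
    rw [partC_tele P hP L h c0 C hC]
    congr 1
    ext x
    simp only [Finset.mem_inter, Finset.mem_filter, List.mem_toFinset, mem_Rc hP]
    grind
  have hS2 : ∑ p ∈ (maxRects P ×ˢ maxRects P).filter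
        (fun p => nRows p.1 < nRows p.2 ∧
          ∀ T ∈ maxRects P, ¬ (nRows p.1 < nRows T ∧ nRows T < nRows p.2)),
      majR (L.toFinset ∩ p.1 ∩ p.2) = ∑ R ∈ maxRects P, G R := by
    rw [Finset.sum_filter, Finset.sum_product]
    apply Finset.sum_congr rfl
    intro R hR
    obtain ⟨c0, hc0, rfl⟩ := max_Rc hP hR
    simp only [G, hrow, nRows_Rc hP]
    rcases ((maxRects P).filter (fun T => colLen P c0 < nRows T)).eq_empty_or_nonempty with he | hne
    · rw [Finset.filter_eq_empty_iff] at he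
      rw [Finset.sum_eq_zero]
      · have : L.toFinset.filter
            (fun x => (x.1, c0) ∈ P ∧ x.2 ∈ C ∧ colLen P c0 < colLen P x.2) = ∅ := by
          rw [Finset.filter_eq_empty_iff]
          rintro x _ ⟨_, h2, h3⟩
          apply he (Rc_max hP ((hCm _).1 h2))
          rw [nRows_Rc hP]; exact h3
        rw [this]; simp [majR]
      · intro T hT
        rw [if_neg]
        rintro ⟨h1, _⟩
        exact he hT h1
    · obtain ⟨R1, hR1, hmin⟩ := Finset.exists_min_image _ nRows hne
      rw [Finset.mem_filter] at hR1
      rw [Finset.sum_eq_single R1, if_pos]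
      · obtain ⟨c1, hc1, rfl⟩ := max_Rc hP hR1.1
        have hlt := hR1.2
        rw [nRows_Rc hP] at hlt
        congr 1
        ext x
        simp only [Finset.mem_inter, Finset.mem_filter, List.mem_toFinset, mem_Rc hP]
        constructor
        · rintro ⟨⟨h1, h2, h3⟩, h4, h5⟩
          exact ⟨h1, h2, hLC x h1, lt_of_lt_of_le hlt h5⟩
        · rintro ⟨h1, h2, h3, h4⟩
          refine ⟨⟨h1, h2, h4.le⟩, (len_le P hP.2.2 _ _).1 hlt.le _ h2, ?_⟩
          have := hmin (Rc P x.2) (Finset.mem_filter.2 ⟨Rc_max hP ((hCm _).1 h3), by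
            rw [nRows_Rc hP]; exact h4⟩)
          rwa [nRows_Rc hP, nRows_Rc hP] at this
      · refine ⟨hR1.2, ?_⟩
        rintro T hT ⟨h1, h2⟩
        exact absurd (hmin T (Finset.mem_filter.2 ⟨hT, h1⟩)) (not_le.2 h2)
      · intro T hT hne
        rw [if_neg]
        rintro ⟨h1, h2⟩
        apply hne
        refine nRows_inj hP hT hR1.1 (le_antisymm ?_ (hmin T (Finset.mem_filter.2 ⟨hT, h1⟩)))
        by_contra hh
        exact h2 R1 hR1.1 ⟨hR1.2, not_le.1 hh⟩
      · intro hn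
        exact absurd hR1.1 hn
  have hS3 := sum_partC P hP L h C (fun c hc => (hCm c).1 hc)
  rw [Finset.sum_add_distrib, hS3] at hS1
  unfold majP
  rw [hS1, ← hS2]
  exact Nat.add_sub_cancel _ _

/-! ### fillings as words -/

theorem zip_rows {T w : List ℤ} (hT : T.Pairwise (· < ·)) (hw : w.length = T.length) :
    (T.zip w).Pairwise (fun a b => a.1 < b.1) := by
  have := List.map_fst_zip (l₁ := T) (l₂ := w) hw.ge
  rw [← this, List.pairwise_map] at hT
  exact hT

theorem zip_count {T w : List ℤ} (hT : T.Pairwise (· < ·)) (hw : w.length = T.length) (c : ℤ) :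
    ((T.zip w).toFinset.filter (fun x => x.2 = c)).card = w.count c := by
  have hnd := rows_nodup (zip_rows hT hw)
  have e : (T.zip w).toFinset.filter (fun x => x.2 = c) =
      ((T.zip w).filter (fun x => decide (x.2 = c))).toFinset := by
    ext x
    simp only [Finset.mem_filter, List.mem_toFinset, List.mem_filter, decide_eq_true_eq]
  rw [e, List.toFinset_card_of_nodup (hnd.filter _), ← List.countP_eq_length_filter]
  have := List.map_snd_zip (l₁ := T) (l₂ := w) hw.le
  conv_rhs => rw [← this, List.count, List.countP_map]
  apply List.countP_congr
  intro x _
  simp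

theorem fill_eq (P : Finset Cell) (s : ℤ → ℕ) (A : Finset ℤ) (C T : List ℤ)
    (hCm : ∀ c, c ∈ C ↔ c ∈ colSet P) (hT : T.Pairwise (· < ·))
    (hTm : ∀ r, r ∈ T ↔ r ∈ rowSet P ∧ r ∉ A) :
    FillSet P s A = (Words P C s T).image (fun w => (T.zip w).toFinset) := by
  classical
  ext M
  rw [Finset.mem_image, FillSet, Finset.mem_filter, Finset.mem_powerset]
  constructor
  · rintro ⟨hM, hrow, hcol, hem⟩
    have hex : ∀ r, r ∈ T → ∃ c, (r, c) ∈ M := by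
      intro r hr
      rw [hTm] at hr
      have := mt (hem r hr.1).2 hr.2
      push Not at this
      obtain ⟨⟨a, b⟩, hx, hxr⟩ := this
      simp only at hxr
      subst hxr
      exact ⟨b, hx⟩
    choose! κ hκ using hex
    have hz : T.zip (T.map κ) = T.map (fun r => (r, κ r)) := by
      clear hT hTm hκ
      induction T with
      | nil => rfl
      | cons r T ih => simp [ih]
    have hlen : (T.map κ).length = T.length := by simp
    have hMe : (T.zip (T.map κ)).toFinset = M := by
      rw [hz]
      ext x
      rw [List.mem_toFinset, List.mem_map]
      constructor
      · rintro ⟨r, hr, rfl⟩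
        exact hκ r hr
      · intro hx
        have hxr : x.1 ∈ rowSet P := Finset.mem_image.2 ⟨x, hM hx, rfl⟩
        have hxT : x.1 ∈ T := by
          rw [hTm]
          refine ⟨hxr, fun hA => ?_⟩
          exact (hem _ hxr).1 hA x hx rfl
        exact ⟨x.1, hxT, hrow _ (hκ _ hxT) _ hx rfl⟩
    refine ⟨T.map κ, ?_, hMe⟩
    rw [mem_Words]
    refine ⟨⟨hlen, ?_⟩, ?_⟩
    · intro x hx
      have hxM : x ∈ M := by rw [← hMe, List.mem_toFinset]; exact hx
      exact ⟨hM hxM, (hCm _).2 (mem_colSet.2 ⟨x.1, hM hxM⟩)⟩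
    · intro c hc
      rw [← zip_count hT hlen, hMe]
      exact hcol c ((hCm c).1 hc)
  · rintro ⟨w, hw, rfl⟩
    rw [mem_Words] at hw
    obtain ⟨⟨hlen, hmem⟩, hcount⟩ := hw
    have hfst := List.map_fst_zip (l₁ := T) (l₂ := w) hlen.ge
    refine ⟨?_, ?_, ?_, ?_⟩
    · intro x hx
      rw [List.mem_toFinset] at hx
      exact (hmem x hx).1
    · intro x hx y hy hxy
      rw [List.mem_toFinset] at hx hy
      refine List.inj_on_of_nodup_map (f := Prod.fst) (l := T.zip w) ?_ hx hy hxy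
      rw [hfst]
      exact hT.imp (fun h => ne_of_lt h)
    · intro c hc
      rw [zip_count hT hlen]
      exact hcount c ((hCm c).2 hc)
    · intro r hr
      have h1 : r ∈ T ↔ ∃ x ∈ T.zip w, x.1 = r := by
        conv_lhs => rw [← hfst]
        rw [List.mem_map]
      constructor
      · intro hA x hx hxr
        rw [List.mem_toFinset] at hx
        exact ((hTm r).1 (h1.2 ⟨x, hx, hxr⟩)).2 hA
      · intro hall
        by_contra hA
        obtain ⟨x, hx, hxr⟩ := h1.1 ((hTm r).2 ⟨hr, hA⟩)
        exact hall x (List.mem_toFinset.2 hx) hxr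

theorem zip_inj (P : Finset Cell) (s : ℤ → ℕ) (C T : List ℤ) (hT : T.Pairwise (· < ·)) :
    Set.InjOn (fun w => (T.zip w).toFinset) (Words P C s T : Set (List ℤ)) := by
  intro w hw v hv h
  rw [Finset.mem_coe, mem_Words] at hw hv
  have pw := zip_rows hT hw.1.1
  have pv := zip_rows hT hv.1.1
  have hp := List.perm_of_nodup_nodup_toFinset_eq (rows_nodup pw) (rows_nodup pv) h
  have he := hp.eq_of_pairwise (fun a b _ _ h1 h2 => absurd h1 (lt_asymm h2)) pw pv
  rw [← List.map_snd_zip (l₁ := T) (l₂ := w) hw.1.1.le, he,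
    List.map_snd_zip (l₁ := T) (l₂ := v) hv.1.1.le]

theorem glue {α : Type} [Nonempty α] (S : Finset α) (f g : α → ℕ)
    (h : ∑ x ∈ S, (X : ℕ[X]) ^ f x = ∑ x ∈ S, (X : ℕ[X]) ^ g x) :
    ∃ ψ : α → α, Set.BijOn ψ ↑S ↑S ∧ ∀ x ∈ S, f x = g (ψ x) := by
  classical
  have hk : ∀ k, (S.filter (fun x => f x = k)).card = (S.filter (fun x => g x = k)).card := by
    intro k
    have := congrArg (fun p => Polynomial.coeff p k) h
    simp only [Polynomial.finset_sum_coeff, Polynomial.coeff_X_pow] at this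
    simpa [Finset.sum_boole, eq_comm] using this
  have hb : ∀ k, ∃ φ : α → α, Set.BijOn φ (S.filter (fun x => f x = k) : Set α)
      (S.filter (fun x => g x = k) : Set α) := by
    intro k
    apply (Finset.finite_toSet _).exists_bijOn_of_encard_eq
    rw [Set.encard_coe_eq_coe_finsetCard, Set.encard_coe_eq_coe_finsetCard, hk]
  choose φ hφ using hb
  have hval : ∀ x ∈ S, φ (f x) x ∈ S ∧ g (φ (f x) x) = f x := by
    intro x hx
    have := (hφ (f x)).mapsTo (Finset.mem_coe.2 (Finset.mem_filter.2 ⟨hx, rfl⟩))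
    exact Finset.mem_filter.1 (Finset.mem_coe.1 this)
  refine ⟨fun x => φ (f x) x, ⟨?_, ?_, ?_⟩, fun x hx => (hval x hx).2.symm⟩
  · intro x hx
    exact (hval x hx).1
  · intro x hx y hy hxy
    simp only at hxy
    have e : f x = f y := by rw [← (hval x hx).2, ← (hval y hy).2, hxy]
    rw [← e] at hxy
    exact (hφ (f x)).injOn (Finset.mem_coe.2 (Finset.mem_filter.2 ⟨hx, rfl⟩))
      (Finset.mem_coe.2 (Finset.mem_filter.2 ⟨hy, e.symm⟩)) hxy
  · intro y hy
    obtain ⟨x, hx, hxy⟩ := (hφ (g y)).surjOn (Finset.mem_coe.2 (Finset.mem_filter.2 ⟨hy, rfl⟩))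
    have hx' := Finset.mem_filter.1 (Finset.mem_coe.1 hx)
    refine ⟨x, hx'.1, ?_⟩
    simp only
    rw [hx'.2]
    exact hxy

/-- **Theorem (STATEMENT 15, Theorem 5.10).** For any moon polyomino `P`, column sums `s`
and empty rows `A`, there is a bijection `ψ` of `F(P,s;A)` onto itself with
`maj(M) = ne(ψ(M))` for every `M`. -/
theorem foata_bijection_moon (P : Finset Cell) (hP : IsMoon P)
    (s : ℤ → ℕ) (A : Finset ℤ) (hA : A ⊆ rowSet P) :
    ∃ ψ : Finset Cell → Finset Cell,
      Set.BijOn ψ ↑(FillSet P s A) ↑(FillSet P s A) ∧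
      ∀ M ∈ FillSet P s A, majP P M = neP P (ψ M) := by
  apply glue
  obtain ⟨C, hC, hCm⟩ := exists_colOrd P hP (colSet P)
  have hT : ((rowSet P \ A).sort (· ≤ ·)).Pairwise (· < ·) := (Finset.sortedLT_sort _).pairwise
  have hTm : ∀ r, r ∈ (rowSet P \ A).sort (· ≤ ·) ↔ r ∈ rowSet P ∧ r ∉ A := by
    intro r
    rw [Finset.mem_sort, Finset.mem_sdiff]
  generalize (rowSet P \ A).sort (· ≤ ·) = T at hT hTm
  rw [fill_eq P s A C T hCm hT hTm, Finset.sum_image (zip_inj P s C T hT),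
    Finset.sum_image (zip_inj P s C T hT)]
  obtain ⟨Q, hQ⟩ := list_main P hP.2.1 s C hC T hT
  have e1 : ∑ w ∈ Words P C s T, (X : ℕ[X]) ^ majP P (T.zip w).toFinset = Q := by
    rw [← hQ comaj good_comaj]
    apply Finset.sum_congr rfl
    intro w hw
    rw [mem_Words] at hw
    rw [majP_list P hP C hC hCm _ (zip_rows hT hw.1.1) (fun x hx => (hw.1.2 x hx).1)]
  have e2 : ∑ w ∈ Words P C s T, (X : ℕ[X]) ^ neP P (T.zip w).toFinset = Q := by
    rw [← hQ linv good_linv]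
    apply Finset.sum_congr rfl
    intro w hw
    rw [mem_Words] at hw
    rw [← neP_list P hP C hC _ (zip_rows hT hw.1.1) (fun x hx => (hw.1.2 x hx).1),
      Finset.filter_true_of_mem]
    intro x hx
    exact (hw.1.2 x (List.mem_toFinset.1 hx)).2
  rw [e1, e2]

end MoonPolyomino
end

section
/- Let M be a 01-filling of a left-aligned stack polyomino 𝓜 with top row r, let 𝓕 be the maximal Ferrers diagram contained in 𝓜 that contains the top row r, let F be the restriction of M to 𝓕, let M₁ be the filling of 𝓜 with row r deleted obtained from M by deleting the top row, and let F₁ be F with the top row deleted. Then maj(M) − maj(M₁) = maj(F) − maj(F₁). -/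
open Polynomial

namespace MoonPolyomino

open scoped Classical in
/-- The maximal Ferrers diagram contained in `P` containing the top row `r₀`: the cells
whose whole column segment up to row `r₀` lies in `P`. -/
noncomputable def ferrersTop (P : Finset Cell) (r₀ : ℤ) : Finset Cell :=
  P.filter fun x => ∀ a : ℤ, r₀ ≤ a → a ≤ x.1 → (a, x.2) ∈ P

theorem desR_mono {N N' : Finset Cell} (h : N ⊆ N')
    (hc : ∀ x ∈ N, ∀ y ∈ N, ∀ z ∈ N', x.1 < z.1 → z.1 < y.1 → z ∈ N) (t : ℤ) :
    desR (N.filter fun x => x.1 ≤ t) ≤ desR (N'.filter fun x => x.1 ≤ t) := by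
  unfold desR
  apply Finset.card_le_card
  intro p hp
  simp only [Finset.mem_filter, Finset.mem_product] at hp ⊢
  obtain ⟨⟨⟨h1, h2⟩, h3, h4⟩, h5, h6, h7⟩ := hp
  refine ⟨⟨⟨h h1, h2⟩, h h3, h4⟩, h5, h6, ?_⟩
  rintro z ⟨hz, hz2⟩ ⟨ha, hb⟩
  exact h7 z ⟨hc _ h1 _ h3 _ hz ha hb, hz2⟩ ⟨ha, hb⟩

theorem majR_mono {N N' : Finset Cell} (h : N ⊆ N')
    (hc : ∀ x ∈ N, ∀ y ∈ N, ∀ z ∈ N', x.1 < z.1 → z.1 < y.1 → z ∈ N) :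
    majR N ≤ majR N' := by
  unfold majR
  have key : ∑ y ∈ N, desR (N.filter fun x => x.1 ≤ y.1) ≤
      ∑ y ∈ N, desR (N'.filter fun x => x.1 ≤ y.1) := by
    apply Finset.sum_le_sum
    intro y hy
    exact desR_mono h hc y.1
  exact key.trans (Finset.sum_le_sum_of_subset_of_nonneg h (fun _ _ _ => Nat.zero_le _))

/-- The rectangle of columns up to `c` on the rows meeting column `c`. -/
def rectAt (P : Finset Cell) (c : ℤ) : Finset Cell :=
  P.filter fun x => (x.1, c) ∈ P ∧ x.2 ≤ c

/-- Left aligned at column `k`. -/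
def LAt (P : Finset Cell) (k : ℤ) : Prop := ∀ x ∈ P, k ≤ x.2 ∧ (x.1, k) ∈ P

theorem nested {P : Finset Cell} {k : ℤ} (hR : RowConvex P) (hL : LAt P k)
    {r c d : ℤ} (hk : k ≤ c) (hcd : c ≤ d) (h : (r, d) ∈ P) : (r, c) ∈ P :=
  hR r k d c (hL _ h).2 h hk hcd

theorem isRect_rectAt {P : Finset Cell} {k : ℤ} (hR : RowConvex P) (hC : ColConvex P)
    (hL : LAt P k) {r c : ℤ} (h : (r, c) ∈ P) : IsRect (rectAt P c) := by
  have hk : k ≤ c := (hL _ h).1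
  set S : Finset ℤ := (P.filter fun x => x.2 = c).image Prod.fst with hS
  have hmem : ∀ a, a ∈ S ↔ (a, c) ∈ P := by
    intro a
    simp only [hS, Finset.mem_image, Finset.mem_filter, Prod.exists]
    constructor
    · rintro ⟨a', b', ⟨h1, h2⟩, h3⟩
      subst h2 h3
      exact h1
    · intro h
      exact ⟨a, c, ⟨h, rfl⟩, rfl⟩
  have hne : S.Nonempty := ⟨r, (hmem r).2 h⟩
  refine ⟨S.min' hne, S.max' hne, k, c, Finset.min'_le_max' _ hne, hk, ?_⟩
  have hmin := (hmem _).1 (S.min'_mem hne)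
  have hmax := (hmem _).1 (S.max'_mem hne)
  ext ⟨a, b⟩
  simp only [rectAt, Finset.mem_filter, Finset.mem_product, Finset.mem_Icc]
  constructor
  · rintro ⟨h1, h2, h3⟩
    exact ⟨⟨S.min'_le _ ((hmem _).2 h2), S.le_max' _ ((hmem _).2 h2)⟩, (hL _ h1).1, h3⟩
  · rintro ⟨⟨h1, h2⟩, h3, h4⟩
    have := hC c _ _ a hmin hmax h1 h2
    exact ⟨nested hR hL h3 h4 this, this, h4⟩

/-- Columns strictly containing the next one. -/
def Brk (P : Finset Cell) (c : ℤ) : Prop := ∃ r, (r, c) ∈ P ∧ (r, c + 1) ∉ P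

theorem isMaxRect_iff {P : Finset Cell} {k : ℤ} (hR : RowConvex P) (hC : ColConvex P)
    (hL : LAt P k) (R : Finset Cell) :
    IsMaxRect P R ↔ ∃ c, Brk P c ∧ rectAt P c = R := by
  constructor
  · rintro ⟨⟨r₁, r₂, a, b, hr, hab, rfl⟩, hsub, hmax⟩
    have hb : ∀ r, r₁ ≤ r → r ≤ r₂ → (r, b) ∈ P := fun r h1 h2 =>
      hsub (by simp [h1, h2, hab])
    have h1 : Finset.Icc r₁ r₂ ×ˢ Finset.Icc a b ⊆ rectAt P b := by
      intro x hx
      have hxP := hsub hx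
      simp only [Finset.mem_product, Finset.mem_Icc] at hx
      simp only [rectAt, Finset.mem_filter]
      exact ⟨hxP, hb _ hx.1.1 hx.1.2, hx.2.2⟩
    have hbP := hb r₁ le_rfl hr
    have h2 := hmax _ (isRect_rectAt hR hC hL hbP) (Finset.filter_subset _ _) h1
    refine ⟨b, ?_, h2⟩
    by_contra hn
    have hn' : ∀ r, (r, b) ∈ P → (r, b + 1) ∈ P := by
      intro r hr; by_contra h; exact hn ⟨r, hr, h⟩
    have h3 := hmax (rectAt P (b+1)) (isRect_rectAt hR hC hL (hn' _ hbP))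
      (Finset.filter_subset _ _) (by
        rw [← h2]
        intro x hx
        simp only [rectAt, Finset.mem_filter] at hx ⊢
        exact ⟨hx.1, hn' _ hx.2.1, by omega⟩)
    have : (r₁, b + 1) ∈ rectAt P (b + 1) := by
      simp [rectAt, hn' _ hbP]
    rw [h3] at this
    simp at this
  · rintro ⟨c, ⟨r, hr, hr'⟩, rfl⟩
    refine ⟨isRect_rectAt hR hC hL hr, Finset.filter_subset _ _, ?_⟩
    rintro R' ⟨r₁, r₂, a, b, hr₁, hab, rfl⟩ hsub hle
    refine Finset.Subset.antisymm ?_ hle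
    have h0 : (r, c) ∈ rectAt P c := by simp [rectAt, hr]
    have h0' := hle h0
    simp only [Finset.mem_product, Finset.mem_Icc] at h0'
    have hbc : b = c := by
      by_contra hne
      apply hr'
      apply hsub
      simp only [Finset.mem_product, Finset.mem_Icc]
      omega
    intro x hx
    have hxP := hsub hx
    simp only [Finset.mem_product, Finset.mem_Icc] at hx
    simp only [rectAt, Finset.mem_filter]
    refine ⟨hxP, hsub ?_, by omega⟩
    simp only [Finset.mem_product, Finset.mem_Icc]
    omega

theorem rectAt_injOn {P : Finset Cell} {c d : ℤ} (hc : Brk P c) (hd : Brk P d)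
    (h : rectAt P c = rectAt P d) : c = d := by
  obtain ⟨r, hr, -⟩ := hc
  obtain ⟨s, hs, -⟩ := hd
  have h1 : (r, c) ∈ rectAt P c := by simp [rectAt, hr]
  have h2 : (s, d) ∈ rectAt P d := by simp [rectAt, hs]
  rw [h] at h1
  rw [← h] at h2
  simp only [rectAt, Finset.mem_filter] at h1 h2
  omega

theorem nRows_lt_s16 {P : Finset Cell} {k : ℤ} (hR : RowConvex P) (hL : LAt P k) {c d : ℤ}
    (hc : Brk P c) (hcd : c < d) : nRows (rectAt P d) < nRows (rectAt P c) := by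
  obtain ⟨r, hr, hr'⟩ := hc
  have hk := (hL _ hr).1
  simp only at hk
  unfold nRows
  apply Finset.card_lt_card
  rw [Finset.ssubset_iff_of_subset]
  · refine ⟨r, Finset.mem_image.2 ⟨(r, c), by simp [rectAt, hr], rfl⟩, ?_⟩
    intro h
    obtain ⟨x, hx, rfl⟩ := Finset.mem_image.1 h
    simp only [rectAt, Finset.mem_filter] at hx
    exact hr' (nested hR hL (by omega) (by omega) hx.2.1)
  · intro s hs
    obtain ⟨x, hx, rfl⟩ := Finset.mem_image.1 hs
    simp only [rectAt, Finset.mem_filter] at hx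
    have := nested hR hL hk hcd.le hx.2.1
    exact Finset.mem_image.2 ⟨(x.1, c), by simp [rectAt, this], rfl⟩

theorem nRows_lt_iff {P : Finset Cell} {k : ℤ} (hR : RowConvex P) (hL : LAt P k) {c d : ℤ}
    (hc : Brk P c) (hd : Brk P d) : nRows (rectAt P d) < nRows (rectAt P c) ↔ c < d := by
  refine ⟨fun h => ?_, nRows_lt_s16 hR hL hc⟩
  by_contra hn
  rcases eq_or_lt_of_le (not_lt.1 hn) with h' | h'
  · subst h'; exact lt_irrefl _ h
  · exact lt_asymm h (nRows_lt_s16 hR hL hd h')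

theorem col_eq {P : Finset Cell} {k : ℤ} (hR : RowConvex P) (hL : LAt P k) {c d : ℤ}
    (hk : k ≤ c) (hcd : c ≤ d) (h : ∀ e, c ≤ e → e < d → ¬ Brk P e) (r : ℤ) :
    (r, c) ∈ P ↔ (r, d) ∈ P := by
  refine ⟨fun hr => ?_, nested hR hL hk hcd⟩
  induction d, hcd using Int.leInduction with
  | base => exact hr
  | succ n hn ih =>
    have h1 := ih (fun e h1 h2 => h e h1 (by omega))
    by_contra hne
    exact h n hn (by omega) ⟨r, h1, hne⟩

/-- first and second terms -/
def setA (P M : Finset Cell) (c : ℤ) : Finset Cell :=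
  M.filter fun x => (x.1, c) ∈ P ∧ x.2 ≤ c

/-- second term -/
def setB (P M : Finset Cell) (c : ℤ) : Finset Cell :=
  M.filter fun x => (x.1, c + 1) ∈ P ∧ x.2 ≤ c

theorem majR_empty : majR ∅ = 0 := by simp [majR]

open scoped Classical in
theorem majP_eq {P : Finset Cell} {k l : ℤ} (hR : RowConvex P) (hC : ColConvex P)
    (hL : LAt P k) (hl : ∀ x ∈ P, x.2 ≤ l) (M : Finset Cell) (hM : M ⊆ P) :
    (majP P M : ℤ) = ∑ c ∈ Finset.Icc k l,
      ((majR (setA P M c) : ℤ) - (majR (setB P M c) : ℤ)) := by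
  set C : Finset ℤ := (Finset.Icc k l).filter (Brk P) with hCdef
  have hmemC : ∀ c, c ∈ C ↔ Brk P c := by
    intro c
    simp only [hCdef, Finset.mem_filter, Finset.mem_Icc]
    refine ⟨fun h => h.2, fun h => ⟨?_, h⟩⟩
    obtain ⟨r, hr, -⟩ := h
    exact ⟨(hL _ hr).1, hl _ hr⟩
  have hk : ∀ c, Brk P c → k ≤ c := fun c ⟨r, hr, _⟩ => (hL _ hr).1
  have hmax : maxRects P = C.image (rectAt P) := by
    ext R
    simp only [maxRects, Finset.mem_filter, Finset.mem_powerset, Finset.mem_image, hmemC,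
      isMaxRect_iff hR hC hL]
    refine ⟨fun h => h.2, fun h => ⟨?_, h⟩⟩
    obtain ⟨c, -, rfl⟩ := h
    exact Finset.filter_subset _ _
  have hinj : Set.InjOn (rectAt P) (C : Set ℤ) := by
    intro c hc d hd h
    exact rectAt_injOn ((hmemC c).1 hc) ((hmemC d).1 hd) h
  have hA : ∀ c, M ∩ rectAt P c = setA P M c := by
    intro c
    ext x
    simp only [rectAt, setA, Finset.mem_inter, Finset.mem_filter]
    exact ⟨fun h => ⟨h.1, h.2.2⟩, fun h => ⟨h.1, hM h.1, h.2⟩⟩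
  have h1 : ∑ R ∈ maxRects P, majR (M ∩ R) = ∑ c ∈ C, majR (setA P M c) := by
    rw [hmax, Finset.sum_image hinj]
    simp only [hA]
  have h2 : ∑ p ∈ (maxRects P ×ˢ maxRects P).filter
        (fun p => nRows p.1 < nRows p.2 ∧
          ∀ T ∈ maxRects P, ¬ (nRows p.1 < nRows T ∧ nRows T < nRows p.2)),
      majR (M ∩ p.1 ∩ p.2) = ∑ c ∈ C, majR (setB P M c) := by
    rw [Finset.sum_filter, Finset.sum_product_right, hmax, Finset.sum_image hinj]
    apply Finset.sum_congr rfl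
    intro c hc
    rw [Finset.sum_image hinj]
    have hbc := (hmemC c).1 hc
    have hcond : ∀ d ∈ C, (nRows (rectAt P d) < nRows (rectAt P c) ∧
        ∀ T ∈ C.image (rectAt P), ¬ (nRows (rectAt P d) < nRows T ∧
          nRows T < nRows (rectAt P c))) ↔ (c < d ∧ ∀ e ∈ C, ¬ (e < d ∧ c < e)) := by
      intro d hd
      rw [nRows_lt_iff hR hL hbc ((hmemC d).1 hd), Finset.forall_mem_image]
      refine and_congr_right fun _ => forall₂_congr fun e he => ?_
      rw [nRows_lt_iff hR hL hbc ((hmemC e).1 he),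
        nRows_lt_iff hR hL ((hmemC e).1 he) ((hmemC d).1 hd)]
    have hstep : ∀ d ∈ C, (if (nRows (rectAt P d) < nRows (rectAt P c) ∧
        ∀ T ∈ C.image (rectAt P), ¬ (nRows (rectAt P d) < nRows T ∧
          nRows T < nRows (rectAt P c))) then majR (M ∩ rectAt P d ∩ rectAt P c) else 0)
        = if (c < d ∧ ∀ e ∈ C, ¬ (e < d ∧ c < e)) then majR (setB P M c) else 0 := by
      intro d hd
      rw [if_congr (hcond d hd) rfl rfl]
      split_ifs with h
      · congr 1
        ext x
        have := col_eq hR hL (c := c + 1) (d := d) (by linarith [hk c hbc]) (by omega)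
          (fun e h1 h2 he => h.2 e ((hmemC e).2 he) ⟨h2, by omega⟩) x.1
        simp only [rectAt, setB, Finset.mem_inter, Finset.mem_filter, this]
        constructor
        · rintro ⟨⟨h1, -, h2, -⟩, -, -, h3⟩
          exact ⟨h1, h2, h3⟩
        · rintro ⟨h1, h2, h3⟩
          exact ⟨⟨h1, hM h1, h2, by omega⟩, hM h1, nested hR hL (hk c hbc) h.1.le h2, h3⟩
      · rfl
    rw [Finset.sum_congr rfl hstep]
    by_cases hne : (C.filter fun d => c < d).Nonempty
    · have hm := Finset.min'_mem _ hne
      have hle : ∀ e ∈ C, c < e → (C.filter fun d => c < d).min' hne ≤ e := fun e he hce =>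
        Finset.min'_le _ _ (Finset.mem_filter.2 ⟨he, hce⟩)
      generalize (C.filter fun d => c < d).min' hne = m at hm hle
      rw [Finset.mem_filter] at hm
      rw [Finset.sum_eq_single_of_mem m hm.1, if_pos]
      · refine ⟨hm.2, fun e he h => ?_⟩
        have := hle e he h.2
        omega
      · intro d hd hdm
        rw [if_neg]
        rintro ⟨h1, h2⟩
        have := hle d hd h1
        exact h2 m hm.1 ⟨by omega, hm.2⟩
    · rw [Finset.not_nonempty_iff_eq_empty, Finset.filter_eq_empty_iff] at hne
      rw [Finset.sum_eq_zero (fun d hd => if_neg (fun h => hne hd h.1))]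
      have hcl : c ≤ l := by
        obtain ⟨r, hr, -⟩ := hbc
        exact hl _ hr
      have : setB P M c = ∅ := by
        rw [setB, Finset.filter_eq_empty_iff]
        rintro x hx ⟨h1, -⟩
        rw [col_eq hR hL (c := c + 1) (d := l + 1) (by linarith [hk c hbc]) (by omega)
          (fun e h1 h2 he => hne ((hmemC e).2 he) (by omega)) x.1] at h1
        have := hl _ h1
        simp only at this
        omega
      rw [this, majR_empty]
  have h3 : ∀ c ∈ C, majR (setB P M c) ≤ majR (setA P M c) := by
    intro c hc
    have hkc := hk c ((hmemC c).1 hc)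
    apply majR_mono
    · intro x hx
      simp only [setA, setB, Finset.mem_filter] at hx ⊢
      exact ⟨hx.1, nested hR hL hkc (by omega) hx.2.1, hx.2.2⟩
    · intro x hx y hy z hz hxz hzy
      simp only [setA, setB, Finset.mem_filter] at hx hy hz ⊢
      exact ⟨hz.1, hC _ _ _ _ hx.2.1 hy.2.1 hxz.le hzy.le, hz.2.2⟩
  have h4 : majP P M = ∑ c ∈ C, majR (setA P M c) - ∑ c ∈ C, majR (setB P M c) := by
    rw [← h1, ← h2]
    rfl
  rw [h4, Nat.cast_sub (Finset.sum_le_sum h3)]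
  push_cast
  rw [← Finset.sum_sub_distrib]
  apply Finset.sum_subset (Finset.filter_subset _ _)
  intro c hc hcC
  rw [sub_eq_zero]
  congr 2
  ext x
  have hn : ¬ Brk P c := fun h => hcC ((hmemC c).2 h)
  have := col_eq hR hL (Finset.mem_Icc.1 hc).1 (by omega : c ≤ c + 1)
    (fun e h1 h2 he => hn (by rwa [show c = e by omega])) x.1
  simp only [setA, setB, Finset.mem_filter, this]

theorem rc_filter {P : Finset Cell} (hR : RowConvex P) (r₀ : ℤ) :
    RowConvex (P.filter fun x => x.1 ≠ r₀) := by
  intro r a b c h1 h2 h3 h4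
  simp only [Finset.mem_filter] at h1 h2 ⊢
  exact ⟨hR r a b c h1.1 h2.1 h3 h4, h1.2⟩

theorem cc_filter {P : Finset Cell} (hC : ColConvex P) {r₀ : ℤ} (ht : ∀ x ∈ P, r₀ ≤ x.1) :
    ColConvex (P.filter fun x => x.1 ≠ r₀) := by
  intro r a b c h1 h2 h3 h4
  simp only [Finset.mem_filter] at h1 h2 ⊢
  have := ht _ h1.1
  simp only at this
  exact ⟨hC r a b c h1.1 h2.1 h3 h4, by omega⟩

theorem la_filter {P : Finset Cell} {k : ℤ} (hL : LAt P k) (r₀ : ℤ) :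
    LAt (P.filter fun x => x.1 ≠ r₀) k := by
  intro x hx
  simp only [Finset.mem_filter] at hx ⊢
  exact ⟨(hL x hx.1).1, (hL x hx.1).2, hx.2⟩

theorem mem_ferrersTop {P : Finset Cell} (hC : ColConvex P) {r₀ : ℤ}
    (ht : ∀ x ∈ P, r₀ ≤ x.1) (r c : ℤ) :
    (r, c) ∈ ferrersTop P r₀ ↔ (r, c) ∈ P ∧ (r₀, c) ∈ P := by
  simp only [ferrersTop, Finset.mem_filter]
  constructor
  · rintro ⟨h1, h2⟩
    exact ⟨h1, h2 r₀ le_rfl (ht _ h1)⟩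
  · rintro ⟨h1, h2⟩
    exact ⟨h1, fun a ha hb => hC c _ _ a h2 h1 ha hb⟩

/-- **Theorem (STATEMENT 16, Lemma 5.5).** Let `M` be a filling of a left-aligned stack
polyomino `P` with top row `r₀`, let `𝓕` be the maximal Ferrers diagram in `P` containing
the top row, `F = M ∩ 𝓕`, and let `M₁` (resp. `F₁`) be `M` (resp. `F`) with the top row
deleted, as a filling of `P` (resp. `𝓕`) with the top row deleted.  Then
`maj(M) − maj(M₁) = maj(F) − maj(F₁)`. -/
theorem maj_top_row_difference (P : Finset Cell) (hP : IsMoon P) (hL : LeftAligned P)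
    (M : Finset Cell) (hM : IsFilling P M)
    (r₀ : ℤ) (hr₀ : r₀ ∈ rowSet P) (htop : ∀ x ∈ P, r₀ ≤ x.1) :
    (majP P M : ℤ) - (majP (P.filter fun x => x.1 ≠ r₀) (M.filter fun x => x.1 ≠ r₀) : ℤ)
      = (majP (ferrersTop P r₀) (M ∩ ferrersTop P r₀) : ℤ)
        - (majP ((ferrersTop P r₀).filter fun x => x.1 ≠ r₀)
            ((M ∩ ferrersTop P r₀).filter fun x => x.1 ≠ r₀) : ℤ) := by
  obtain ⟨hR, hC, -⟩ := hP
  obtain ⟨k, hk⟩ := hL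
  have hL : LAt P k := hk
  obtain ⟨l, hl⟩ : ∃ l : ℤ, ∀ x ∈ P, x.2 ≤ l := by
    obtain ⟨l, hl⟩ := (P.image Prod.snd).bddAbove
    exact ⟨l, fun x hx => hl (Finset.mem_coe.2 (Finset.mem_image_of_mem _ hx))⟩
  have hr0k : (r₀, k) ∈ P := by
    obtain ⟨x, hx, rfl⟩ := Finset.mem_image.1 hr₀
    exact (hL x hx).2
  have hF := mem_ferrersTop hC htop
  have hFP : ∀ x ∈ ferrersTop P r₀, x ∈ P := fun x hx => ((hF x.1 x.2).1 hx).1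
  have hRF : RowConvex (ferrersTop P r₀) := by
    intro r a b c h1 h2 h3 h4
    rw [hF] at h1 h2 ⊢
    exact ⟨hR _ _ _ _ h1.1 h2.1 h3 h4, hR _ _ _ _ h1.2 h2.2 h3 h4⟩
  have hCF : ColConvex (ferrersTop P r₀) := by
    intro r a b c h1 h2 h3 h4
    rw [hF] at h1 h2 ⊢
    exact ⟨hC _ _ _ _ h1.1 h2.1 h3 h4, h1.2⟩
  have hLF : LAt (ferrersTop P r₀) k := by
    intro x hx
    rw [hF]
    exact ⟨(hL x (hFP x hx)).1, (hL x (hFP x hx)).2, hr0k⟩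
  have htF : ∀ x ∈ ferrersTop P r₀, r₀ ≤ x.1 := fun x hx => htop x (hFP x hx)
  have hlF : ∀ x ∈ ferrersTop P r₀, x.2 ≤ l := fun x hx => hl x (hFP x hx)
  have hMP := hM.1
  rw [majP_eq hR hC hL hl M hMP,
    majP_eq (rc_filter hR r₀) (cc_filter hC htop) (la_filter hL r₀)
      (fun x hx => hl x (Finset.filter_subset _ _ hx)) _ (Finset.filter_subset_filter _ hMP),
    majP_eq hRF hCF hLF hlF _ Finset.inter_subset_right,
    majP_eq (rc_filter hRF r₀) (cc_filter hCF htF) (la_filter hLF r₀)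
      (fun x hx => hlF x (Finset.filter_subset _ _ hx)) _
      (Finset.filter_subset_filter _ Finset.inter_subset_right),
    ← Finset.sum_sub_distrib, ← Finset.sum_sub_distrib]
  apply Finset.sum_congr rfl
  intro c hc
  rw [Finset.mem_Icc] at hc
  -- general facts about a column `d` and cells in columns up to `c ≤ d`
  have key1 : ∀ d, c ≤ d → (r₀, d) ∉ P →
      (M.filter fun x => (x.1, d) ∈ P ∧ x.2 ≤ c) =
        ((M.filter fun x => x.1 ≠ r₀).filter fun x =>
          (x.1, d) ∈ (P.filter fun x => x.1 ≠ r₀) ∧ x.2 ≤ c) := by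
    intro d hd h
    ext x
    simp only [Finset.mem_filter]
    have : (x.1, d) ∈ P → x.1 ≠ r₀ := fun h1 h2 => h (h2 ▸ h1)
    exact ⟨fun ⟨a, b, e⟩ => ⟨⟨a, this b⟩, ⟨b, this b⟩, e⟩,
      fun ⟨⟨a, _⟩, ⟨b, _⟩, e⟩ => ⟨a, b, e⟩⟩
  have key2 : ∀ d, (r₀, d) ∉ P →
      ((M ∩ ferrersTop P r₀).filter fun x => (x.1, d) ∈ ferrersTop P r₀ ∧ x.2 ≤ c) = ∅ ∧
      (((M ∩ ferrersTop P r₀).filter fun x => x.1 ≠ r₀).filter fun x =>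
          (x.1, d) ∈ ((ferrersTop P r₀).filter fun x => x.1 ≠ r₀) ∧ x.2 ≤ c) = ∅ := by
    intro d h
    constructor
    · rw [Finset.filter_eq_empty_iff]
      intro x _
      rw [hF]
      exact fun h' => h h'.1.2
    · rw [Finset.filter_eq_empty_iff]
      intro x _
      rw [Finset.mem_filter, hF]
      exact fun h' => h h'.1.1.2
  have key3 : ∀ d, c ≤ d → (r₀, d) ∈ P →
      ((M ∩ ferrersTop P r₀).filter fun x => (x.1, d) ∈ ferrersTop P r₀ ∧ x.2 ≤ c) =
        (M.filter fun x => (x.1, d) ∈ P ∧ x.2 ≤ c) ∧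
      (((M ∩ ferrersTop P r₀).filter fun x => x.1 ≠ r₀).filter fun x =>
          (x.1, d) ∈ ((ferrersTop P r₀).filter fun x => x.1 ≠ r₀) ∧ x.2 ≤ c) =
        ((M.filter fun x => x.1 ≠ r₀).filter fun x =>
          (x.1, d) ∈ (P.filter fun x => x.1 ≠ r₀) ∧ x.2 ≤ c) := by
    intro d hd h
    have hx : ∀ x ∈ M, x.2 ≤ c → x ∈ ferrersTop P r₀ := by
      intro x hx hxc
      exact (hF x.1 x.2).2 ⟨hMP hx, nested hR hL (hL x (hMP hx)).1 (by omega) h⟩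
    constructor
    · ext x
      simp only [Finset.mem_filter, Finset.mem_inter, hF]
      exact ⟨fun ⟨⟨a, _⟩, ⟨b, _⟩, e⟩ => ⟨a, b, e⟩,
        fun ⟨a, b, e⟩ => ⟨⟨a, (hF x.1 x.2).1 (hx x a e)⟩, ⟨b, h⟩, e⟩⟩
    · ext x
      simp only [Finset.mem_filter, Finset.mem_inter, hF]
      exact ⟨fun ⟨⟨⟨a, _⟩, f⟩, ⟨⟨b, _⟩, g⟩, e⟩ => ⟨⟨a, f⟩, ⟨b, g⟩, e⟩,
        fun ⟨⟨a, f⟩, ⟨b, g⟩, e⟩ => ⟨⟨⟨a, (hF x.1 x.2).1 (hx x a e)⟩, f⟩, ⟨⟨b, h⟩, g⟩, e⟩⟩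
  unfold setA setB
  by_cases h1 : (r₀, c) ∈ P
  · rw [(key3 c le_rfl h1).1, (key3 c le_rfl h1).2]
    by_cases h2 : (r₀, c + 1) ∈ P
    · rw [(key3 (c + 1) (by omega) h2).1, (key3 (c + 1) (by omega) h2).2]
    · rw [(key2 (c + 1) h2).1, (key2 (c + 1) h2).2, key1 (c + 1) (by omega) h2]
      ring
  · have h2 : (r₀, c + 1) ∉ P := fun h => h1 (nested hR hL hc.1 (by omega) h)
    rw [(key2 c h1).1, (key2 c h1).2, (key2 (c + 1) h2).1, (key2 (c + 1) h2).2,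
      key1 c le_rfl h1, key1 (c + 1) (by omega) h2]
    ring


end MoonPolyomino
end
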